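/- A non-singular plane curve of degree d in the complex projective plane has genus g = (1/2)(d-1)(d-2). -/

import Mathlib

open MvPolynomial

/-- The quotient topology on the complex projective plane
`ℙ ℂ (Fin 3 → ℂ)` (the projectivization is by definition a quotient of the
set of nonzero vectors, which carries the subspace topology). -/
noncomputable instance : TopologicalSpace (Projectivization ℂ (Fin 3 → ℂ)) :=
  instTopologicalSpaceQuotient

section

open Set Topology

/-- The `k`-valued functions on homotopy classes of paths that are additive under concatenation. -/
def pathCocycles (k X : Type*) [Field k] [TopologicalSpace X] :
    Submodule k (∀ x y : X, Path.Homotopic.Quotient x y → k) where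
  carrier := {φ | ∀ x y z (p : Path.Homotopic.Quotient x y) (q : Path.Homotopic.Quotient y z),
    φ x z (p.trans q) = φ x y p + φ y z q}
  add_mem' {a b} ha hb x y z p q := by
    simp only [Pi.add_apply, ha x y z p q, hb x y z p q]; ring
  zero_mem' x y z p q := by simp
  smul_mem' c a ha x y z p q := by
    simp only [Pi.smul_apply, ha x y z p q, smul_add]

theorem pathQuotient_induction {X ι : Type*} [TopologicalSpace X] {W : ι → Set X}
    (hW : ∀ i, IsOpen (W i)) (hcov : ∀ x, ∃ i, x ∈ W i)
    {P : ∀ x y : X, Path.Homotopic.Quotient x y → Prop}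
    (small : ∀ i x y (γ : Path x y), range γ ⊆ W i → P x y (.mk γ))
    (trans : ∀ x y z (p : Path.Homotopic.Quotient x y) (q : Path.Homotopic.Quotient y z),
      P x y p → P y z q → P x z (p.trans q))
    {x y : X} (p : Path.Homotopic.Quotient x y) : P x y p := by
  induction p using Path.Homotopic.Quotient.ind with | mk γ =>
  obtain ⟨t, t0, tm, ⟨n, hn⟩, ht⟩ := exists_monotone_Icc_subset_open_cover_unitInterval
    (c := fun i ↦ γ ⁻¹' W i) (fun i ↦ (hW i).preimage γ.continuous) (fun s _ ↦ by
      obtain ⟨i, hi⟩ := hcov (γ s); exact mem_iUnion.2 ⟨i, hi⟩)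
  have step : ∀ m, P (γ (t m)) (γ (t (m + 1))) (.mk (γ.subpath (t m) (t (m + 1)))) := by
    intro m
    obtain ⟨i, hi⟩ := ht m
    refine small i _ _ _ ?_
    rw [Path.range_subpath_of_le _ _ _ (tm m.le_succ)]
    rintro _ ⟨s, hs, rfl⟩
    exact hi hs
  have key : ∀ m, P (γ (t 0)) (γ (t (m + 1))) (.mk (γ.subpath (t 0) (t (m + 1)))) := by
    intro m
    induction m with
    | zero => exact step 0
    | succ m ih =>
      have := trans _ _ _ _ _ ih (step (m + 1))
      rw [← Path.Homotopic.Quotient.mk_trans] at this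
      rwa [Path.Homotopic.Quotient.eq.2 ⟨Path.Homotopy.subpathTransSubpath γ _ _ _⟩] at this
  have := key n
  rw [hn (n + 1) (by omega), t0, Path.subpath_zero_one] at this
  have h2 : ∀ {a b : X} (ha : a = x) (hb : b = y), P a b (.mk (γ.cast ha hb)) → P x y (.mk γ) := by
    rintro a b rfl rfl h
    exact h
  exact h2 _ _ this

/-- The covering with fibre `k` glued from the trivial coverings of the `W i` along the locally
constant functions `g i - g j`. -/
def gluedCoveringCore {k X ι : Type*} [Field k] [TopologicalSpace X] [TopologicalSpace k]
    [DiscreteTopology k] (W : ι → Set X) (hW : ∀ i, IsOpen (W i)) (idx : X → ι)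
    (hidx : ∀ x, x ∈ W (idx x)) (g : ι → X → k)
    (hg : ∀ i j x, x ∈ W i → x ∈ W j → ∀ᶠ y in 𝓝 x, g i y - g j y = g i x - g j x) :
    FiberBundleCore ι X k where
  baseSet := W
  isOpen_baseSet := hW
  indexAt := idx
  mem_baseSet_at := hidx
  coordChange i j x v := v + (g i x - g j x)
  coordChange_self i x hx v := by ring
  continuousOn_coordChange i j := by
    rintro ⟨x, v⟩ ⟨⟨hi, hj⟩, -⟩
    refine ContinuousAt.continuousWithinAt ?_
    have h : ∀ᶠ p : X × k in 𝓝 (x, v), v + (g i x - g j x) = p.2 + (g i p.1 - g j p.1) := by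
      have h2 : ∀ᶠ w in 𝓝 v, w = v := by simp [nhds_discrete]
      filter_upwards [(hg i j x hi hj).prod_nhds h2] with p hp
      rw [hp.1, hp.2]
    exact continuousAt_const.congr h
  coordChange_comp i j l x hx v := by ring

theorem exists_pathCocycle_of_cover {k X ι : Type*} [Field k] [TopologicalSpace X] {W : ι → Set X}
    (hW : ∀ i, IsOpen (W i)) (hcov : ∀ x, ∃ i, x ∈ W i) (g : ι → X → k)
    (hg : ∀ i j x, x ∈ W i → x ∈ W j → ∀ᶠ y in 𝓝 x, g i y - g j y = g i x - g j x) :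
    ∃ φ ∈ pathCocycles k X, ∀ i x y (γ : Path x y), range γ ⊆ W i →
      φ x y (.mk γ) = g i y - g i x := by
  let _ : TopologicalSpace k := ⊥
  have _ : DiscreteTopology k := ⟨rfl⟩
  choose idx hidx using hcov
  set Z := gluedCoveringCore W hW idx hidx g hg with hZ
  have cov : IsCoveringMap Z.proj := IsCoveringMap.mk _ (fun _ ↦ k) (fun x ↦ Z.localTriv (idx x))
    (fun x ↦ hidx x)
  let Φ : Z.TotalSpace → k := fun e ↦ (id e.2 : k) + g (idx e.1) e.1
  have small : ∀ i x y (γ : Path x y), range γ ⊆ W i → ∀ e : Z.proj ⁻¹' {x},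
      Φ (cov.monodromy (.mk γ) e) - Φ e = g i y - g i x := by
    rintro i x y γ hγ ⟨⟨x', (v : k)⟩, rfl : x' = x⟩
    set u : k := v + (g (idx x') x' - g i x')
    let Γ : C(unitInterval, Z.TotalSpace) :=
      ⟨fun t ↦ (Z.localTriv i).toOpenPartialHomeomorph.symm (γ t, u), by
        refine (Z.localTriv i).toOpenPartialHomeomorph.continuousOn_symm.comp_continuous
          (γ.continuous.prodMk continuous_const) fun t ↦ ?_
        exact (Z.mem_localTriv_target i _).2 (hγ ⟨t, rfl⟩)⟩
    have hΓ : ∀ t, Γ t = ⟨γ t, u + (g i (γ t) - g (idx (γ t)) (γ t))⟩ := fun t ↦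
      Z.localTriv_symm_apply i _
    have h1 : (cov.monodromy (.mk γ) ⟨⟨x', v⟩, rfl⟩ : Z.TotalSpace) = Γ 1 := by
      refine (DFunLike.congr_fun ((cov.eq_liftPath_iff' (Γ := Γ) _).mpr ⟨?_, ?_⟩) 1).symm
      · ext t; show (Γ t).1 = _; rw [hΓ]; rfl
      · rw [hΓ, γ.source]
        exact congrArg (fun w : k ↦ (⟨x', w⟩ : Z.TotalSpace)) (by simp only [u]; ring)
    rw [h1, hΓ, γ.target]
    simp only [Φ, u, id]
    ring
  have indep : ∀ x y (p : Path.Homotopic.Quotient x y), ∀ e e' : Z.proj ⁻¹' {x},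
      Φ (cov.monodromy p e) - Φ e = Φ (cov.monodromy p e') - Φ e' := by
    intro x y p
    refine pathQuotient_induction (P := fun x y p ↦ ∀ e e' : Z.proj ⁻¹' {x},
      Φ (cov.monodromy p e) - Φ e = Φ (cov.monodromy p e') - Φ e') hW
      (fun x ↦ ⟨idx x, hidx x⟩) ?_ ?_ p
    · intro i x y γ hγ e e'
      rw [small i x y γ hγ, small i x y γ hγ]
    · intro x y z p q hp hq e e'
      rw [cov.monodromy_trans_apply, cov.monodromy_trans_apply]
      linear_combination hp e e' + hq (cov.monodromy p e) (cov.monodromy p e')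
  let e₀ : ∀ x, Z.proj ⁻¹' {x} := fun x ↦ ⟨⟨x, (0 : k)⟩, rfl⟩
  refine ⟨fun x y p ↦ Φ (cov.monodromy p (e₀ x)) - Φ (e₀ x), ?_, ?_⟩
  · intro x y z p q
    beta_reduce
    rw [cov.monodromy_trans_apply, indep y z q (e₀ y) (cov.monodromy p (e₀ x))]
    ring
  · intro i x y γ hγ
    exact small i x y γ hγ _

/-- `ρ` is locally constant near the points of `W`. -/
def LocConstOn {X S : Type*} [TopologicalSpace X] (ρ : X → S) (W : Set X) : Prop :=
  ∀ x ∈ W, ∀ᶠ y in 𝓝 x, ρ y = ρ x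

theorem LocConstOn.path_eq {X S : Type*} [TopologicalSpace X] {ρ : X → S} {W : Set X}
    (h : LocConstOn ρ W) {x y : X} (γ : Path x y) (hγ : range γ ⊆ W) (t : unitInterval) :
    ρ (γ t) = ρ x := by
  have hl : IsLocallyConstant (fun s ↦ ρ (γ s)) := by
    rw [IsLocallyConstant.iff_eventually_eq]
    intro s
    exact γ.continuous.continuousAt.eventually (h (γ s) (hγ ⟨s, rfl⟩))
  have := hl.apply_eq_of_preconnectedSpace t 0
  simpa using this

theorem LocConstOn.joinedIn_eq {X S : Type*} [TopologicalSpace X] {ρ : X → S} {W : Set X}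
    (h : LocConstOn ρ W) {x y : X} (hj : JoinedIn W x y) : ρ y = ρ x := by
  obtain ⟨γ, hγ⟩ := hj
  simpa using h.path_eq γ (by rintro _ ⟨t, rfl⟩; exact hγ t) 1

/-- `A` is path connected, and paths in `A` with common endpoints are homotopic in `X`. -/
def RelSimplyConnected {X : Type*} [TopologicalSpace X] (A : Set X) : Prop :=
  (∀ x ∈ A, ∀ y ∈ A, JoinedIn A x y) ∧
    ∀ (x y : X) (γ γ' : Path x y), range γ ⊆ A → range γ' ⊆ A → γ.Homotopic γ'

theorem exists_primitive_of_relSimplyConnected {k X S : Type*} [Field k] [TopologicalSpace X]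
    {W : Set X} {ρ : X → S} (hρ : LocConstOn ρ W)
    (hsc : ∀ s, RelSimplyConnected (W ∩ ρ ⁻¹' {s}))
    {φ : ∀ x y : X, Path.Homotopic.Quotient x y → k} (hφ : φ ∈ pathCocycles k X) :
    ∃ g : X → k, ∀ x y (γ : Path x y), range γ ⊆ W → φ x y (.mk γ) = g y - g x := by
  classical
  have hb : ∀ s, ∃ g : X → k, ∀ x y (γ : Path x y), range γ ⊆ W ∩ ρ ⁻¹' {s} →
      φ x y (.mk γ) = g y - g x := by
    intro s
    rcases (W ∩ ρ ⁻¹' {s}).eq_empty_or_nonempty with h | ⟨b, hb⟩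
    · exact ⟨0, fun x y γ hγ ↦ absurd (hγ ⟨0, rfl⟩) (by rw [h]; exact notMem_empty _)⟩
    · refine ⟨fun x ↦ if h : JoinedIn (W ∩ ρ ⁻¹' {s}) b x then φ b x (.mk h.somePath) else 0,
        fun x y γ hγ ↦ ?_⟩
      have hx : x ∈ W ∩ ρ ⁻¹' {s} := hγ ⟨0, γ.source⟩
      have hy : y ∈ W ∩ ρ ⁻¹' {s} := hγ ⟨1, γ.target⟩
      have jx := (hsc s).1 b hb x hx
      have jy := (hsc s).1 b hb y hy
      beta_reduce
      rw [dif_pos jx, dif_pos jy]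
      have h1 : (Path.Homotopic.Quotient.mk jy.somePath) = .mk (jx.somePath.trans γ) := by
        refine Path.Homotopic.Quotient.eq.2 ((hsc s).2 _ _ _ _ ?_ ?_)
        · rintro _ ⟨t, rfl⟩; exact jy.somePath_mem t
        · rw [Path.trans_range]
          refine union_subset ?_ hγ
          rintro _ ⟨t, rfl⟩; exact jx.somePath_mem t
      rw [h1, Path.Homotopic.Quotient.mk_trans, hφ]
      ring
  choose g hg using hb
  refine ⟨fun x ↦ g (ρ x) x, fun x y γ hγ ↦ ?_⟩
  have h1 : ∀ t, ρ (γ t) = ρ x := hρ.path_eq γ hγ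
  have h2 : ρ y = ρ x := by simpa using h1 1
  simp only [h2]
  refine hg _ _ _ γ ?_
  rintro _ ⟨t, rfl⟩
  exact ⟨hγ ⟨t, rfl⟩, h1 t⟩

/-- A decomposition of `X` into two opens `Wo`, `Wi` and a cyclically indexed family of disjoint
opens `W j`, each of them a union of relatively simply connected sheets, with the overlaps of the
sheets described by combinatorial data. -/
structure SheetDecomposition (X : Type*) [TopologicalSpace X] (n : ℕ) (S S' : Type*)
    (F : Fin (n + 1) → Type*) where
  Wo : Set X
  Wi : Set X
  W : Fin (n + 1) → Set X
  ρo : X → S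
  ρi : X → S'
  ρ : ∀ j, X → F j
  q : X → Fin (n + 1)
  σ : Fin (n + 1) → S ≃ S'
  κ : ∀ j, S → F j
  κ' : ∀ j, S' → F j
  isOpen_Wo : IsOpen Wo
  isOpen_Wi : IsOpen Wi
  isOpen_W : ∀ j, IsOpen (W j)
  cover : ∀ x, x ∈ Wo ∨ x ∈ Wi ∨ ∃ j, x ∈ W j
  disj : ∀ i j x, x ∈ W i → x ∈ W j → i = j
  lc_o : LocConstOn ρo Wo
  lc_i : LocConstOn ρi Wi
  lc : ∀ j, LocConstOn (ρ j) (W j)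
  lc_q : LocConstOn q (Wo ∩ Wi)
  sc_o : ∀ s, RelSimplyConnected (Wo ∩ ρo ⁻¹' {s})
  sc_i : ∀ s, RelSimplyConnected (Wi ∩ ρi ⁻¹' {s})
  sc : ∀ j s, RelSimplyConnected (W j ∩ ρ j ⁻¹' {s})
  ρi_eq : ∀ x ∈ Wo, x ∈ Wi → ρi x = σ (q x) (ρo x)
  ρ_eq_o : ∀ j, ∀ x ∈ W j, x ∈ Wo → ρ j x = κ j (ρo x)
  ρ_eq_i : ∀ j, ∀ x ∈ W j, x ∈ Wi → ρ j x = κ' j (ρi x)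
  joined_oi : ∀ x ∈ Wo ∩ Wi, ∀ y ∈ Wo ∩ Wi, q x = q y → ρo x = ρo y → JoinedIn (Wo ∩ Wi) x y
  joined_o : ∀ j, ∀ x ∈ W j ∩ Wo, ∀ y ∈ W j ∩ Wo, ρo x = ρo y → JoinedIn (W j ∩ Wo) x y
  joined_i : ∀ j, ∀ x ∈ W j ∩ Wi, ∀ y ∈ W j ∩ Wi, ρi x = ρi y → JoinedIn (W j ∩ Wi) x y
  q_adj : ∀ j, ∀ x ∈ W j, x ∈ Wo → x ∈ Wi → q x = j ∨ q x = j + 1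
  exists_left : ∀ j s, ∃ x ∈ W j, x ∈ Wo ∧ x ∈ Wi ∧ q x = j ∧ ρo x = s
  exists_right : ∀ j s, ∃ x ∈ W j, x ∈ Wo ∧ x ∈ Wi ∧ q x = j + 1 ∧ ρo x = s
  κ_surj : ∀ j, Function.Surjective (κ j)
  transitive : ∀ (A : Set S) (A' : Set S'), (∀ j s, s ∈ A ↔ σ j s ∈ A') → A = ∅ ∨ A = univ

namespace SheetDecomposition

variable {X : Type*} [TopologicalSpace X] {n : ℕ} {S S' : Type*} {F : Fin (n + 1) → Type*}
  (D : SheetDecomposition X n S S' F)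

include D

theorem κ_eq (j : Fin (n + 1)) (s : S) : D.κ' j (D.σ j s) = D.κ j s := by
  obtain ⟨x, h1, h2, h3, h4, rfl⟩ := D.exists_left j s
  rw [← D.ρ_eq_o j x h1 h2, D.ρ_eq_i j x h1 h3, D.ρi_eq x h2 h3, h4]

theorem eq_of_transitive {M : Type*} (μ : S → M) (μ' : S' → M) (h : ∀ j s, μ s = μ' (D.σ j s))
    (s t : S) : μ s = μ t := by
  rcases D.transitive {x | μ x = μ t} {x | μ' x = μ t} (fun j s ↦ by simp [h j s]) with h | h
  · exact absurd (rfl : μ t = μ t) (h ▸ notMem_empty t : ¬ t ∈ {x | μ x = μ t})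
  · exact (h ▸ mem_univ s : s ∈ {x | μ x = μ t})

theorem joined (c x : X) : Joined c x := by
  have key : ∀ a ∈ D.Wo, ∀ b ∈ D.Wo, Joined a b := by
    intro a ha b hb
    have hA := D.transitive {s | ∃ y ∈ D.Wo, D.ρo y = s ∧ Joined a y}
      {s | ∃ y ∈ D.Wi, D.ρi y = s ∧ Joined a y} (by
        intro j s
        obtain ⟨z, -, h2, h3, h4, h5⟩ := D.exists_left j s
        constructor
        · rintro ⟨y, hy, hys, hj⟩
          exact ⟨z, h3, by rw [D.ρi_eq z h2 h3, h4, h5], hj.trans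
            ((D.sc_o s).1 y ⟨hy, hys⟩ z ⟨h2, h5⟩).joined⟩
        · rintro ⟨y, hy, hys, hj⟩
          exact ⟨z, h2, h5, hj.trans ((D.sc_i (D.σ j s)).1 y ⟨hy, hys⟩ z
            ⟨h3, by rw [mem_preimage, D.ρi_eq z h2 h3, h4, h5]; rfl⟩).joined⟩)
    have ha' : D.ρo a ∈ {s | ∃ y ∈ D.Wo, D.ρo y = s ∧ Joined a y} := ⟨a, ha, rfl, .refl a⟩
    rcases hA with h | h
    · rw [h] at ha'; exact ha'.elim
    · obtain ⟨y, hy, hys, hj⟩ := (h ▸ mem_univ (D.ρo b) :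
        D.ρo b ∈ {s | ∃ y ∈ D.Wo, D.ρo y = s ∧ Joined a y})
      exact hj.trans ((D.sc_o (D.ρo b)).1 y ⟨hy, hys⟩ b ⟨hb, rfl⟩).joined
  have key2 : ∀ a, ∃ b ∈ D.Wo, Joined a b := by
    intro a
    rcases D.cover a with h | h | ⟨j, h⟩
    · exact ⟨a, h, .refl a⟩
    · obtain ⟨z, -, h2, h3, h4, h5⟩ := D.exists_left 0 ((D.σ 0).symm (D.ρi a))
      exact ⟨z, h2, ((D.sc_i (D.ρi a)).1 a ⟨h, rfl⟩ z
        ⟨h3, by rw [mem_preimage, D.ρi_eq z h2 h3, h4, h5, Equiv.apply_symm_apply]; rfl⟩).joined⟩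
    · obtain ⟨s, hs⟩ := D.κ_surj j (D.ρ j a)
      obtain ⟨z, h1, h2, -, -, h5⟩ := D.exists_left j s
      exact ⟨z, h2, ((D.sc j (D.ρ j a)).1 a ⟨h, rfl⟩ z
        ⟨h1, by rw [mem_preimage, D.ρ_eq_o j z h1 h2, h5, hs]; rfl⟩).joined⟩
  obtain ⟨a, ha, hca⟩ := key2 c
  obtain ⟨b, hb, hxb⟩ := key2 x
  exact hca.trans ((key a ha b hb).trans hxb.symm)

end SheetDecomposition

section Linear

variable {n : ℕ} {S S' : Type*} {F : Fin (n + 1) → Type*} (k : Type*) [Field k]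

/-- The compatibility conditions between the gluing data around consecutive branch points. -/
def sectorMap (σ : Fin (n + 1) → S ≃ S') :
    ((Fin (n + 1) → S → k) × (Fin (n + 1) → S' → k)) →ₗ[k] (Fin (n + 1) → S → k) where
  toFun p j s := (p.2 j (σ (j + 1) s) - p.1 j s) - (p.2 (j + 1) (σ (j + 1) s) - p.1 (j + 1) s)
  map_add' p p' := by ext j s; simp; ring
  map_smul' c p := by ext j s; simp; ring

/-- The gluing data coming from locally constant functions on the sheets. -/
def sheetCoboundary (κ : ∀ j, S → F j) (κ' : ∀ j, S' → F j) :
    ((∀ j, F j → k) × (S → k) × (S' → k)) →ₗ[k]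
      ((Fin (n + 1) → S → k) × (Fin (n + 1) → S' → k)) where
  toFun p := (fun j s ↦ p.1 j (κ j s) - p.2.1 s, fun j s ↦ p.1 j (κ' j s) - p.2.2 s)
  map_add' p p' := by ext j s <;> simp <;> ring
  map_smul' c p := by ext j s <;> simp <;> ring

variable [Fintype S] [Fintype S'] [∀ j, Fintype (F j)] [Nonempty S] (σ : Fin (n + 1) → S ≃ S')

theorem Fin.eq_of_add_one_eq {M : Type*} {l : Fin (n + 1) → M} (h : ∀ j, l j = l (j + 1))
    (j : Fin (n + 1)) : l j = l 0 := by
  induction j using Fin.induction with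
  | zero => rfl
  | succ i ih =>
    rw [← ih, h i.castSucc, Fin.coeSucc_eq_succ]

theorem finrank_ker_sectorMap
    (tr : ∀ (μ : S → k) (μ' : S' → k), (∀ j s, μ s = μ' (σ j s)) → ∀ s t, μ s = μ t) :
    Module.finrank k (LinearMap.ker (sectorMap k σ)) = (n + 1) * Fintype.card S + 1 := by
  classical
  let T : Module.Dual k (Fin (n + 1) → S → k) := ∑ j, ∑ s, LinearMap.proj s ∘ₗ LinearMap.proj j
  have hT : ∀ v, T v = ∑ j, ∑ s, v j s := fun v ↦ by simp [T]
  have hann : (LinearMap.range (sectorMap k σ)).dualAnnihilator = Submodule.span k {T} := by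
    apply le_antisymm
    · intro ψ hψ
      rw [Submodule.mem_dualAnnihilator] at hψ
      let e : Fin (n + 1) → S → (Fin (n + 1) → S → k) := fun j s ↦ Pi.single j (Pi.single s 1)
      have h1 : ∀ j s, ψ (e j s) = ψ (e (j + 1) s) := by
        intro j s
        have := hψ _ ⟨(e (j + 1) s, 0), rfl⟩
        have h2 : sectorMap k σ (e (j + 1) s, 0) = e j s - e (j + 1) s := by
          ext i t
          simp [sectorMap, e, Pi.single_apply, add_left_inj, ite_apply]
          ring
        rw [h2, map_sub, sub_eq_zero] at this
        exact this
      have h3 : ∀ j s, ψ (e j s) = ψ (e 0 s) := fun j s ↦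
        Fin.eq_of_add_one_eq (l := fun j ↦ ψ (e j s)) (fun j ↦ h1 j s) j
      have h4 : ∀ j s', ψ (e 0 ((σ (j + 1)).symm s')) = ψ (e 0 ((σ (j + 1 + 1)).symm s')) := by
        intro j s'
        have h2 : sectorMap k σ (0, Pi.single (j + 1) (Pi.single s' 1)) =
            e (j + 1) ((σ (j + 1 + 1)).symm s') - e j ((σ (j + 1)).symm s') := by
          ext i t
          simp only [sectorMap, LinearMap.coe_mk, AddHom.coe_mk, e, Pi.single_apply, Pi.sub_apply,
            ite_apply, Pi.zero_apply, Equiv.eq_symm_apply, add_left_inj, sub_zero]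
          congr 1
          · by_cases h : i = j + 1
            · subst h; rfl
            · simp [h]
          · by_cases h : i = j
            · subst h; rfl
            · simp [h]
        have := hψ _ ⟨_, h2⟩
        rw [map_sub, sub_eq_zero, h3, h3 j] at this
        exact this.symm
      have h5 : ∀ j s', ψ (e 0 ((σ j).symm s')) = ψ (e 0 ((σ 0).symm s')) := by
        intro j s'
        have h6 := Fin.eq_of_add_one_eq (l := fun j ↦ ψ (e 0 ((σ (j + 1)).symm s')))
          (fun j ↦ h4 j s')
        have h7 := h6 (j - 1)
        have h8 := h6 (0 - 1)
        simp only [sub_add_cancel] at h7 h8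
        rw [h7, h8]
      have h9 := tr (fun s ↦ ψ (e 0 s)) (fun s' ↦ ψ (e 0 ((σ 0).symm s')))
        (fun j s ↦ by rw [← h5 j]; simp)
      obtain ⟨s₀⟩ := ‹Nonempty S›
      refine Submodule.mem_span_singleton.2 ⟨ψ (e 0 s₀), ?_⟩
      refine LinearMap.ext fun v ↦ ?_
      have hv : v = ∑ j, ∑ s, v j s • e j s := by
        ext i t
        simp [e, Finset.sum_apply, Pi.single_apply, ite_apply]
      conv_rhs => rw [hv]
      simp only [map_sum, map_smul, smul_eq_mul, LinearMap.smul_apply, hT, Finset.mul_sum]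
      refine Finset.sum_congr rfl fun j _ ↦ Finset.sum_congr rfl fun s _ ↦ ?_
      rw [h3 j, h9 s s₀, mul_comm]
    · rw [Submodule.span_singleton_le_iff_mem, Submodule.mem_dualAnnihilator]
      rintro _ ⟨p, rfl⟩
      rw [hT]
      simp only [sectorMap, LinearMap.coe_mk, AddHom.coe_mk, Finset.sum_sub_distrib]
      have h1 : ∑ j, ∑ s, p.2 (j + 1) (σ (j + 1) s) = ∑ j, ∑ s, p.2 j s := by
        rw [← Equiv.sum_comp (Equiv.addRight (1 : Fin (n + 1))) (fun j ↦ ∑ s, p.2 j s)]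
        exact Finset.sum_congr rfl fun j _ ↦ Equiv.sum_comp (σ (j + 1)) (p.2 (j + 1))
      have h2 : ∑ j, ∑ s, p.2 j (σ (j + 1) s) = ∑ j, ∑ s, p.2 j s :=
        Finset.sum_congr rfl fun j _ ↦ Equiv.sum_comp (σ (j + 1)) (p.2 j)
      have h3 : ∑ j, ∑ s, p.1 (j + 1) s = ∑ j, ∑ s, p.1 j s :=
        Equiv.sum_comp (Equiv.addRight (1 : Fin (n + 1))) (fun j ↦ ∑ s, p.1 j s)
      rw [h1, h2, h3, sub_self]
  have hT0 : T ≠ 0 := by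
    obtain ⟨s₀⟩ := ‹Nonempty S›
    intro h
    have := hT (Pi.single 0 (Pi.single s₀ 1))
    rw [h] at this
    simp [Pi.single_apply, ite_apply] at this
  have h1 := LinearMap.finrank_range_add_finrank_ker (sectorMap k σ)
  have h2 := Subspace.finrank_add_finrank_dualAnnihilator_eq (LinearMap.range (sectorMap k σ))
  rw [hann, finrank_span_singleton hT0] at h2
  have h3 : Module.finrank k (Fin (n + 1) → S → k) = (n + 1) * Fintype.card S := by
    simp [Module.finrank_pi_fintype]
  have h4 : Module.finrank k (Fin (n + 1) → S' → k) = (n + 1) * Fintype.card S := by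
    simp [Module.finrank_pi_fintype, Fintype.card_congr (σ 0)]
  rw [Module.finrank_prod, h4, h3] at h1
  rw [h3] at h2
  omega

theorem finrank_range_sheetCoboundary {κ : ∀ j, S → F j} {κ' : ∀ j, S' → F j}
    (hκ : ∀ j, Function.Surjective (κ j)) (hκσ : ∀ j s, κ' j (σ j s) = κ j s)
    (tr : ∀ (μ : S → k) (μ' : S' → k), (∀ j s, μ s = μ' (σ j s)) → ∀ s t, μ s = μ t) :
    Module.finrank k (LinearMap.range (sheetCoboundary k κ κ')) + 1 =
      ∑ j, Fintype.card (F j) + 2 * Fintype.card S := by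
  have h1 := LinearMap.finrank_range_add_finrank_ker (sheetCoboundary k κ κ')
  have hker : LinearMap.ker (sheetCoboundary k κ κ') = Submodule.span k {(1, 1, 1)} := by
    apply le_antisymm
    · rintro ⟨h, u, u'⟩ hp
      rw [LinearMap.mem_ker, Prod.ext_iff] at hp
      have hp1 : ∀ j s, h j (κ j s) = u s := fun j s ↦ sub_eq_zero.1 (congrFun₂ hp.1 j s)
      have hp2 : ∀ j s, h j (κ' j s) = u' s := fun j s ↦ sub_eq_zero.1 (congrFun₂ hp.2 j s)
      have h3 := tr u u' (fun j s ↦ by rw [← hp1 j, ← hp2 j, hκσ])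
      obtain ⟨s₀⟩ := ‹Nonempty S›
      refine Submodule.mem_span_singleton.2 ⟨u s₀, ?_⟩
      refine Prod.ext ?_ (Prod.ext ?_ ?_)
      · ext j x
        obtain ⟨s, rfl⟩ := hκ j x
        simp [hp1, h3 s s₀]
      · ext s
        simp [h3 s s₀]
      · ext s
        obtain ⟨t, rfl⟩ := (σ 0).surjective s
        simp [← hp2 0, hκσ, hp1, h3 t s₀]
    · rw [Submodule.span_singleton_le_iff_mem, LinearMap.mem_ker]
      ext <;> simp [sheetCoboundary]
  have hne : ((1, 1, 1) : (∀ j, F j → k) × (S → k) × (S' → k)) ≠ 0 := by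
    obtain ⟨s₀⟩ := ‹Nonempty S›
    intro h
    have := congrFun (congrArg (fun p ↦ p.2.1) h) s₀
    simp at this
  rw [hker, finrank_span_singleton hne] at h1
  rw [h1]
  simp only [Module.finrank_prod, Module.finrank_pi_fintype,
    Fintype.card_congr (σ 0), Module.finrank_self, Finset.sum_const, smul_eq_mul, mul_one,
    Finset.card_univ]
  ring

end Linear

/-- `φ` is the coboundary of `g` on paths in `W`. -/
def PrimitiveOn {k X : Type*} [Field k] [TopologicalSpace X] (W : Set X) (g : X → k)
    (φ : ∀ x y : X, Path.Homotopic.Quotient x y → k) : Prop :=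
  ∀ x y (γ : Path x y), range γ ⊆ W → φ x y (.mk γ) = g y - g x

section

variable {k X : Type*} [Field k] [TopologicalSpace X] {W V : Set X} {g g' : X → k}
  {φ φ' : ∀ x y : X, Path.Homotopic.Quotient x y → k}

theorem PrimitiveOn.add (h : PrimitiveOn W g φ) (h' : PrimitiveOn W g' φ') :
    PrimitiveOn W (g + g') (φ + φ') := fun x y γ hγ ↦ by
  simp only [Pi.add_apply, h x y γ hγ, h' x y γ hγ]; ring

theorem PrimitiveOn.smul (c : k) (h : PrimitiveOn W g φ) : PrimitiveOn W (c • g) (c • φ) :=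
  fun x y γ hγ ↦ by simp only [Pi.smul_apply, h x y γ hγ, smul_sub]

theorem PrimitiveOn.zero : PrimitiveOn W (0 : X → k) 0 := fun x y γ _ ↦ by simp

theorem PrimitiveOn.mono (h : PrimitiveOn W g φ) (hV : V ⊆ W) : PrimitiveOn V g φ :=
  fun x y γ hγ ↦ h x y γ (hγ.trans hV)

theorem PrimitiveOn.sub_eq (h : PrimitiveOn W g φ) (h' : PrimitiveOn W g' φ) {x y : X}
    (hj : JoinedIn W x y) : g y - g' y = g x - g' x := by
  obtain ⟨γ, hγ⟩ := hj
  have hr : range γ ⊆ W := by rintro _ ⟨t, rfl⟩; exact hγ t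
  linear_combination h' x y γ hr - h x y γ hr

theorem PrimitiveOn.congr (h : PrimitiveOn W g φ) (hg : ∀ x ∈ W, g' x = g x) :
    PrimitiveOn W g' φ := fun x y γ hγ ↦ by
  rw [h x y γ hγ, hg x (hγ ⟨0, γ.source⟩), hg y (hγ ⟨1, γ.target⟩)]

theorem LocConstOn.primitiveOn_zero {S : Type*} {ρ : X → S} (hρ : LocConstOn ρ W) (w : S → k) :
    PrimitiveOn W (fun x ↦ w (ρ x)) 0 := by
  intro x y γ hγ
  have := hρ.path_eq γ hγ 1
  rw [γ.target] at this
  simp [this]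

/-- The additive `k`-valued characters of a group. -/
def additiveCharacters (k G : Type*) [Field k] [Group G] : Submodule k (G → k) where
  carrier := {h | ∀ a b, h (a * b) = h a + h b}
  add_mem' {f g} hf hg a b := by simp only [Pi.add_apply, hf a b, hg a b]; ring
  zero_mem' a b := by simp
  smul_mem' c f hf a b := by simp only [Pi.smul_apply, hf a b, smul_add]

theorem exists_pathCocycle_of_character {c : X} (hc : ∀ x, Joined c x)
    {h : FundamentalGroup X c → k} (hh : h ∈ additiveCharacters k (FundamentalGroup X c)) :
    ∃ φ ∈ pathCocycles k X, ∀ p : Path.Homotopic.Quotient c c, φ c c p = h p := by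
  have htr : ∀ p q : Path.Homotopic.Quotient c c, h (p.trans q) = h p + h q := fun p q ↦ by
    rw [add_comm]; exact hh q p
  let P : ∀ x, Path.Homotopic.Quotient c x := fun x ↦ .mk (hc x).somePath
  refine ⟨fun x y p ↦ h ((P x).trans (p.trans (P y).symm)), fun x y z p q ↦ ?_, fun p ↦ ?_⟩
  · beta_reduce
    rw [← htr]
    congr 1
    simp only [Path.Homotopic.Quotient.trans_assoc]
    congr 2
    rw [← Path.Homotopic.Quotient.trans_assoc (P y).symm, Path.Homotopic.Quotient.symm_trans,
      Path.Homotopic.Quotient.refl_trans]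
  · beta_reduce
    rw [htr, htr]
    have h1 := htr (P c) (P c).symm
    rw [Path.Homotopic.Quotient.trans_symm] at h1
    have h2 := htr (Path.Homotopic.Quotient.refl c) (.refl c)
    rw [Path.Homotopic.Quotient.refl_trans] at h2
    linear_combination - h2 - h1

end

namespace SheetDecomposition

variable {X : Type*} [TopologicalSpace X] {n : ℕ} {S S' : Type*} {F : Fin (n + 1) → Type*}
  (D : SheetDecomposition X n S S' F) (k : Type*) [Field k] (c : X)

/-- The relation between characters of the fundamental group and gluing data of primitives on the
sheets. -/
def gluing : Submodule k ((FundamentalGroup X c → k) ×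
    ((Fin (n + 1) → S → k) × (Fin (n + 1) → S' → k))) where
  carrier := {p | ∃ φ ∈ pathCocycles k X, ∃ (go gi : X → k) (g : Fin (n + 1) → X → k),
    (∀ a, p.1 a = φ c c a) ∧ PrimitiveOn D.Wo go φ ∧ PrimitiveOn D.Wi gi φ ∧
    (∀ j, PrimitiveOn (D.W j) (g j) φ) ∧
    (∀ j, ∀ x ∈ D.W j, x ∈ D.Wo → g j x - go x = p.2.1 j (D.ρo x)) ∧
    (∀ j, ∀ x ∈ D.W j, x ∈ D.Wi → g j x - gi x = p.2.2 j (D.ρi x))}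
  add_mem' := by
    rintro p p' ⟨φ, hφ, go, gi, g, h1, h2, h3, h4, h5, h6⟩
      ⟨φ', hφ', go', gi', g', h1', h2', h3', h4', h5', h6'⟩
    refine ⟨φ + φ', add_mem hφ hφ', go + go', gi + gi', g + g', fun a ↦ ?_, h2.add h2', h3.add h3',
      fun j ↦ (h4 j).add (h4' j), fun j x hx hx' ↦ ?_, fun j x hx hx' ↦ ?_⟩
    · simp [h1 a, h1' a]
    · simp only [Pi.add_apply, Prod.snd_add, Prod.fst_add, ← h5 j x hx hx', ← h5' j x hx hx']; ring
    · simp only [Pi.add_apply, Prod.snd_add, ← h6 j x hx hx', ← h6' j x hx hx']; ring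
  zero_mem' := ⟨0, zero_mem _, 0, 0, 0, by simp, .zero, .zero, fun _ ↦ .zero, by simp, by simp⟩
  smul_mem' := by
    rintro a p ⟨φ, hφ, go, gi, g, h1, h2, h3, h4, h5, h6⟩
    refine ⟨a • φ, Submodule.smul_mem _ a hφ, a • go, a • gi, a • g, fun b ↦ ?_, h2.smul a,
      h3.smul a, fun j ↦ (h4 j).smul a, fun j x hx hx' ↦ ?_, fun j x hx hx' ↦ ?_⟩
    · simp [h1 b]
    · simp only [Pi.smul_apply, Prod.smul_snd, Prod.smul_fst, ← h5 j x hx hx', smul_sub]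
    · simp only [Pi.smul_apply, Prod.smul_snd, ← h6 j x hx hx', smul_sub]

variable {k c}

theorem mem_ker_of_mem_gluing {h p} (hp : (h, p) ∈ D.gluing k c) :
    p ∈ LinearMap.ker (sectorMap k D.σ) := by
  obtain ⟨φ, hφ, go, gi, g, h1, h2, h3, h4, h5, h6⟩ := hp
  rw [LinearMap.mem_ker]
  ext j s
  obtain ⟨x, x1, x2, x3, x4, rfl⟩ := D.exists_right j s
  obtain ⟨y, y1, y2, y3, y4, hxy⟩ := D.exists_left (j + 1) (D.ρo x)
  have hj := D.joined_oi x ⟨x2, x3⟩ y ⟨y2, y3⟩ (x4.trans y4.symm) hxy.symm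
  have e1 := (h2.mono inter_subset_left).sub_eq (h3.mono inter_subset_right) hj
  have a1 := h5 j x x1 x2
  have a2 := h6 j x x1 x3
  have a3 := h5 (j + 1) y y1 y2
  have a4 := h6 (j + 1) y y1 y3
  rw [D.ρi_eq x x2 x3, x4] at a2
  rw [D.ρi_eq y y2 y3, y4, hxy] at a4
  rw [hxy] at a3
  simp only [sectorMap, LinearMap.coe_mk, AddHom.coe_mk, Pi.zero_apply]
  simp only at a1 a2 a3 a4
  rw [← a1, ← a2, ← a3, ← a4]
  linear_combination - e1

theorem eq_zero_of_mem_gluing {h} (hp : (h, 0) ∈ D.gluing k c) : h = 0 := by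
  classical
  obtain ⟨φ, hφ, go, gi, g, h1, h2, h3, h4, h5, h6⟩ := hp
  have e1 : ∀ j, ∀ x ∈ D.W j, x ∈ D.Wo → g j x = go x := fun j x hx hx' ↦
    sub_eq_zero.1 (h5 j x hx hx')
  have e2 : ∀ j, ∀ x ∈ D.W j, x ∈ D.Wi → g j x = gi x := fun j x hx hx' ↦
    sub_eq_zero.1 (h6 j x hx hx')
  have e3 : ∀ x ∈ D.Wo, x ∈ D.Wi → go x = gi x := by
    intro x hx hx'
    obtain ⟨y, y1, y2, y3, y4, hxy⟩ := D.exists_left (D.q x) (D.ρo x)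
    have hj := D.joined_oi x ⟨hx, hx'⟩ y ⟨y2, y3⟩ y4.symm hxy.symm
    have := (h2.mono inter_subset_left).sub_eq (h3.mono inter_subset_right) hj
    rw [← e1 _ y y1 y2, ← e2 _ y y1 y3, sub_self] at this
    exact sub_eq_zero.1 this.symm
  let G : X → k := fun x ↦ if x ∈ D.Wo then go x else if x ∈ D.Wi then gi x else
    if h : ∃ j, x ∈ D.W j then g h.choose x else 0
  have Go : ∀ x ∈ D.Wo, G x = go x := fun x hx ↦ if_pos hx
  have Gi : ∀ x ∈ D.Wi, G x = gi x := fun x hx ↦ by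
    by_cases h : x ∈ D.Wo
    · rw [Go x h, e3 x h hx]
    · simp [G, h, hx]
  have Gj : ∀ j, ∀ x ∈ D.W j, G x = g j x := fun j x hx ↦ by
    by_cases h : x ∈ D.Wo
    · rw [Go x h, e1 j x hx h]
    · by_cases h' : x ∈ D.Wi
      · rw [Gi x h', e2 j x hx h']
      · have h4 : ∃ j, x ∈ D.W j := ⟨j, hx⟩
        simp only [G, h, h', if_false, dif_pos h4]
        rw [D.disj _ _ x h4.choose_spec hx]
  have key : ∀ x y (p : Path.Homotopic.Quotient x y), φ x y p = G y - G x := by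
    intro x y p
    refine pathQuotient_induction (P := fun x y p ↦ φ x y p = G y - G x)
      (W := fun i : Option (Option (Fin (n + 1))) ↦ i.elim D.Wo (fun i ↦ i.elim D.Wi D.W))
      ?_ ?_ ?_ ?_ p
    · rintro (_ | _ | j)
      exacts [D.isOpen_Wo, D.isOpen_Wi, D.isOpen_W j]
    · intro x
      rcases D.cover x with h | h | ⟨j, h⟩
      exacts [⟨none, h⟩, ⟨some none, h⟩, ⟨some (some j), h⟩]
    · rintro (_ | _ | j)
      exacts [h2.congr Go, h3.congr Gi, (h4 j).congr (Gj j)]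
    · intro x y z p q hp hq
      rw [hφ, hp, hq]; ring
  ext a
  exact (h1 a).trans (by rw [key]; simp)

theorem exists_mem_gluing_of_mem_characters {h}
    (hh : h ∈ additiveCharacters k (FundamentalGroup X c)) : ∃ p, (h, p) ∈ D.gluing k c := by
  obtain ⟨φ, hφ, hφh⟩ := exists_pathCocycle_of_character (D.joined c) hh
  obtain ⟨go, ho⟩ := exists_primitive_of_relSimplyConnected D.lc_o D.sc_o hφ
  obtain ⟨gi, hi⟩ := exists_primitive_of_relSimplyConnected D.lc_i D.sc_i hφ
  choose g hg using fun j ↦ exists_primitive_of_relSimplyConnected (D.lc j) (D.sc j) hφ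
  choose x x1 x2 x3 x4 x5 using D.exists_left
  refine ⟨(fun j s ↦ g j (x j s) - go (x j s), fun j s ↦ g j (x j ((D.σ j).symm s)) -
    gi (x j ((D.σ j).symm s))), φ, hφ, go, gi, g, fun a ↦ (hφh a).symm, ho, hi, hg, ?_, ?_⟩
  · intro j y y1 y2
    exact PrimitiveOn.sub_eq (PrimitiveOn.mono (hg j) inter_subset_left)
      (PrimitiveOn.mono ho inter_subset_right)
      (D.joined_o j _ ⟨x1 j _, x2 j _⟩ y ⟨y1, y2⟩ (x5 _ _))
  · intro j y y1 y2
    exact PrimitiveOn.sub_eq (PrimitiveOn.mono (hg j) inter_subset_left)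
      (PrimitiveOn.mono hi inter_subset_right)
      (D.joined_i j _ ⟨x1 j _, x3 j _⟩ y ⟨y1, y2⟩ (by
        rw [D.ρi_eq _ (x2 _ _) (x3 _ _), x4, x5, Equiv.apply_symm_apply]))

theorem mem_characters_of_mem_gluing {h p} (hp : (h, p) ∈ D.gluing k c) :
    h ∈ additiveCharacters k (FundamentalGroup X c) := by
  obtain ⟨φ, hφ, go, gi, g, h1, -⟩ := hp
  intro a b
  have h2 := hφ c c c b a
  rw [← h1 a, ← h1 b, add_comm] at h2
  exact (h1 (a * b)).trans h2

theorem exists_mem_gluing_of_mem_ker {p} (hp : p ∈ LinearMap.ker (sectorMap k D.σ)) :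
    ∃ h, (h, p) ∈ D.gluing k c := by
  classical
  obtain ⟨f, f'⟩ := p
  have hff : ∀ j s, f' j (D.σ (j + 1) s) - f j s =
      f' (j + 1) (D.σ (j + 1) s) - f (j + 1) s := fun j s ↦
    sub_eq_zero.1 (congrFun₂ (LinearMap.mem_ker.1 hp) j s)
  let gi : X → k := fun x ↦ if x ∈ D.Wo then
    f (D.q x) (D.ρo x) - f' (D.q x) (D.σ (D.q x) (D.ρo x)) else 0
  let g : Fin (n + 1) → X → k := fun j x ↦ if x ∈ D.Wo then f j (D.ρo x) else
    if x ∈ D.Wi then f' j (D.ρi x) else 0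
  have ho : ∀ j, ∀ x ∈ D.W j, x ∈ D.Wo → g j x = f j (D.ρo x) := fun j x _ hx ↦ if_pos hx
  have hi : ∀ j, ∀ x ∈ D.W j, x ∈ D.Wi → g j x - gi x = f' j (D.ρi x) := by
    intro j x hj hx
    by_cases h : x ∈ D.Wo
    · simp only [g, gi, if_pos h]
      rw [D.ρi_eq x h hx]
      rcases D.q_adj j x hj h hx with hq | hq
      · rw [hq]; ring
      · rw [hq]; linear_combination - hff j (D.ρo x)
    · simp [g, gi, h, hx]
  let G : Option (Option (Fin (n + 1))) → X → k := fun i ↦ i.elim 0 (fun i ↦ i.elim gi g)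
  let U : Option (Option (Fin (n + 1))) → Set X := fun i ↦ i.elim D.Wo (fun i ↦ i.elim D.Wi D.W)
  have hU : ∀ i, IsOpen (U i) := by
    rintro (_ | _ | j)
    exacts [D.isOpen_Wo, D.isOpen_Wi, D.isOpen_W j]
  have hcov : ∀ x, ∃ i, x ∈ U i := by
    intro x
    rcases D.cover x with h | h | ⟨j, h⟩
    exacts [⟨none, h⟩, ⟨some none, h⟩, ⟨some (some j), h⟩]
  have symm : ∀ {u v : X → k} {x}, (∀ᶠ y in 𝓝 x, u y - v y = u x - v x) →
      ∀ᶠ y in 𝓝 x, v y - u y = v x - u x := fun h ↦ by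
    filter_upwards [h] with y hy
    linear_combination - hy
  have c1 : ∀ x ∈ D.Wo, x ∈ D.Wi → ∀ᶠ y in 𝓝 x, gi y - (0 : X → k) y = gi x - (0 : X → k) x := by
    intro x hx hx'
    filter_upwards [D.isOpen_Wo.mem_nhds hx, D.lc_o x hx, D.lc_q x ⟨hx, hx'⟩] with y h1 h2 h3
    simp only [gi, if_pos hx, if_pos h1, h2, h3, Pi.zero_apply]
  have c2 : ∀ j, ∀ x ∈ D.W j, x ∈ D.Wo →
      ∀ᶠ y in 𝓝 x, g j y - (0 : X → k) y = g j x - (0 : X → k) x := by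
    intro j x hx hx'
    filter_upwards [D.isOpen_Wo.mem_nhds hx', (D.isOpen_W j).mem_nhds hx, D.lc_o x hx']
      with y h1 h2 h3
    rw [ho j y h2 h1, ho j x hx hx', h3]; rfl
  have c3 : ∀ j, ∀ x ∈ D.W j, x ∈ D.Wi → ∀ᶠ y in 𝓝 x, g j y - gi y = g j x - gi x := by
    intro j x hx hx'
    filter_upwards [D.isOpen_Wi.mem_nhds hx', (D.isOpen_W j).mem_nhds hx, D.lc_i x hx']
      with y h1 h2 h3
    rw [hi j y h2 h1, hi j x hx hx', h3]
  obtain ⟨φ, hφ, hφG⟩ := exists_pathCocycle_of_cover hU hcov G (by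
    rintro (_ | _ | i) (_ | _ | j) x h1 h2
    · simp
    · exact symm (c1 x h1 h2)
    · exact symm (c2 j x h2 h1)
    · exact c1 x h2 h1
    · simp
    · exact symm (c3 j x h2 h1)
    · exact c2 i x h1 h2
    · exact c3 i x h1 h2
    · obtain rfl := D.disj i j x h1 h2
      simp)
  exact ⟨fun a ↦ φ c c a, φ, hφ, 0, gi, g, fun _ ↦ rfl, hφG none, hφG (some none),
    fun j ↦ hφG (some (some j)), fun j x hx hx' ↦ by rw [ho j x hx hx']; simp, hi⟩

theorem zero_mem_gluing_iff {p} :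
    ((0, p) ∈ D.gluing k c) ↔ p ∈ LinearMap.range (sheetCoboundary k D.κ D.κ') := by
  constructor
  · rintro ⟨φ, hφ, go, gi, g, h1, h2, h3, h4, h5, h6⟩
    let G : X → k := fun x ↦ φ c x (.mk (D.joined c x).somePath)
    have hG : ∀ V, PrimitiveOn V G φ := by
      intro V x y γ _
      have e1 := h1 ((Path.Homotopic.Quotient.mk (D.joined c x).somePath).trans
        ((Path.Homotopic.Quotient.mk γ).trans
          (Path.Homotopic.Quotient.mk (D.joined c y).somePath).symm))
      have e2 := hφ _ _ _ (Path.Homotopic.Quotient.mk (D.joined c y).somePath)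
        (Path.Homotopic.Quotient.mk (D.joined c y).somePath).symm
      have e3 := h1 (Path.Homotopic.Quotient.refl c)
      rw [Path.Homotopic.Quotient.trans_symm] at e2
      rw [hφ, hφ] at e1
      simp only [Pi.zero_apply] at e1 e3
      simp only [G]
      linear_combination e2 - e1 + e3
    choose x x1 x2 x3 x4 x5 using D.exists_left
    let u : S → k := fun s ↦ go (x 0 s) - G (x 0 s)
    let u' : S' → k := fun s' ↦ gi (x 0 ((D.σ 0).symm s')) - G (x 0 ((D.σ 0).symm s'))
    choose s hs using D.κ_surj
    let h : ∀ j, F j → k := fun j t ↦ g j (x j (s j t)) - G (x j (s j t))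
    have hu : ∀ y ∈ D.Wo, go y - G y = u (D.ρo y) := fun y hy ↦
      PrimitiveOn.sub_eq (h2.mono inter_subset_left) (hG _)
        ((D.sc_o (D.ρo y)).1 _ ⟨x2 0 _, x5 0 _⟩ y ⟨hy, rfl⟩)
    have hu' : ∀ y ∈ D.Wi, gi y - G y = u' (D.ρi y) := fun y hy ↦
      PrimitiveOn.sub_eq (h3.mono inter_subset_left) (hG _)
        ((D.sc_i (D.ρi y)).1 _ ⟨x3 0 _, by
          rw [mem_preimage, D.ρi_eq _ (x2 _ _) (x3 _ _), x4, x5, Equiv.apply_symm_apply]; rfl⟩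
          y ⟨hy, rfl⟩)
    have hh : ∀ j, ∀ y ∈ D.W j, g j y - G y = h j (D.ρ j y) := fun j y hy ↦
      PrimitiveOn.sub_eq ((h4 j).mono inter_subset_left) (hG _)
        ((D.sc j (D.ρ j y)).1 _ ⟨x1 j _, by
          rw [mem_preimage, D.ρ_eq_o j _ (x1 _ _) (x2 _ _), x5, hs]; rfl⟩ y ⟨hy, rfl⟩)
    refine ⟨(h, u, u'), ?_⟩
    refine Prod.ext ?_ ?_
    · ext j t
      have e1 := h5 j _ (x1 j t) (x2 j t)
      have e2 := hu _ (x2 j t)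
      have e3 := hh j _ (x1 j t)
      rw [D.ρ_eq_o j _ (x1 j t) (x2 j t)] at e3
      rw [x5] at e1 e2 e3
      simp only [sheetCoboundary, LinearMap.coe_mk, AddHom.coe_mk]
      linear_combination e1 + e2 - e3
    · ext j t'
      obtain ⟨t, rfl⟩ := (D.σ j).surjective t'
      have e1 := h6 j _ (x1 j t) (x3 j t)
      have e2 := hu' _ (x3 j t)
      have e3 := hh j _ (x1 j t)
      rw [D.ρ_eq_i j _ (x1 j t) (x3 j t)] at e3
      rw [D.ρi_eq _ (x2 j t) (x3 j t), x4, x5] at e1 e2 e3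
      simp only [sheetCoboundary, LinearMap.coe_mk, AddHom.coe_mk]
      linear_combination e1 + e2 - e3
  · rintro ⟨⟨h, u, u'⟩, rfl⟩
    refine ⟨0, zero_mem _, fun x ↦ u (D.ρo x), fun x ↦ u' (D.ρi x), fun j x ↦ h j (D.ρ j x),
      by simp, D.lc_o.primitiveOn_zero u,
      D.lc_i.primitiveOn_zero u', fun j ↦ (D.lc j).primitiveOn_zero (h j), ?_, ?_⟩
    · intro j x hx hx'
      simp [sheetCoboundary, D.ρ_eq_o j x hx hx']
    · intro j x hx hx'
      simp [sheetCoboundary, D.ρ_eq_i j x hx hx']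

include D in
theorem finrank_additiveCharacters [Fintype S] [Fintype S'] [∀ j, Fintype (F j)] [Nonempty S] :
    Module.finrank k (additiveCharacters k (FundamentalGroup X c)) +
      ∑ j, Fintype.card (F j) + 2 * Fintype.card S = (n + 1) * Fintype.card S + 2 := by
  have tr : ∀ (μ : S → k) (μ' : S' → k), (∀ j s, μ s = μ' (D.σ j s)) → ∀ s t, μ s = μ t :=
    fun μ μ' h ↦ D.eq_of_transitive μ μ' h
  have h1 := finrank_ker_sectorMap k D.σ tr
  have h2 := finrank_range_sheetCoboundary k D.σ D.κ_surj D.κ_eq tr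
  let Γ := D.gluing k c
  let pr₂ : Γ →ₗ[k] LinearMap.ker (sectorMap k D.σ) :=
    (LinearMap.snd k _ _ ∘ₗ Γ.subtype).codRestrict _ fun p ↦ D.mem_ker_of_mem_gluing p.2
  have inj : Function.Injective pr₂ := by
    rw [← LinearMap.ker_eq_bot, LinearMap.ker_eq_bot']
    rintro ⟨⟨h, p⟩, hp⟩ h0
    obtain rfl : p = 0 := congrArg Subtype.val h0
    obtain rfl := D.eq_zero_of_mem_gluing hp
    rfl
  have surj : Function.Surjective pr₂ := by
    rintro ⟨p, hp⟩
    obtain ⟨h, hh⟩ := D.exists_mem_gluing_of_mem_ker (c := c) hp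
    exact ⟨⟨(h, p), hh⟩, rfl⟩
  let e := LinearEquiv.ofBijective pr₂ ⟨inj, surj⟩
  have hΓ := e.finrank_eq
  have : Module.Finite k Γ := Module.Finite.equiv e.symm
  let pr₁ : Γ →ₗ[k] additiveCharacters k (FundamentalGroup X c) :=
    (LinearMap.fst k _ _ ∘ₗ Γ.subtype).codRestrict _ fun p ↦ D.mem_characters_of_mem_gluing p.2
  have surj₁ : Function.Surjective pr₁ := by
    rintro ⟨h, hh⟩
    obtain ⟨p, hp⟩ := D.exists_mem_gluing_of_mem_characters hh
    exact ⟨⟨(h, p), hp⟩, rfl⟩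
  have h3 := LinearMap.finrank_range_add_finrank_ker pr₁
  rw [LinearMap.range_eq_top.2 surj₁, finrank_top] at h3
  let B := LinearMap.range (sheetCoboundary k D.κ D.κ')
  let ι : B →ₗ[k] LinearMap.ker pr₁ :=
    { toFun b := ⟨⟨(0, b), D.zero_mem_gluing_iff.2 b.2⟩, rfl⟩
      map_add' b b' := by
        apply Subtype.ext; apply Subtype.ext; simp
      map_smul' a b := by
        apply Subtype.ext; apply Subtype.ext; simp }
  have hι : Function.Bijective ι := by
    constructor
    · intro b b' h
      have h' := congrArg (fun z ↦ z.1.1.2) h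
      exact Subtype.ext h'
    · rintro ⟨⟨⟨h, p⟩, hp⟩, h0⟩
      obtain rfl : h = 0 := congrArg Subtype.val h0
      exact ⟨⟨p, D.zero_mem_gluing_iff.1 hp⟩, rfl⟩
  have h4 := (LinearEquiv.ofBijective ι hι).finrank_eq
  linarith

end SheetDecomposition

theorem LocConstOn.eq_of_isPreconnected {T X S : Type*} [TopologicalSpace T] [TopologicalSpace X]
    {ρ : X → S} {W : Set X} (h : LocConstOn ρ W) {A : Set T} (hA : IsPreconnected A) {g : T → X}
    (hg : ContinuousOn g A) (hgW : MapsTo g A W) {a b : T} (ha : a ∈ A) (hb : b ∈ A) :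
    ρ (g a) = ρ (g b) := by
  have : PreconnectedSpace A := Subtype.preconnectedSpace hA
  have hl : IsLocallyConstant (fun s : A ↦ ρ (g s)) := by
    rw [IsLocallyConstant.iff_eventually_eq]
    intro s
    exact hg.domRestrict.continuousAt.eventually (h (g s) (hgW s.2))
  exact hl.apply_eq_of_preconnectedSpace ⟨a, ha⟩ ⟨b, hb⟩

theorem RelSimplyConnected.of_contractible {X : Type*} [TopologicalSpace X] {A : Set X}
    (h : A.Nonempty → ContractibleSpace A) : RelSimplyConnected A := by
  refine ⟨fun x hx y hy ↦ ?_, fun x y γ γ' hγ hγ' ↦ ?_⟩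
  · have := h ⟨x, hx⟩
    exact joinedIn_iff_joined hx hy |>.2 (PathConnectedSpace.joined _ _)
  · have hx : x ∈ A := hγ ⟨0, γ.source⟩
    have hy : y ∈ A := hγ ⟨1, γ.target⟩
    have := h ⟨x, hx⟩
    have : SimplyConnectedSpace A := inferInstance
    let γ₁ : Path (⟨x, hx⟩ : A) ⟨y, hy⟩ :=
      { toFun t := ⟨γ t, hγ ⟨t, rfl⟩⟩
        source' := by simp
        target' := by simp }
    let γ₂ : Path (⟨x, hx⟩ : A) ⟨y, hy⟩ :=
      { toFun t := ⟨γ' t, hγ' ⟨t, rfl⟩⟩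
        source' := by simp
        target' := by simp }
    have h12 := SimplyConnectedSpace.paths_homotopic γ₁ γ₂
    exact h12.map ⟨Subtype.val, continuous_subtype_val⟩

theorem RelSimplyConnected.image_of_contractible {X Y : Type*} [TopologicalSpace X]
    [TopologicalSpace Y] {A : Set X} (h : A.Nonempty → ContractibleSpace A) {f : X → Y}
    (hf : IsEmbedding f) : RelSimplyConnected (f '' A) :=
  .of_contractible fun hA ↦
    have := h hA.of_image
    (hf.homeomorphImage A).symm.contractibleSpace

/-- A finite surjective map onto `ℂ`, which is a covering map away from `B`. -/
structure IsBranchedCover {E : Type*} [TopologicalSpace E] (π : E → ℂ) (B : Set ℂ) : Prop where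
  continuous : Continuous π
  isClosedMap : IsClosedMap π
  isOpenMap : IsOpenMap π
  surjective : Function.Surjective π
  finite_fiber : ∀ z, (π ⁻¹' {z}).Finite
  isCoveringMapOn : IsCoveringMapOn π Bᶜ

namespace IsBranchedCover

variable {E : Type*} [TopologicalSpace E] {π : E → ℂ} {B : Set ℂ}

theorem exists_lift (hπ : IsBranchedCover π B) {V : Set ℂ} (hV : V ⊆ Bᶜ) {x : E} {z : ℂ}
    (hz : JoinedIn V (π x) z) : ∃ y, π y = z ∧ JoinedIn (π ⁻¹' V) x y := by
  obtain ⟨γ, hγ⟩ := hz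
  have cov := (hπ.isCoveringMapOn.mono hV).isCoveringMap_restrictPreimage
  have hx : π x ∈ V := by simpa using hγ 0
  let γ' : C(unitInterval, V) := ⟨fun t ↦ ⟨γ t, hγ t⟩, by fun_prop⟩
  have h0 : γ' 0 = V.restrictPreimage π ⟨x, hx⟩ := by
    apply Subtype.ext; simp [γ']
  let Γ := cov.liftPath γ' ⟨x, hx⟩ h0
  have hΓ : ∀ t, π (Γ t) = γ t := fun t ↦
    congrArg Subtype.val (congrFun (cov.liftPath_lifts γ' ⟨x, hx⟩ h0) t)
  refine ⟨Γ 1, by simp [hΓ], ⟨⟨fun t ↦ (Γ t : E), by fun_prop⟩, ?_, rfl⟩, fun t ↦ (Γ t).2⟩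
  exact congrArg Subtype.val (cov.liftPath_zero γ' ⟨x, hx⟩ h0)

/-- Lifts of a path away from the branch points which agree at one point agree. -/
theorem lift_unique (hπ : IsBranchedCover π B) {A : Type*} [TopologicalSpace A]
    [PreconnectedSpace A] {g g' : A → E} (hg : Continuous g) (hg' : Continuous g')
    (h : ∀ t, π (g t) = π (g' t)) (hB : ∀ t, π (g t) ∉ B) {a : A} (ha : g a = g' a) : g = g' := by
  have cov := hπ.isCoveringMapOn.isCoveringMap_restrictPreimage
  have := cov.eq_of_comp_eq (g₁ := fun t ↦ (⟨g t, hB t⟩ : π ⁻¹' Bᶜ))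
    (g₂ := fun t ↦ (⟨g' t, by simpa [← h] using hB t⟩ : π ⁻¹' Bᶜ)) (by fun_prop) (by fun_prop)
    (by ext t; simp [h]) a (by simpa using ha)
  ext t
  exact congrArg Subtype.val (congrFun this t)

theorem exists_local_retraction [T2Space E] (hπ : IsBranchedCover π B) (c : ℂ) :
    ∃ ε > 0, ∃ r : E → E, LocConstOn r (π ⁻¹' Metric.ball c ε) ∧
      (∀ x, π x ∈ Metric.ball c ε → π (r x) = c) ∧ (∀ x, π x = c → r x = x) ∧
      ∀ p, π p = c → ∀ U ∈ 𝓝 p, ∃ δ > 0, δ ≤ ε ∧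
        ∀ x, π x ∈ Metric.ball c δ → r x = p → x ∈ U := by
  classical
  obtain ⟨U, hU, hd⟩ := (hπ.finite_fiber c).t2_separation
  have small : ∀ V : Set E, (∀ p, π p = c → V ∈ 𝓝 p) → ∃ ε > 0, ∀ x, π x ∈ Metric.ball c ε →
      x ∈ V := by
    intro V hV
    obtain ⟨ε, hε, h⟩ := Metric.eventually_nhds_iff_ball.1
      (hπ.isClosedMap.eventually_nhds_fiber (p := fun x ↦ x ∈ V) c hV)
    exact ⟨ε, hε, fun x hx ↦ h _ hx x rfl⟩
  let r : E → E := fun x ↦ if h : ∃ p, π p = c ∧ x ∈ U p then h.choose else x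
  have hr : ∀ x p, π p = c → x ∈ U p → r x = p := by
    intro x p hp hx
    have h : ∃ p, π p = c ∧ x ∈ U p := ⟨p, hp, hx⟩
    simp only [r, dif_pos h]
    by_contra hne
    exact disjoint_left.1 (hd h.choose_spec.1 hp hne) h.choose_spec.2 hx
  obtain ⟨ε, hε, h⟩ := small (⋃ p ∈ π ⁻¹' {c}, U p) fun p hp ↦
    Filter.mem_of_superset ((hU p).2.mem_nhds (hU p).1) (subset_biUnion_of_mem (u := U) hp)
  have h' : ∀ x, π x ∈ Metric.ball c ε → ∃ p, π p = c ∧ x ∈ U p := fun x hx ↦ by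
    simpa using h x hx
  refine ⟨ε, hε, r, ?_, ?_, fun x hx ↦ hr x x hx (hU x).1, ?_⟩
  · intro x hx
    obtain ⟨p, hp, hxp⟩ := h' x hx
    filter_upwards [(hU p).2.mem_nhds hxp] with y hy
    rw [hr y p hp hy, hr x p hp hxp]
  · intro x hx
    obtain ⟨p, hp, hxp⟩ := h' x hx
    rw [hr x p hp hxp, hp]
  · intro p hp V hV
    obtain ⟨δ, hδ, hδ'⟩ := small (V ∪ {x | r x ≠ p}) fun q hq ↦ by
      by_cases hqp : q = p
      · subst hqp
        exact Filter.mem_of_superset hV subset_union_left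
      · filter_upwards [(hU q).2.mem_nhds (hU q).1] with y hy
        right
        rw [mem_ofPred_eq, hr y q hq hy]
        exact hqp
    refine ⟨min δ ε, lt_min hδ hε, min_le_right _ _, fun x hx hxp ↦ ?_⟩
    exact (hδ' x (Metric.ball_subset_ball (min_le_left _ _) hx)).resolve_right fun h ↦ h hxp

/-- Lifting the rays towards the centre of a star-shaped set. -/
theorem exists_ray_lift (hπ : IsBranchedCover π B) {c : ℂ} {D : Set ℂ} (hD : StarConvex ℝ c D)
    (hDB : D \ {c} ⊆ Bᶜ) : ∃ G : ℝ × E → E,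
      ContinuousOn G (Ico 0 1 ×ˢ (π ⁻¹' (D \ {c}))) ∧ (∀ x, π x ∈ D \ {c} → G (0, x) = x) ∧
      ∀ s ∈ Ico (0 : ℝ) 1, ∀ x, π x ∈ D \ {c} → π (G (s, x)) = c + (1 - s) * (π x - c) := by
  classical
  have cov := (hπ.isCoveringMapOn.mono hDB).isCoveringMap_restrictPreimage
  set D' := D \ {c} with hD'
  have mem : ∀ s ∈ Ico (0 : ℝ) 1, ∀ z ∈ D', c + (1 - s) * (z - c) ∈ D' := by
    intro s hs z hz
    refine ⟨?_, ?_⟩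
    · have := hD hz.1 hs.1 (by linarith [hs.2] : 0 ≤ 1 - s) (by ring)
      convert this using 1
      simp only [Complex.real_smul]
      push_cast
      ring
    · have h1 : (1 - s : ℂ) ≠ 0 := by
        have := hs.2
        intro h
        have : (1 : ℝ) - s = 0 := by exact_mod_cast h
        linarith
      have h2 : z - c ≠ 0 := sub_ne_zero.2 hz.2
      simp [h1, h2]
  have hcont := hπ.continuous
  have mem' : ∀ (t : unitInterval) (a : ↥(Ico (0 : ℝ) 1) × ↥(π ⁻¹' D')),
      (t : ℝ) * a.1 ∈ Ico (0 : ℝ) 1 := by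
    rintro t ⟨⟨s, h1, h2⟩, _⟩
    exact ⟨mul_nonneg t.2.1 h1, by nlinarith [t.2.1, t.2.2]⟩
  let H : C(unitInterval × (↥(Ico (0 : ℝ) 1) × ↥(π ⁻¹' D')), D') :=
    ⟨fun p ↦ ⟨c + (1 - ((p.1 : ℝ) * (p.2.1 : ℝ) : ℝ)) * (π p.2.2 - c),
      mem _ (mem' p.1 p.2) _ p.2.2.2⟩, by fun_prop⟩
  let f : C(↥(Ico (0 : ℝ) 1) × ↥(π ⁻¹' D'), ↥(π ⁻¹' D')) := ⟨fun a ↦ a.2, by fun_prop⟩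
  have h0 : ∀ a, H (0, a) = D'.restrictPreimage π (f a) := by
    intro a
    apply Subtype.ext
    simp [H, f]
  let L := cov.liftHomotopy H f h0
  have hL : ∀ p, π (L p) = c + (1 - ((p.1 : ℝ) * (p.2.1 : ℝ) : ℝ)) * (π p.2.2 - c) := fun p ↦
    congrArg Subtype.val (congrFun (cov.liftHomotopy_lifts H f h0) p)
  have hL0 : ∀ a, L (0, a) = a.2 := cov.liftHomotopy_zero H f h0
  let G : ℝ × E → E := fun p ↦ if h : p.1 ∈ Ico (0 : ℝ) 1 ∧ π p.2 ∈ D' then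
    ((L (1, (⟨p.1, h.1⟩, ⟨p.2, mem_preimage.2 h.2⟩)) : ↥(π ⁻¹' D')) : E) else p.2
  have hG : ∀ p (h : p.1 ∈ Ico (0 : ℝ) 1 ∧ π p.2 ∈ D'),
      G p = L (1, (⟨p.1, h.1⟩, ⟨p.2, mem_preimage.2 h.2⟩)) := fun p h ↦ dif_pos h
  refine ⟨G, ?_, fun x hx ↦ ?_, fun s hs x hx ↦ ?_⟩
  · rw [continuousOn_iff_continuous_domRestrict]
    have : (Ico (0 : ℝ) 1 ×ˢ (π ⁻¹' D')).domRestrict G =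
        fun p ↦ (L (1, (⟨p.1.1, p.2.1⟩, ⟨p.1.2, p.2.2⟩)) : E) := by
      ext p
      exact hG p.1 p.2
    rw [this]
    fun_prop
  · rw [hG (0, x) ⟨⟨le_rfl, one_pos⟩, hx⟩]
    have h1 : Continuous fun t : unitInterval ↦
      L (t, ((⟨0, le_rfl, one_pos⟩, ⟨x, hx⟩) : ↥(Ico (0 : ℝ) 1) × ↥(π ⁻¹' D'))) := by fun_prop
    have := cov.const_of_comp h1 (by
      intro t t'
      apply Subtype.ext
      simp [hL]) 1 0
    rw [this, hL0]
  · rw [hG (s, x) ⟨hs, hx⟩, hL]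
    simp

end IsBranchedCover

namespace IsBranchedCover

variable {E : Type*} [TopologicalSpace E] {π : E → ℂ} {B : Set ℂ}

/-- The part of a branched cover over a star-shaped set, unbranched away from the centre,
deformation retracts onto the central fiber. -/
theorem exists_contraction [T2Space E] (hπ : IsBranchedCover π B) {c : ℂ} {D : Set ℂ}
    (hD : StarConvex ℝ c D) (hDo : IsOpen D) (hDB : D \ {c} ⊆ Bᶜ) :
    ∃ (ρ : E → E) (H : ℝ × E → E), LocConstOn ρ (π ⁻¹' D) ∧
      (∀ x, π x ∈ D → π (ρ x) = c) ∧ (∀ x, π x = c → ρ x = x) ∧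
      ContinuousOn H (Icc 0 1 ×ˢ (π ⁻¹' D)) ∧ (∀ x, π x ∈ D → H (0, x) = x) ∧
      (∀ x, π x ∈ D → H (1, x) = ρ x) ∧
      ∀ s ∈ Icc (0 : ℝ) 1, ∀ x, π x ∈ D → π (H (s, x)) = c + (1 - s) * (π x - c) := by
  classical
  obtain ⟨ε, hε, r, hr, hrc, hrx, hrU⟩ := hπ.exists_local_retraction c
  obtain ⟨G, hG, hG0, hπG⟩ := hπ.exists_ray_lift hD hDB
  have hcont := hπ.continuous
  let m : E → ℝ := fun x ↦ 1 - ε / (2 * (‖π x - c‖ + ε))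
  have hm1 : ∀ x, m x < 1 := fun x ↦ by
    have : 0 < ε / (2 * (‖π x - c‖ + ε)) := by positivity
    simp only [m]; linarith
  have hm0 : ∀ x, 0 ≤ m x := fun x ↦ by
    have : ε / (2 * (‖π x - c‖ + ε)) ≤ 1 := by
      rw [div_le_one (by positivity)]
      have := norm_nonneg (π x - c)
      linarith
    simp only [m]; linarith
  have hm : ∀ x, (1 - m x) * ‖π x - c‖ < ε := fun x ↦ by
    have : (1 - m x) * ‖π x - c‖ = ε * (‖π x - c‖ / (2 * (‖π x - c‖ + ε))) := by
      simp only [m]; ring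
    rw [this]
    have : ‖π x - c‖ / (2 * (‖π x - c‖ + ε)) < 1 := by
      rw [div_lt_one (by positivity)]
      have := norm_nonneg (π x - c)
      linarith
    nlinarith
  let ρ : E → E := fun x ↦ if π x = c then x else r (G (m x, x))
  have hball : ∀ s ∈ Ico (0 : ℝ) 1, ∀ x, π x ∈ D \ {c} → ∀ δ, (1 - s) * ‖π x - c‖ < δ →
      π (G (s, x)) ∈ Metric.ball c δ := by
    intro s hs x hx δ h
    rw [mem_ball_iff_norm, hπG s hs x hx, add_sub_cancel_left, norm_mul]
    have : ‖(1 - s : ℂ)‖ = 1 - s := by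
      rw [← Complex.ofReal_one, ← Complex.ofReal_sub, Complex.norm_real, Real.norm_of_nonneg]
      linarith [hs.2]
    rwa [this]
  have hGx : ∀ x, π x ∈ D \ {c} → ContinuousOn (fun s ↦ G (s, x)) (Ico 0 1) := fun x hx ↦
    hG.comp (by fun_prop) fun s hs ↦ ⟨hs, hx⟩
  have key : ∀ x, π x ∈ D \ {c} → ∀ s ∈ Ico (0 : ℝ) 1, ∀ t ∈ Ico (0 : ℝ) 1, s ≤ t →
      (1 - s) * ‖π x - c‖ < ε → r (G (s, x)) = r (G (t, x)) := by
    intro x hx s hs t ht hst h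
    refine hr.eq_of_isPreconnected (A := Ico s 1) isPreconnected_Ico
      ((hGx x hx).mono (Ico_subset_Ico_left hs.1)) ?_ ⟨le_rfl, hs.2⟩ ⟨hst, ht.2⟩
    intro u hu
    refine hball u ⟨hs.1.trans hu.1, hu.2⟩ x hx ε (lt_of_le_of_lt ?_ h)
    gcongr
    exact hu.1
  have keyρ : ∀ x, π x ∈ D \ {c} → ∀ s ∈ Ico (0 : ℝ) 1, (1 - s) * ‖π x - c‖ < ε →
      r (G (s, x)) = ρ x := by
    intro x hx s hs h
    have h1 : ρ x = r (G (m x, x)) := if_neg hx.2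
    rw [h1]
    rcases le_total s (m x) with h | h'
    · exact key x hx s hs _ ⟨hm0 x, hm1 x⟩ h ‹_›
    · exact (key x hx _ ⟨hm0 x, hm1 x⟩ s hs h' (hm x)).symm
  have ρfix : ∀ x, π x = c → ρ x = x := fun x hx ↦ if_pos hx
  have near : ∀ x, π x ∈ D → ‖π x - c‖ < ε → ρ x = r x := by
    intro x hx hxε
    by_cases hxc : π x = c
    · rw [ρfix x hxc, hrx x hxc]
    · rw [← keyρ x ⟨hx, hxc⟩ 0 ⟨le_rfl, one_pos⟩ (by simpa using hxε), hG0 x ⟨hx, hxc⟩]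
  have hlc : LocConstOn ρ (π ⁻¹' D) := by
    intro x hx
    by_cases hxc : π x = c
    · have h1 : ∀ᶠ y in 𝓝 x, ‖π y - c‖ < ε :=
        (show Continuous fun y ↦ ‖π y - c‖ by
          fun_prop).continuousAt.eventually
          (gt_mem_nhds (by simpa [hxc] using hε))
      filter_upwards [h1, (hDo.preimage hcont).mem_nhds hx,
        hr x (by simpa [hxc] using hε)] with y h2 h3 h4
      rw [near y h3 h2, near x hx (by simpa [hxc] using hε), h4]
    · have hD'o : IsOpen (D \ {c}) := hDo.sdiff isClosed_singleton
      have h1 : ∀ᶠ y in 𝓝 x, (1 - m x) * ‖π y - c‖ < ε :=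
        (show Continuous fun y ↦ (1 - m x) * ‖π y - c‖ by
          fun_prop).continuousAt.eventually
          (gt_mem_nhds (hm x))
      have hc : ContinuousAt (fun y ↦ G (m x, y)) x := by
        have : ContinuousOn (fun y ↦ G (m x, y)) (π ⁻¹' (D \ {c})) :=
          hG.comp (by fun_prop) fun y hy ↦ ⟨⟨hm0 x, hm1 x⟩, hy⟩
        exact this.continuousAt ((hD'o.preimage hcont).mem_nhds ⟨hx, hxc⟩)
      filter_upwards [h1, (hD'o.preimage hcont).mem_nhds (show π x ∈ D \ {c} from ⟨hx, hxc⟩),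
        hc.eventually (hr _ (hball _ ⟨hm0 x, hm1 x⟩ x ⟨hx, hxc⟩ ε (hm x)))] with y h2 h3 h4
      rw [← keyρ y h3 _ ⟨hm0 x, hm1 x⟩ h2, h4, keyρ x ⟨hx, hxc⟩ _ ⟨hm0 x, hm1 x⟩ (hm x)]
  have hρc : ∀ x, π x ∈ D → π (ρ x) = c := by
    intro x hx
    by_cases hxc : π x = c
    · rw [ρfix x hxc, hxc]
    · rw [← keyρ x ⟨hx, hxc⟩ _ ⟨hm0 x, hm1 x⟩ (hm x)]
      exact hrc _ (hball _ ⟨hm0 x, hm1 x⟩ x ⟨hx, hxc⟩ ε (hm x))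
  let H : ℝ × E → E := fun p ↦ if π p.2 = c then p.2 else if p.1 < 1 then G p else ρ p.2
  have H1 : ∀ s x, π x = c → H (s, x) = x := fun s x h ↦ if_pos h
  have H2 : ∀ s x, π x ≠ c → s < 1 → H (s, x) = G (s, x) := fun s x h h' ↦ by
    simp only [H, if_neg h, if_pos h']
  have H3 : ∀ x, H (1, x) = ρ x := fun x ↦ by
    by_cases h : π x = c
    · rw [H1 _ _ h, ρfix x h]
    · simp [H, if_neg h]
  have Hnear : ∀ p, π p = c → ∀ U ∈ 𝓝 p, ∃ δ > 0, ∀ s ∈ Icc (0 : ℝ) 1, ∀ x, π x ∈ D → ρ x = p →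
      (1 - s) * ‖π x - c‖ < δ → H (s, x) ∈ U := by
    intro p hp U hU
    obtain ⟨δ, hδ, hδε, h⟩ := hrU p hp U hU
    refine ⟨δ, hδ, fun s hs x hx hxp hsx ↦ ?_⟩
    by_cases hxc : π x = c
    · rw [H1 s x hxc, ← ρfix x hxc, hxp]
      exact mem_of_mem_nhds hU
    · rcases hs.2.lt_or_eq with h1 | rfl
      · rw [H2 s x hxc h1]
        refine h _ (hball s ⟨hs.1, h1⟩ x ⟨hx, hxc⟩ δ hsx) ?_
        rw [keyρ x ⟨hx, hxc⟩ s ⟨hs.1, h1⟩ (hsx.trans_le hδε), hxp]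
      · rw [H3, hxp]
        exact mem_of_mem_nhds hU
  refine ⟨ρ, H, hlc, hρc, ρfix, ?_, ?_, fun x _ ↦ H3 x, ?_⟩
  · rintro ⟨s, x⟩ ⟨hs, hx⟩
    by_cases hsx : π x ≠ c ∧ s < 1
    · have hD'o : IsOpen (D \ {c}) := hDo.sdiff isClosed_singleton
      have hU : IsOpen (Iio (1 : ℝ) ×ˢ (π ⁻¹' (D \ {c}))) :=
        isOpen_Iio.prod (hD'o.preimage hcont)
      have h1 := hG (s, x) ⟨⟨hs.1, hsx.2⟩, hx, hsx.1⟩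
      have hU' := hU.mem_nhds (show (s, x) ∈ _ from ⟨hsx.2, hx, hsx.1⟩)
      rw [← continuousWithinAt_inter hU']
      have h2 : ContinuousWithinAt G (Icc 0 1 ×ˢ (π ⁻¹' D) ∩ Iio (1 : ℝ) ×ˢ (π ⁻¹' (D \ {c})))
          (s, x) := h1.mono (by
        rintro ⟨s', x'⟩ ⟨⟨h1, h2⟩, h3, h4⟩
        exact ⟨⟨h1.1, h3⟩, h4⟩)
      refine h2.congr ?_ (H2 s x hsx.1 hsx.2)
      rintro ⟨s', x'⟩ ⟨-, h, h'⟩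
      exact H2 s' x' h'.2 h
    · have hz : (1 - s) * ‖π x - c‖ = 0 := by
        by_cases h : π x = c
        · simp [h]
        · have : s = 1 := le_antisymm hs.2 (not_lt.1 fun h' ↦ hsx ⟨h, h'⟩)
          simp [this]
      have hHx : H (s, x) = ρ x := by
        by_cases h : π x = c
        · rw [H1 _ _ h, ρfix x h]
        · have : s = 1 := le_antisymm hs.2 (not_lt.1 fun h' ↦ hsx ⟨h, h'⟩)
          rw [this, H3]
      rw [ContinuousWithinAt, hHx]
      intro U hU
      obtain ⟨δ, hδ, h⟩ := Hnear (ρ x) (hρc x hx) U hU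
      have e1 : ∀ᶠ p : ℝ × E in 𝓝 (s, x), (1 - p.1) * ‖π p.2 - c‖ < δ :=
        (show Continuous fun p : ℝ × E ↦ (1 - p.1) * ‖π p.2 - c‖ by
          fun_prop).continuousAt.eventually
          (gt_mem_nhds (by show (1 - s) * ‖π x - c‖ < δ; rw [hz]; exact hδ))
      have e2 : ∀ᶠ p : ℝ × E in 𝓝 (s, x), ρ p.2 = ρ x :=
        (continuous_snd.tendsto (s, x)).eventually (hlc x hx)
      rw [Filter.mem_map]
      filter_upwards [mem_nhdsWithin_of_mem_nhds e1, mem_nhdsWithin_of_mem_nhds e2,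
        self_mem_nhdsWithin] with p h1 h2 h3
      exact h p.1 h3.1 p.2 h3.2 h2 h1
  · intro x hx
    by_cases h : π x = c
    · exact H1 _ _ h
    · rw [H2 _ _ h one_pos, hG0 x ⟨hx, h⟩]
  · intro s hs x hx
    by_cases h : π x = c
    · rw [H1 _ _ h, h]; simp
    · rcases hs.2.lt_or_eq with h1 | rfl
      · rw [H2 _ _ h h1, hπG s ⟨hs.1, h1⟩ x ⟨hx, h⟩]
      · rw [H3, hρc x hx]; simp

end IsBranchedCover

/-- `ρ` labels the sheets of `π` over `D` by the fiber over the point `c`. -/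
structure IsSheetMap {E : Type*} [TopologicalSpace E] (π : E → ℂ) (B : Set ℂ) (c : ℂ) (D : Set ℂ)
    (ρ : E → π ⁻¹' {c}) : Prop where
  isOpen : IsOpen D
  locConst : LocConstOn ρ (π ⁻¹' D)
  contractible : ∀ p, (π ⁻¹' D ∩ ρ ⁻¹' {p}).Nonempty →
    ContractibleSpace ↥(π ⁻¹' D ∩ ρ ⁻¹' {p})
  self_eq : ∀ p : π ⁻¹' {c}, ρ p = p
  surjOn : ∀ p, ∀ z ∈ D, ∃ x, π x = z ∧ ρ x = p
  injOn : c ∉ B → ∀ x y, π x ∈ D → π x = π y → ρ x = ρ y → x = y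

namespace IsBranchedCover

variable {E : Type*} [TopologicalSpace E] {π : E → ℂ} {B : Set ℂ}

theorem exists_isSheetMap [T2Space E] (hπ : IsBranchedCover π B) {c : ℂ} {D : Set ℂ}
    (hD : StarConvex ℝ c D) (hDo : IsOpen D) (hDB : D \ {c} ⊆ Bᶜ) (hcD : c ∈ D) :
    ∃ ρ : E → π ⁻¹' {c}, IsSheetMap π B c D ρ := by
  classical
  obtain ⟨ρ', H, hlc, hρc, ρfix, hH, hH0, hH1, hπH⟩ := hπ.exists_contraction hD hDo hDB
  obtain ⟨e₀, he₀⟩ := hπ.surjective c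
  let ρ : E → π ⁻¹' {c} := fun x ↦ if h : π (ρ' x) = c then ⟨ρ' x, h⟩ else ⟨e₀, he₀⟩
  have hρ : ∀ x, π x ∈ D → (ρ x : E) = ρ' x := fun x hx ↦ by simp [ρ, hρc x hx]
  have hρ' : LocConstOn ρ (π ⁻¹' D) := fun x hx ↦ by
    filter_upwards [hlc x hx] with y hy
    simp only [ρ, hy]
  have self : ∀ p : π ⁻¹' {c}, ρ p = p := fun p ↦ by
    apply Subtype.ext
    rw [hρ p (by simpa [show π p = c from p.2] using hcD), ρfix p p.2]
  have HD : ∀ s ∈ Icc (0 : ℝ) 1, ∀ x, π x ∈ D → π (H (s, x)) ∈ D := by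
    intro s hs x hx
    rw [hπH s hs x hx]
    have := hD hx hs.1 (by linarith [hs.2] : 0 ≤ 1 - s) (by ring)
    convert this using 1
    simp only [Complex.real_smul]
    push_cast
    ring
  have Hx : ∀ x, π x ∈ D → ContinuousOn (fun s ↦ H (s, x)) (Icc 0 1) := fun x hx ↦
    hH.comp (by fun_prop) fun s hs ↦ ⟨hs, hx⟩
  have Hρ : ∀ s ∈ Icc (0 : ℝ) 1, ∀ x, π x ∈ D → ρ (H (s, x)) = ρ x := by
    intro s hs x hx
    rw [hρ'.eq_of_isPreconnected isPreconnected_Icc (Hx x hx) (fun u hu ↦ HD u hu x hx) hs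
      (left_mem_Icc.2 zero_le_one), hH0 x hx]
  refine ⟨ρ, hDo, hρ', ?_, self, ?_, ?_⟩
  · intro p _
    rw [contractible_iff_id_nullhomotopic]
    have hp : (p : E) ∈ π ⁻¹' D ∩ ρ ⁻¹' {p} :=
      ⟨by simpa [show π p = c from p.2] using hcD, self p⟩
    refine ⟨⟨p, hp⟩, ⟨⟨⟨fun q ↦ ⟨H (q.1, q.2), HD _ q.1.2 _ q.2.2.1, ?_⟩, ?_⟩, ?_, ?_⟩⟩⟩
    · rw [mem_preimage, Hρ _ q.1.2 _ q.2.2.1]; exact q.2.2.2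
    · refine Continuous.subtype_mk ?_ _
      exact hH.comp_continuous (by fun_prop) fun q ↦ ⟨q.1.2, q.2.2.1⟩
    · intro q
      exact Subtype.ext (hH0 _ q.2.1)
    · intro q
      apply Subtype.ext
      show H (1, (q : E)) = p
      rw [hH1 _ q.2.1, ← hρ _ q.2.1, show ρ q = p from q.2.2]
  · intro p z hz
    by_cases hzc : z = c
    · exact ⟨p, by rw [hzc]; exact p.2, self p⟩
    have hU : (p : E) ∈ interior (π ⁻¹' D ∩ ρ ⁻¹' {p}) := by
      have hpD : (p : E) ∈ π ⁻¹' D := by simpa [show π p = c from p.2] using hcD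
      rw [mem_interior_iff_mem_nhds]
      filter_upwards [(hDo.preimage hπ.continuous).mem_nhds hpD, hρ' p hpD] with y h1 h2
      exact ⟨h1, h2.trans (self p)⟩
    have hV := hπ.isOpenMap _ (isOpen_interior (s := π ⁻¹' D ∩ ρ ⁻¹' {p}))
    have hc : c ∈ π '' interior (π ⁻¹' D ∩ ρ ⁻¹' {p}) := ⟨p, hU, p.2⟩
    have hcont : ContinuousAt (fun s : ℝ ↦ c + s * (z - c)) 0 := by fun_prop
    have h1 := hcont.eventually (hV.mem_nhds (by simpa using hc))
    obtain ⟨s, ⟨hs0, hs1⟩, x, hx, hxs⟩ : ∃ s : ℝ, s ∈ Ioo (0 : ℝ) 1 ∧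
        c + s * (z - c) ∈ π '' interior (π ⁻¹' D ∩ ρ ⁻¹' {p}) :=
      ((h1.filter_mono nhdsWithin_le_nhds).and
        (Ioo_mem_nhdsGT (one_pos : (0 : ℝ) < 1))).exists.imp fun s h ↦ ⟨h.2, h.1⟩
    have hxρ := interior_subset hx
    have hzc' : z - c ≠ 0 := sub_ne_zero.2 hzc
    have hj : JoinedIn (D \ {c}) (π x) z := by
      have hseg : ∀ t ∈ Icc s 1, c + t * (z - c) ∈ D \ {c} := by
        intro t ht
        have ht0 : 0 < t := hs0.trans_le ht.1
        refine ⟨?_, by simp [hzc', ht0.ne']⟩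
        have := hD hz (by linarith [ht.2] : 0 ≤ 1 - t) ht0.le (by ring)
        convert this using 1
        simp only [Complex.real_smul]
        push_cast
        ring
      have hpc : IsPathConnected ((fun t : ℝ ↦ c + t * (z - c)) '' Icc s 1) :=
        ((convex_Icc s 1).isPathConnected ⟨s, le_rfl, hs1.le⟩).image (by fun_prop)
      refine (hpc.joinedIn _ ?_ _ ?_).mono (image_subset_iff.2 hseg)
      · exact ⟨s, ⟨le_rfl, hs1.le⟩, hxs.symm⟩
      · exact ⟨1, ⟨hs1.le, le_rfl⟩, by simp⟩
    obtain ⟨y, hy, hj'⟩ := hπ.exists_lift hDB hj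
    refine ⟨y, hy, ?_⟩
    rw [hρ'.joinedIn_eq (hj'.mono (preimage_mono sdiff_subset))]
    exact hxρ.2
  · intro hcB x y hx hxy hρxy
    have hDB' : ∀ z ∈ D, z ∉ B := fun z hz ↦ by
      by_cases h : z = c
      · rwa [h]
      · exact hDB ⟨hz, h⟩
    have hy : π y ∈ D := hxy ▸ hx
    have cx : ∀ x, π x ∈ D → Continuous fun s : unitInterval ↦ H (s, x) := fun x hx ↦
      (Hx x hx).comp_continuous continuous_subtype_val fun s ↦ s.2
    have := hπ.lift_unique (cx x hx) (cx y hy) (fun t ↦ by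
      rw [hπH _ t.2 _ hx, hπH _ t.2 _ hy, hxy]) (fun t ↦ hDB' _ (HD _ t.2 _ hx)) (a := 1) (by
      show H (1, x) = H (1, y)
      rw [hH1 _ hx, hH1 _ hy, ← hρ _ hx, ← hρ _ hy, hρxy])
    have := congrFun this 0
    simpa [hH0 _ hx, hH0 _ hy] using this

end IsBranchedCover

namespace IsSheetMap

variable {E : Type*} [TopologicalSpace E] {π : E → ℂ} {B : Set ℂ} {c : ℂ} {D : Set ℂ}
  {ρ : E → π ⁻¹' {c}}

theorem joinedIn (hρ : IsSheetMap π B c D ρ) (hπ : IsBranchedCover π B) (hc : c ∉ B) {V : Set ℂ}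
    (hVB : V ⊆ Bᶜ) (hVD : V ⊆ D) {x y : E} (hV : JoinedIn V (π x) (π y)) (hxy : ρ x = ρ y) :
    JoinedIn (π ⁻¹' V) x y := by
  obtain ⟨y', hy', hj⟩ := hπ.exists_lift hVB hV
  have h1 := hρ.locConst.joinedIn_eq (hj.mono (preimage_mono hVD))
  have : y' = y := hρ.injOn hc y' y (hVD hj.target_mem) hy' (h1.trans hxy)
  rwa [← this]

end IsSheetMap

open Complex in
theorem Complex.div_pos_real_iff_arg_eq {z w : ℂ} (hz : z ≠ 0) (hw : w ≠ 0) :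
    ((z / w).im = 0 ∧ 0 < (z / w).re) ↔ arg z = arg w := by
  constructor
  · rintro ⟨h1, h2⟩
    have h3 : z = ((z / w).re : ℝ) * w := by
      have : ((z / w).re : ℂ) = z / w := Complex.ext (by simp) (by simp [h1])
      rw [this, div_mul_cancel₀ _ hw]
    rw [h3, arg_real_mul _ h2]
  · intro h
    rw [eq_comm, arg_eq_arg_iff hw hz] at h
    have h' : z / w = ((‖z‖ / ‖w‖ : ℝ) : ℂ) := by
      rw [div_eq_iff hw]
      push_cast
      exact h.symm
    rw [h']
    have h1 := norm_pos_iff.2 hz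
    have h2 := norm_pos_iff.2 hw
    exact ⟨ofReal_im _, by rw [ofReal_re]; positivity⟩

/-- The plane slit along the outer parts of the rays through the points `c j`. -/
def slitRegion {n : ℕ} (c : Fin (n + 1) → ℂ) : Set ℂ := {z | ∀ j, 1 - z / c j ∈ Complex.slitPlane}

/-- The plane without the rays through the points `c j`. -/
def sectorRegion {n : ℕ} (c : Fin (n + 1) → ℂ) : Set ℂ := {z | ∀ j, -(z / c j) ∈ Complex.slitPlane}

section

variable {n : ℕ} {c : Fin (n + 1) → ℂ}

theorem isOpen_slitRegion : IsOpen (slitRegion c) := by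
  simp only [slitRegion, ofPred_forall]
  exact isOpen_iInter_of_finite fun j ↦ Complex.isOpen_slitPlane.preimage (by fun_prop)

theorem starConvex_slitRegion : StarConvex ℝ 0 (slitRegion c) := by
  intro z hz a b ha hb hab j
  have := Complex.starConvex_one_slitPlane (hz j) ha hb hab
  convert this using 1
  simp only [smul_zero, zero_add, Complex.real_smul]
  have : (a : ℂ) = 1 - b := by rw [eq_sub_iff_add_eq]; exact_mod_cast hab
  rw [this]; ring

theorem zero_mem_slitRegion : (0 : ℂ) ∈ slitRegion c := fun j ↦ by simp

theorem mem_slitRegion_iff {z : ℂ} : z ∈ slitRegion c ↔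
    ∀ j, (z / c j).re < 1 ∨ (z / c j).im ≠ 0 := by
  simp [slitRegion, Complex.slitPlane]

theorem mem_sectorRegion_iff {z : ℂ} : z ∈ sectorRegion c ↔
    ∀ j, (z / c j).re < 0 ∨ (z / c j).im ≠ 0 := by
  simp [sectorRegion, Complex.slitPlane]

theorem inv_mem_slitRegion_iff {z : ℂ} (hc : ∀ j, c j ≠ 0) (hz : z ≠ 0) :
    z⁻¹ ∈ slitRegion c⁻¹ ↔
    ∀ j, (z / c j).re < 0 ∨ 1 < (z / c j).re ∨ (z / c j).im ≠ 0 := by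
  rw [mem_slitRegion_iff]
  refine forall_congr' fun j ↦ ?_
  have : z⁻¹ / c⁻¹ j = (z / c j)⁻¹ := by simp [div_eq_mul_inv, mul_comm]
  rw [this]
  have h0 : z / c j ≠ 0 := div_ne_zero hz (hc j)
  have hn := Complex.normSq_pos.2 h0
  simp only [Complex.inv_re, Complex.inv_im]
  by_cases him : (z / c j).im = 0
  · have hns : Complex.normSq (z / c j) = (z / c j).re * (z / c j).re := by
      rw [Complex.normSq_apply, him]; ring
    have hre : (z / c j).re ≠ 0 := fun h ↦ h0 (Complex.ext h him)
    simp only [him, neg_zero, zero_div, ne_eq, not_true, or_false, hns]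
    rw [div_mul_cancel_left₀ hre]
    rcases hre.lt_or_gt with h | h
    · have := inv_lt_zero.2 h
      simp only [h, true_or, iff_true]
      linarith
    · rw [inv_lt_one₀ h]
      simp [h.le]
  · refine iff_of_true (.inr ?_) (.inr (.inr him))
    exact div_ne_zero (neg_ne_zero.2 him) hn.ne'

theorem mem_sectorRegion_iff' {z : ℂ} (hc : ∀ j, c j ≠ 0) : z ∈ sectorRegion c ↔
    z ≠ 0 ∧ z ∈ slitRegion c ∧ z⁻¹ ∈ slitRegion c⁻¹ := by
  constructor
  · intro h
    have hz : z ≠ 0 := by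
      rintro rfl
      simpa using mem_sectorRegion_iff.1 h 0
    refine ⟨hz, mem_slitRegion_iff.2 fun j ↦ ?_, (inv_mem_slitRegion_iff hc hz).2 fun j ↦ ?_⟩
    · rcases mem_sectorRegion_iff.1 h j with h | h
      · exact .inl (h.trans one_pos)
      · exact .inr h
    · rcases mem_sectorRegion_iff.1 h j with h | h
      · exact .inl h
      · exact .inr (.inr h)
  · rintro ⟨hz, h1, h2⟩
    rw [mem_sectorRegion_iff]
    intro j
    have h1 := mem_slitRegion_iff.1 h1 j
    have h2 := (inv_mem_slitRegion_iff hc hz).1 h2 j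
    rcases h2 with h2 | h2 | h2
    · exact .inl h2
    · exact h1.imp_left fun h1 ↦ by linarith
    · exact .inr h2

theorem mem_sectorRegion_iff_arg {z : ℂ} (hc : ∀ j, c j ≠ 0) : z ∈ sectorRegion c ↔
    z ≠ 0 ∧ ∀ j, z.arg ≠ (c j).arg := by
  rw [mem_sectorRegion_iff]
  by_cases hz : z = 0
  · subst hz; simp
  simp only [ne_eq, hz, not_false_eq_true, true_and, ← Complex.div_pos_real_iff_arg_eq hz (hc _)]
  refine forall_congr' fun j ↦ ?_
  have : ¬ ((z / c j).re = 0 ∧ (z / c j).im = 0) := fun h ↦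
    div_ne_zero hz (hc j) (Complex.ext h.1 h.2)
  grind


variable (hc : ∀ j, c j ≠ 0) (hmono : StrictMono fun j ↦ (c j).arg)
  (hlast : (c (Fin.last n)).arg = Real.pi)

include hmono hlast in
theorem exists_sector_label :
    ∃ q : ℂ → Fin (n + 1), ∀ z j, (c j).arg < z.arg ↔ j < q z := by
  have : ∀ z : ℂ, ∃ k : Fin (n + 1), ∀ j, (c j).arg < z.arg ↔ j < k := by
    intro z
    have hne : ∃ k : Fin (n + 1), z.arg ≤ (c k).arg := ⟨Fin.last n, by
      rw [hlast]; exact Complex.arg_le_pi z⟩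
    obtain ⟨k, hk, hmin⟩ := WellFounded.has_min (wellFounded_lt (α := Fin (n + 1)))
      {k | z.arg ≤ (c k).arg} hne
    refine ⟨k, fun j ↦ ⟨fun h ↦ ?_, fun h ↦ ?_⟩⟩
    · by_contra hkj
      have : (c k).arg ≤ (c j).arg := hmono.monotone (not_lt.1 hkj)
      have hk : z.arg ≤ (c k).arg := hk
      linarith
    · by_contra hjk
      exact hmin j (not_lt.1 hjk) h
  exact ⟨fun z ↦ (this z).choose, fun z ↦ (this z).choose_spec⟩

/-- The open cone around the ray through `b`. -/
def coneAround (κ : ℝ) (b : ℂ) : Set ℂ := {z | |(z / b).im| < κ * (z / b).re}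

theorem isOpen_coneAround (κ : ℝ) (b : ℂ) : IsOpen (coneAround κ b) := by
  have h1 : Continuous fun z : ℂ ↦ (z / b).im := Complex.continuous_im.comp (by fun_prop)
  have h2 : Continuous fun z : ℂ ↦ (z / b).re := Complex.continuous_re.comp (by fun_prop)
  exact isOpen_lt h1.abs (h2.const_mul κ)

theorem convex_coneAround (κ : ℝ) (b : ℂ) : Convex ℝ (coneAround κ b) := by
  intro z hz w hw s t hs ht hst
  have e : (s • z + t • w) / b = (s : ℂ) * (z / b) + (t : ℂ) * (w / b) := by
    simp only [Complex.real_smul]; ring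
  simp only [coneAround, mem_ofPred_eq, e, Complex.add_im, Complex.add_re, Complex.re_ofReal_mul,
    Complex.im_ofReal_mul] at hz hw ⊢
  rw [abs_lt] at hz hw ⊢
  rcases hs.eq_or_lt with rfl | hs
  · obtain rfl : t = 1 := by linarith
    constructor <;> linarith
  · constructor <;> nlinarith

theorem mem_coneAround_self {κ : ℝ} (hκ : 0 < κ) {b : ℂ} (hb : b ≠ 0) : b ∈ coneAround κ b := by
  simp [coneAround, hb, hκ]

theorem coneAround_re_pos {κ : ℝ} (hκ : 0 < κ) {b z : ℂ} (hz : z ∈ coneAround κ b) :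
    0 < (z / b).re := by
  have := (abs_nonneg _).trans_lt (show |(z / b).im| < κ * (z / b).re from hz)
  exact pos_of_mul_pos_right this hκ.le

theorem mem_coneAround_of_pos {κ : ℝ} (hκ : 0 < κ) {b z : ℂ} (h : (z / b).im = 0)
    (h' : 0 < (z / b).re) : z ∈ coneAround κ b := by
  rw [coneAround, mem_ofPred_eq, h, abs_zero]
  positivity

theorem coneAround_inter {κ : ℝ} (hκ : 0 < κ) (hκ' : κ ≤ 1 / 2) {a b z : ℂ}
    (ha : z ∈ coneAround κ a) (hb : z ∈ coneAround κ b) :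
    0 < (b / a).re ∧ |(b / a).im| ≤ 3 * κ * (b / a).re := by
  have ha0 := coneAround_re_pos hκ ha
  have hb0 := coneAround_re_pos hκ hb
  have hz : z / b ≠ 0 := fun h ↦ by simp [h] at hb0
  have hz' : z ≠ 0 := fun h ↦ by simp [h] at hz
  have hb' : b ≠ 0 := fun h ↦ by simp [h] at hz
  have e : b / a = (z / a) / (z / b) := by field_simp
  have ha : |(z / a).im| < κ * (z / a).re := ha
  have hb : |(z / b).im| < κ * (z / b).re := hb
  rw [e]
  generalize z / a = u at *
  generalize z / b = v at *
  rw [Complex.div_re, Complex.div_im]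
  have hn := Complex.normSq_pos.2 hz
  rw [← add_div, ← sub_div, abs_div, abs_of_pos hn, ← mul_div_assoc,
    div_le_div_iff_of_pos_right hn]
  rw [abs_lt] at ha hb
  have h1 : |u.im * v.im| ≤ (κ * u.re) * (κ * v.re) := by
    rw [abs_mul]
    exact mul_le_mul (abs_lt.2 ha).le (abs_lt.2 hb).le (abs_nonneg _) (by positivity)
  have h2 : (κ * u.re) * (κ * v.re) ≤ 1 / 4 * (u.re * v.re) := by
    have h3 := mul_pos ha0 hb0
    have h4 : κ * κ ≤ 1 / 4 := by nlinarith
    calc (κ * u.re) * (κ * v.re) = κ * κ * (u.re * v.re) := by ring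
      _ ≤ _ := mul_le_mul_of_nonneg_right h4 h3.le
  rw [abs_le] at h1
  have h3 := mul_pos ha0 hb0
  refine ⟨div_pos (by linarith) hn, ?_⟩
  have h4 : |u.im * v.re| ≤ κ * (u.re * v.re) := by
    rw [abs_mul, abs_of_pos hb0]
    nlinarith [abs_lt.2 ha]
  have h5 : |u.re * v.im| ≤ κ * (u.re * v.re) := by
    rw [abs_mul, abs_of_pos ha0]
    nlinarith [abs_lt.2 hb]
  have h6 : 2 * κ * (u.re * v.re) ≤ 3 * κ * (3 / 4 * (u.re * v.re)) := by
    nlinarith [mul_pos hκ h3]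
  have h7 : 3 * κ * (3 / 4 * (u.re * v.re)) ≤ 3 * κ * (u.re * v.re + u.im * v.im) := by
    have : 0 < 3 * κ := by positivity
    nlinarith
  refine (abs_sub _ _).trans ?_
  linarith

include hc hmono in
theorem exists_disjoint_cones : ∃ κ > 0, ∀ i j z, z ∈ coneAround κ (c i) → z ∈ coneAround κ (c j) →
    i = j := by
  have h : ∀ i j, i ≠ j → ∀ᶠ κ in 𝓝[>] (0 : ℝ),
      ¬ (0 < (c j / c i).re ∧ |(c j / c i).im| ≤ 3 * κ * (c j / c i).re) := by
    intro i j hij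
    by_cases h0 : 0 < (c j / c i).re
    · have him : 0 < |(c j / c i).im| := by
        rw [abs_pos]
        intro him
        exact hij (hmono.injective
          ((Complex.div_pos_real_iff_arg_eq (hc j) (hc i)).1 ⟨him, h0⟩).symm)
      have hcont : ContinuousAt (fun κ : ℝ ↦ 3 * κ * (c j / c i).re) 0 := by fun_prop
      filter_upwards [nhdsWithin_le_nhds (hcont.eventually (gt_mem_nhds
        (show 3 * 0 * (c j / c i).re < |(c j / c i).im| by rwa [mul_zero, zero_mul])))]
        with κ hκ h
      linarith [h.2]
    · exact .of_forall fun κ hκ ↦ h0 hκ.1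
  have h' : ∀ᶠ κ in 𝓝[>] (0 : ℝ), ∀ i j, i ≠ j →
      ¬ (0 < (c j / c i).re ∧ |(c j / c i).im| ≤ 3 * κ * (c j / c i).re) := by
    simp only [Filter.eventually_all]
    exact h
  obtain ⟨κ, h1, h2, h3⟩ := (h'.and (Ioc_mem_nhdsGT (by norm_num : (0 : ℝ) < 1 / 2))).exists
  refine ⟨κ, h2, fun i j z hi hj ↦ ?_⟩
  by_contra hij
  exact h1 i j hij (coneAround_inter h2 h3 hi hj)

end

section

variable {n : ℕ} {c : Fin (n + 1) → ℂ} {κ : ℝ} {q : ℂ → Fin (n + 1)}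
  (hc : ∀ j, c j ≠ 0) (hmono : StrictMono fun j ↦ (c j).arg)
  (hlast : (c (Fin.last n)).arg = Real.pi) (hκ : 0 < κ)
  (hdisj : ∀ i j z, z ∈ coneAround κ (c i) → z ∈ coneAround κ (c j) → i = j)
  (hq : ∀ z j, (c j).arg < z.arg ↔ j < q z)

include hκ in
theorem exists_mem_coneAround_of_notMem {z : ℂ} (hz : z ∉ slitRegion c) :
    ∃ j, z ∈ coneAround κ (c j) := by
  rw [mem_slitRegion_iff] at hz
  push Not at hz
  obtain ⟨j, h1, h2⟩ := hz
  exact ⟨j, mem_coneAround_of_pos hκ h2 (by linarith)⟩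

include hκ hdisj in
theorem not_pos_of_mem_coneAround {i j : Fin (n + 1)} (hij : i ≠ j) {z : ℂ}
    (hz : z ∈ coneAround κ (c j)) : (z / c i).re ≤ 0 ∨ (z / c i).im ≠ 0 := by
  by_contra! h
  exact hij (hdisj i j z (mem_coneAround_of_pos hκ h.2 h.1) hz)

include hκ hdisj in
theorem mem_slitRegion_of_cone {j : Fin (n + 1)} {z : ℂ} (hz : z ∈ coneAround κ (c j)) :
    z ∈ slitRegion c ↔ (z / c j).re < 1 ∨ (z / c j).im ≠ 0 := by
  rw [mem_slitRegion_iff]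
  refine ⟨fun h ↦ h j, fun h i ↦ ?_⟩
  by_cases hij : i = j
  · rwa [hij]
  · exact (not_pos_of_mem_coneAround hκ hdisj hij hz).imp_left fun h ↦ by linarith

include hc hκ hdisj in
theorem mem_sectorRegion_of_cone {j : Fin (n + 1)} {z : ℂ} (hz : z ∈ coneAround κ (c j)) :
    z ∈ sectorRegion c ↔ (z / c j).im ≠ 0 := by
  rw [mem_sectorRegion_iff]
  refine ⟨fun h ↦ (h j).resolve_left (coneAround_re_pos hκ hz).not_gt, fun h i ↦ ?_⟩
  by_cases hij : i = j
  · exact .inr (hij ▸ h)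
  · have := not_pos_of_mem_coneAround hκ hdisj hij hz
    by_cases him : (z / c i).im = 0
    · have hre := this.resolve_right (not_not.2 him)
      refine .inl (hre.lt_of_ne fun h0 ↦ ?_)
      have h1 := coneAround_re_pos hκ hz
      have h2 : z / c i = 0 := Complex.ext h0 him
      rcases div_eq_zero_iff.1 h2 with h3 | h3
      · simp [h3] at h
      · exact hc i h3
    · exact .inr him

include hc hκ hdisj in
theorem mem_inv_slitRegion_of_cone {j : Fin (n + 1)} {z : ℂ} (hz : z ∈ coneAround κ (c j)) :
    z⁻¹ ∈ slitRegion c⁻¹ ↔ 1 < (z / c j).re ∨ (z / c j).im ≠ 0 := by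
  have h1 := coneAround_re_pos hκ hz
  have hz0 : z ≠ 0 := by rintro rfl; simp at h1
  rw [inv_mem_slitRegion_iff hc hz0]
  refine ⟨fun h ↦ (h j).resolve_left h1.not_gt, fun h i ↦ ?_⟩
  by_cases hij : i = j
  · exact .inr (hij ▸ h)
  · have := not_pos_of_mem_coneAround hκ hdisj hij hz
    by_cases him : (z / c i).im = 0
    · have hre := this.resolve_right (not_not.2 him)
      refine .inl (hre.lt_of_ne fun h0 ↦ ?_)
      exact div_ne_zero hz0 (hc i) (Complex.ext h0 him)
    · exact .inr (.inr him)

include hc hκ hdisj in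
theorem joinedIn_cone_inter_slitRegion {j : Fin (n + 1)} {z z' : ℂ}
    (hz : z ∈ coneAround κ (c j) ∩ slitRegion c) (hz' : z' ∈ coneAround κ (c j) ∩ slitRegion c) :
    JoinedIn (coneAround κ (c j) ∩ slitRegion c) z z' := by
  have he : ((1 / 2 : ℝ) : ℂ) * c j / c j = ((1 / 2 : ℝ) : ℂ) := mul_div_cancel_right₀ _ (hc j)
  have hm : ((1 / 2 : ℝ) : ℂ) * c j ∈ coneAround κ (c j) :=
    mem_coneAround_of_pos hκ (by rw [he, Complex.ofReal_im])
      (by rw [he, Complex.ofReal_re]; norm_num)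
  suffices StarConvex ℝ (((1 / 2 : ℝ) : ℂ) * c j) (coneAround κ (c j) ∩ slitRegion c) from
    (this.isPathConnected ⟨hm, (mem_slitRegion_of_cone hκ hdisj hm).2 (.inl (by
      rw [he, Complex.ofReal_re]; norm_num))⟩).joinedIn _ hz _ hz'
  intro y hy a b ha hb hab
  have hD := convex_coneAround κ (c j) hm hy.1 ha hb hab
  refine ⟨hD, (mem_slitRegion_of_cone hκ hdisj hD).2 ?_⟩
  have hy' := (mem_slitRegion_of_cone hκ hdisj hy.1).1 hy.2
  have e : (a • (((1 / 2 : ℝ) : ℂ) * c j) + b • y) / c j =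
      ((a * (1 / 2) : ℝ) : ℂ) + b * (y / c j) := by
    simp only [Complex.real_smul]
    have := hc j
    push_cast
    field_simp
  rw [e, Complex.add_re, Complex.add_im, Complex.ofReal_re, Complex.ofReal_im,
    Complex.re_ofReal_mul, Complex.im_ofReal_mul, zero_add]
  rcases hb.eq_or_lt with rfl | hb'
  · left; linarith
  · refine hy'.imp (fun h ↦ by nlinarith) fun h ↦ mul_ne_zero hb'.ne' h

include hc hκ hdisj in
theorem joinedIn_cone_inter_inv_slitRegion {j : Fin (n + 1)} {z z' : ℂ}
    (hz : z ∈ coneAround κ (c j) ∩ {z | z⁻¹ ∈ slitRegion c⁻¹})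
    (hz' : z' ∈ coneAround κ (c j) ∩ {z | z⁻¹ ∈ slitRegion c⁻¹}) :
    JoinedIn (coneAround κ (c j) ∩ {z | z⁻¹ ∈ slitRegion c⁻¹}) z z' := by
  have he : ((2 : ℝ) : ℂ) * c j / c j = ((2 : ℝ) : ℂ) := mul_div_cancel_right₀ _ (hc j)
  have hm : ((2 : ℝ) : ℂ) * c j ∈ coneAround κ (c j) :=
    mem_coneAround_of_pos hκ (by rw [he, Complex.ofReal_im])
      (by rw [he, Complex.ofReal_re]; norm_num)
  suffices StarConvex ℝ (((2 : ℝ) : ℂ) * c j) (coneAround κ (c j) ∩ {z | z⁻¹ ∈ slitRegion c⁻¹}) from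
    (this.isPathConnected ⟨hm, (mem_inv_slitRegion_of_cone hc hκ hdisj hm).2 (.inl (by
      rw [he, Complex.ofReal_re]; norm_num))⟩).joinedIn _ hz _ hz'
  intro y hy a b ha hb hab
  have hD := convex_coneAround κ (c j) hm hy.1 ha hb hab
  refine ⟨hD, (mem_inv_slitRegion_of_cone hc hκ hdisj hD).2 ?_⟩
  have hy' := (mem_inv_slitRegion_of_cone hc hκ hdisj hy.1).1 hy.2
  have e : (a • (((2 : ℝ) : ℂ) * c j) + b • y) / c j = ((a * 2 : ℝ) : ℂ) + b * (y / c j) := by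
    simp only [Complex.real_smul]
    have := hc j
    push_cast
    field_simp
  rw [e, Complex.add_re, Complex.add_im, Complex.ofReal_re, Complex.ofReal_im,
    Complex.re_ofReal_mul, Complex.im_ofReal_mul, zero_add]
  rcases hb.eq_or_lt with rfl | hb'
  · left; linarith
  · refine hy'.imp (fun h ↦ by nlinarith) fun h ↦ mul_ne_zero hb'.ne' h

include hc hlast in
theorem sectorRegion_subset_slitPlane : sectorRegion c ⊆ Complex.slitPlane := fun z hz ↦ by
  rw [mem_sectorRegion_iff_arg hc] at hz
  exact Complex.mem_slitPlane_iff_arg.2 ⟨hlast ▸ hz.2 _, hz.1⟩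

include hc hlast hq in
theorem locConstOn_sector_label : LocConstOn q (sectorRegion c) := by
  intro z hz
  have harg := Complex.continuousAt_arg (sectorRegion_subset_slitPlane hc hlast hz)
  have hz' := ((mem_sectorRegion_iff_arg hc).1 hz).2
  have : ∀ j, ∀ᶠ y in 𝓝 z, ((c j).arg < y.arg ↔ (c j).arg < z.arg) := by
    intro j
    rcases (hz' j).lt_or_gt with h | h
    · filter_upwards [harg.eventually (gt_mem_nhds h)] with y hy
      exact iff_of_false hy.not_gt h.not_gt
    · filter_upwards [harg.eventually (lt_mem_nhds h)] with y hy
      exact iff_of_true hy h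
  filter_upwards [Filter.eventually_all.2 this] with y hy
  exact eq_of_forall_lt_iff fun j ↦ by rw [← hq, ← hq, hy]

include hc hq in
theorem joinedIn_sectorRegion {z z' : ℂ} (hz : z ∈ sectorRegion c) (hz' : z' ∈ sectorRegion c)
    (h : q z = q z') : JoinedIn (sectorRegion c) z z' := by
  rw [mem_sectorRegion_iff_arg hc] at hz hz'
  refine JoinedIn.ofLine
    (f := fun t : ℝ ↦ Complex.exp ((1 - t) * Complex.log z + t * Complex.log z'))
    (by fun_prop) (by simp [Complex.exp_log hz.1]) (by simp [Complex.exp_log hz'.1]) ?_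
  rintro _ ⟨t, ⟨ht0, ht1⟩, rfl⟩
  rw [mem_sectorRegion_iff_arg hc]
  refine ⟨Complex.exp_ne_zero _, fun j ↦ ?_⟩
  have him : ((1 - t) * Complex.log z + t * Complex.log z').im = (1 - t) * z.arg + t * z'.arg := by
    rw [← Complex.ofReal_one, ← Complex.ofReal_sub, Complex.add_im, Complex.im_ofReal_mul,
      Complex.im_ofReal_mul, Complex.log_im, Complex.log_im]
  have key : ∀ {P : ℝ → Prop}, Convex ℝ {x | P x} → P z.arg → P z'.arg →
      P ((1 - t) * z.arg + t * z'.arg) := fun hP h1 h2 ↦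
    hP h1 h2 (sub_nonneg.2 ht1) ht0 (by ring)
  rw [Complex.arg_exp, him, (toIocMod_eq_self _).2]
  · have h1 := hq z j
    rw [h, ← hq] at h1
    rcases (hz.2 j).lt_or_gt with h2 | h2
    · have h3 : z'.arg < (c j).arg := (hz'.2 j).lt_of_le (not_lt.1 fun h ↦ h2.not_gt (h1.2 h))
      exact (key (convex_Iio _) h2 h3).ne
    · exact (key (P := fun x ↦ (c j).arg < x) (convex_Ioi _) h2 (h1.1 h2)).ne'
  · rw [show -Real.pi + 2 * Real.pi = Real.pi by ring]
    exact key (P := fun x ↦ x ∈ Ioc (-Real.pi) Real.pi) (convex_Ioc _ _) (Complex.arg_mem_Ioc z)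
      (Complex.arg_mem_Ioc z')

include hc hlast hκ hdisj hq in
theorem sector_label_eq_of_half_cone {j : Fin (n + 1)} {z z' : ℂ} (hz : z ∈ coneAround κ (c j))
    (hz' : z' ∈ coneAround κ (c j)) (h : 0 < (z / c j).im ∧ 0 < (z' / c j).im ∨
      (z / c j).im < 0 ∧ (z' / c j).im < 0) : q z = q z' := by
  have main : ∀ I : Set ℝ, Convex ℝ I → 0 ∉ I → (z / c j).im ∈ I → (z' / c j).im ∈ I →
      q z = q z' := by
    intro I hI h0 h1 h2
    have hconv : Convex ℝ (coneAround κ (c j) ∩ {z | (z / c j).im ∈ I}) := by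
      refine (convex_coneAround _ _).inter fun x hx y hy s t hs ht hst ↦ ?_
      have e : ((s • x + t • y) / c j).im = s * (x / c j).im + t * (y / c j).im := by
        rw [← Complex.im_ofReal_mul, ← Complex.im_ofReal_mul, ← Complex.add_im]
        congr 1
        simp only [Complex.real_smul]
        ring
      simp only [mem_ofPred_eq, e]
      exact hI hx hy hs ht hst
    have hsub : coneAround κ (c j) ∩ {z | (z / c j).im ∈ I} ⊆ sectorRegion c := fun x hx ↦
      (mem_sectorRegion_of_cone hc hκ hdisj hx.1).2 fun h ↦ h0 (h ▸ hx.2)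
    exact (locConstOn_sector_label hc hlast hq).eq_of_isPreconnected
      hconv.isPreconnected continuousOn_id hsub ⟨hz, h1⟩ ⟨hz', h2⟩
  rcases h with h | h
  · exact main (Ioi 0) (convex_Ioi _) (by simp) h.1 h.2
  · exact main (Iio 0) (convex_Iio _) (by simp) h.1 h.2

theorem tendsto_mul_exp_nhdsGT (b : ℂ) (s : ℝ) :
    Filter.Tendsto (fun ε : ℝ ↦ b * Complex.exp (((s * ε : ℝ) : ℂ) * Complex.I))
      (𝓝[>] 0) (𝓝 b) := by
  have : ContinuousAt (fun ε : ℝ ↦ b * Complex.exp (((s * ε : ℝ) : ℂ) * Complex.I)) 0 := by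
    fun_prop
  simpa [ContinuousAt] using this.tendsto.mono_left nhdsWithin_le_nhds

theorem Complex.arg_mul_exp {b : ℂ} (hb : b ≠ 0) {t u : ℝ} (hu : u ∈ Ioc (-Real.pi) Real.pi)
    (h : ∃ m : ℤ, b.arg + t = u + m * (2 * Real.pi)) :
    (b * Complex.exp (t * Complex.I)).arg = u := by
  obtain ⟨m, hm⟩ := h
  have : b * Complex.exp (t * Complex.I) = ‖b‖ * (Complex.cos u + Complex.sin u * Complex.I) := by
    nth_rw 1 [← Complex.norm_mul_exp_arg_mul_I b]
    rw [mul_assoc, ← Complex.exp_add, ← add_mul, ← Complex.ofReal_add, hm, ← Complex.exp_mul_I,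
      ← Complex.exp_periodic.int_mul m (u * Complex.I)]
    congr 2
    push_cast
    ring
  rw [this, Complex.arg_mul_cos_add_sin_mul_I (norm_pos_iff.2 hb) hu]

include hc hmono hκ hq in
theorem exists_sector_label_eq_left (j : Fin (n + 1)) :
    ∃ z ∈ coneAround κ (c j), (z / c j).im < 0 ∧ q z = j := by
  have hpi := Complex.neg_pi_lt_arg (c j)
  have h1 := (tendsto_mul_exp_nhdsGT (c j) (-1)).eventually
    ((isOpen_coneAround κ (c j)).mem_nhds (mem_coneAround_self hκ (hc j)))
  have h2 : ∀ᶠ ε in 𝓝[>] (0 : ℝ), ∀ i < j, (c i).arg < (c j).arg - ε := by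
    simp only [Filter.eventually_all]
    intro i hi
    filter_upwards [Ioo_mem_nhdsGT (sub_pos.2 (hmono hi))] with ε hε
    linarith [hε.2]
  obtain ⟨ε, ⟨⟨h1, h2⟩, h3⟩, h4⟩ := ((h1.and h2).and (Ioo_mem_nhdsGT Real.pi_pos)).and
    (Ioo_mem_nhdsGT (neg_lt_iff_pos_add'.1 hpi)) |>.exists
  refine ⟨_, h1, ?_, ?_⟩
  · rw [mul_div_cancel_left₀ _ (hc j), Complex.exp_ofReal_mul_I_im, neg_one_mul, Real.sin_neg,
      neg_lt_zero]
    exact Real.sin_pos_of_pos_of_lt_pi h3.1 h3.2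
  · have harg : (c j * Complex.exp (((-1 * ε : ℝ) : ℂ) * Complex.I)).arg = (c j).arg - ε :=
      Complex.arg_mul_exp (hc j) ⟨by linarith [h4.2], by linarith [Complex.arg_le_pi (c j), h4.1]⟩
        ⟨0, by simp; ring⟩
    refine eq_of_forall_lt_iff fun i ↦ ?_
    rw [← hq, harg]
    refine ⟨fun h ↦ ?_, h2 i⟩
    by_contra hij
    have : (c j).arg ≤ (c i).arg := hmono.monotone (not_lt.1 hij)
    linarith [h4.1]

include hc hmono hlast hκ hq in
theorem exists_sector_label_eq_right (j : Fin (n + 1)) :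
    ∃ z ∈ coneAround κ (c j), 0 < (z / c j).im ∧ q z = j + 1 := by
  have h1 := (tendsto_mul_exp_nhdsGT (c j) 1).eventually
    ((isOpen_coneAround κ (c j)).mem_nhds (mem_coneAround_self hκ (hc j)))
  have him : ∀ ε ∈ Ioo 0 Real.pi,
      0 < ((c j * Complex.exp (((1 * ε : ℝ) : ℂ) * Complex.I)) / c j).im := fun ε hε ↦ by
    rw [mul_div_cancel_left₀ _ (hc j), Complex.exp_ofReal_mul_I_im, one_mul]
    exact Real.sin_pos_of_pos_of_lt_pi hε.1 hε.2
  by_cases hj : j = Fin.last n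
  · have h2 : ∀ᶠ ε in 𝓝[>] (0 : ℝ), ∀ i, -Real.pi + ε < (c i).arg := by
      simp only [Filter.eventually_all]
      intro i
      filter_upwards [Ioo_mem_nhdsGT (neg_lt_iff_pos_add'.1 (Complex.neg_pi_lt_arg (c i)))]
        with ε hε
      linarith [hε.2]
    obtain ⟨ε, ⟨h1, h2⟩, h3⟩ := ((h1.and h2).and (Ioo_mem_nhdsGT Real.pi_pos)).exists
    refine ⟨_, h1, him ε h3, ?_⟩
    have harg : (c j * Complex.exp (((1 * ε : ℝ) : ℂ) * Complex.I)).arg = -Real.pi + ε :=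
      Complex.arg_mul_exp (hc j) ⟨by linarith [h3.1], by linarith [h3.2]⟩
        ⟨1, by rw [hj, hlast]; simp; ring⟩
    refine eq_of_forall_lt_iff fun i ↦ ?_
    rw [← hq, harg, hj, Fin.last_add_one]
    exact iff_of_false (h2 i).not_gt (Fin.not_lt_zero i)
  · have hjl : j < Fin.last n := Fin.lt_last_iff_ne_last.2 hj
    have hlt : (c j).arg < Real.pi := hlast ▸ hmono hjl
    have h2 : ∀ᶠ ε in 𝓝[>] (0 : ℝ), ∀ i, j < i → (c j).arg + ε < (c i).arg := by
      simp only [Filter.eventually_all]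
      intro i hi
      filter_upwards [Ioo_mem_nhdsGT (sub_pos.2 (hmono hi))] with ε hε
      linarith [hε.2]
    obtain ⟨ε, ⟨⟨h1, h2⟩, h3⟩, h4⟩ := ((h1.and h2).and (Ioo_mem_nhdsGT Real.pi_pos)).and
      (Ioo_mem_nhdsGT (sub_pos.2 hlt)) |>.exists
    refine ⟨_, h1, him ε h3, ?_⟩
    have harg : (c j * Complex.exp (((1 * ε : ℝ) : ℂ) * Complex.I)).arg = (c j).arg + ε :=
      Complex.arg_mul_exp (hc j)
        ⟨by linarith [h4.1, Complex.neg_pi_lt_arg (c j)], by linarith [h4.2]⟩ ⟨0, by simp⟩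
    refine eq_of_forall_lt_iff fun i ↦ ?_
    rw [← hq, harg, Fin.lt_def, Fin.val_add_one_of_lt hjl, Nat.lt_succ_iff]
    refine ⟨fun h ↦ ?_, fun h ↦ ?_⟩
    · by_contra hij
      exact (h2 i (not_le.1 hij)).not_gt h
    · have : (c i).arg ≤ (c j).arg := hmono.monotone h
      linarith [h4.1]

/-- Open sets `D j` around the rays through the points `c j`, and labels `q` of the sectors
between these rays. -/
structure IsPlanarCut {n : ℕ} (c : Fin (n + 1) → ℂ) (D : Fin (n + 1) → Set ℂ)
    (q : ℂ → Fin (n + 1)) : Prop where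
  isOpen : ∀ j, IsOpen (D j)
  mem : ∀ j, c j ∈ D j
  convex : ∀ j, Convex ℝ (D j)
  zero_notMem : ∀ j, 0 ∉ D j
  disj : ∀ i j z, z ∈ D i → z ∈ D j → i = j
  cover : ∀ z, z ∉ slitRegion c → ∃ j, z ∈ D j
  cover_inv : ∀ z, z ∉ range c → z ∉ slitRegion c → z⁻¹ ∈ slitRegion c⁻¹
  locConst : LocConstOn q (sectorRegion c)
  joinedIn_sector : ∀ z z', z ∈ sectorRegion c → z' ∈ sectorRegion c → q z = q z' →
    JoinedIn (sectorRegion c) z z'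
  joinedIn_slit : ∀ j z z', z ∈ D j ∩ slitRegion c → z' ∈ D j ∩ slitRegion c →
    JoinedIn (D j ∩ slitRegion c) z z'
  joinedIn_inv_slit : ∀ j z z', z ∈ D j ∩ {z | z⁻¹ ∈ slitRegion c⁻¹} →
    z' ∈ D j ∩ {z | z⁻¹ ∈ slitRegion c⁻¹} → JoinedIn (D j ∩ {z | z⁻¹ ∈ slitRegion c⁻¹}) z z'
  adj : ∀ j, ∀ z ∈ D j ∩ sectorRegion c, q z = j ∨ q z = j + 1
  exists_left : ∀ j, ∃ z ∈ D j ∩ sectorRegion c, q z = j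
  exists_right : ∀ j, ∃ z ∈ D j ∩ sectorRegion c, q z = j + 1

include hc hmono hlast in
theorem exists_isPlanarCut : ∃ D q, IsPlanarCut c D q := by
  obtain ⟨κ, hκ, hdisj⟩ := exists_disjoint_cones hc hmono
  obtain ⟨q, hq⟩ := exists_sector_label hmono hlast
  refine ⟨fun j ↦ coneAround κ (c j), q, fun j ↦ isOpen_coneAround _ _,
    fun j ↦ mem_coneAround_self hκ (hc j), fun j ↦ convex_coneAround _ _,
    fun j h ↦ by simp [coneAround] at h, hdisj, fun z ↦ exists_mem_coneAround_of_notMem hκ,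
    ?_, locConstOn_sector_label hc hlast hq, fun z z' ↦ joinedIn_sectorRegion hc hq,
    fun j z z' ↦ joinedIn_cone_inter_slitRegion hc hκ hdisj,
    fun j z z' ↦ joinedIn_cone_inter_inv_slitRegion hc hκ hdisj, ?_, ?_, ?_⟩
  · intro z hz h
    obtain ⟨j, hj⟩ := exists_mem_coneAround_of_notMem hκ h
    rw [mem_slitRegion_of_cone hκ hdisj hj] at h
    push Not at h
    refine (mem_inv_slitRegion_of_cone hc hκ hdisj hj).2 (.inl (h.1.lt_of_ne fun h1 ↦ hz ⟨j, ?_⟩))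
    exact ((div_eq_one_iff_eq (hc j)).1 (Complex.ext h1.symm h.2)).symm
  · rintro j z ⟨hz, hz'⟩
    rw [mem_sectorRegion_of_cone hc hκ hdisj hz] at hz'
    rcases hz'.lt_or_gt with h | h
    · obtain ⟨y, hy, hy1, hy2⟩ := exists_sector_label_eq_left hc hmono hκ hq j
      exact .inl ((sector_label_eq_of_half_cone hc hlast hκ hdisj hq hz hy
        (.inr ⟨h, hy1⟩)).trans hy2)
    · obtain ⟨y, hy, hy1, hy2⟩ := exists_sector_label_eq_right hc hmono hlast hκ hq j
      exact .inr ((sector_label_eq_of_half_cone hc hlast hκ hdisj hq hz hy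
        (.inl ⟨h, hy1⟩)).trans hy2)
  · intro j
    obtain ⟨y, hy, hy1, hy2⟩ := exists_sector_label_eq_left hc hmono hκ hq j
    exact ⟨y, ⟨hy, (mem_sectorRegion_of_cone hc hκ hdisj hy).2 hy1.ne⟩, hy2⟩
  · intro j
    obtain ⟨y, hy, hy1, hy2⟩ := exists_sector_label_eq_right hc hmono hlast hκ hq j
    exact ⟨y, ⟨hy, (mem_sectorRegion_of_cone hc hκ hdisj hy).2 hy1.ne'⟩, hy2⟩

end

/-- Two branched covers of the plane, glued along `z ↦ z⁻¹` to cover `X`. -/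
structure IsGluedCover {X E E' : Type*} [TopologicalSpace X] [TopologicalSpace E]
    [TopologicalSpace E'] (ι : E → X) (ι' : E' → X) (π : E → ℂ) (π' : E' → ℂ) : Prop where
  isOpenEmbedding : IsOpenEmbedding ι
  isOpenEmbedding' : IsOpenEmbedding ι'
  cover : ∀ x, x ∈ range ι ∨ x ∈ range ι'
  eq_inv : ∀ e e', ι e = ι' e' → π e ≠ 0 ∧ π' e' = (π e)⁻¹
  exists_right : ∀ e, π e ≠ 0 → ∃ e', ι e = ι' e'
  exists_left : ∀ e', π' e' ≠ 0 → ∃ e, ι e = ι' e'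

theorem LocConstOn.image {X E S : Type*} [TopologicalSpace X] [TopologicalSpace E] {ι : E → X}
    (hι : IsOpenEmbedding ι) {ρ : E → S} {A : Set E} (h : LocConstOn ρ A) {r : X → E}
    (hr : ∀ e, r (ι e) = e) : LocConstOn (ρ ∘ r) (ι '' A) := by
  rintro _ ⟨e, he, rfl⟩
  rw [← hι.map_nhds_eq, Filter.eventually_map]
  simpa [hr] using h e he

theorem LocConstOn.mono {X S : Type*} [TopologicalSpace X] {ρ : X → S} {W W' : Set X}
    (h : LocConstOn ρ W) (hW : W' ⊆ W) : LocConstOn ρ W' := fun x hx ↦ h x (hW hx)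

theorem LocConstOn.comp_right {X Y S : Type*} [TopologicalSpace X] [TopologicalSpace Y] {ρ : X → S}
    {W : Set X} (h : LocConstOn ρ W) {f : Y → X} (hf : Continuous f) :
    LocConstOn (ρ ∘ f) (f ⁻¹' W) :=
  fun y hy ↦ hf.continuousAt.eventually (h (f y) hy)

theorem JoinedIn.inv₀ {A : Set ℂ} (hA : 0 ∉ A) {z w : ℂ} (h : JoinedIn A z w) :
    JoinedIn {y | y⁻¹ ∈ A} z⁻¹ w⁻¹ := by
  have : ContinuousOn (fun z : ℂ ↦ z⁻¹) A := continuousOn_inv₀.mono fun z hz h ↦ hA (h ▸ hz)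
  refine (h.map_continuousOn this).mono ?_
  rintro _ ⟨z, hz, rfl⟩
  simpa using hz

theorem slitRegion_subset {n : ℕ} {c : Fin (n + 1) → ℂ} (hc : ∀ j, c j ≠ 0) :
    slitRegion c ⊆ (range c)ᶜ := by
  rintro _ h ⟨j, rfl⟩
  have := h j
  simp [hc j] at this

theorem IsGluedCover.exists_sheetDecomposition {X E E' : Type*} [TopologicalSpace X]
    [TopologicalSpace E] [TopologicalSpace E'] [T2Space E] [T2Space E'] {ι : E → X} {ι' : E' → X}
    {π : E → ℂ} {π' : E' → ℂ} {B B' : Set ℂ} (hι : IsGluedCover ι ι' π π')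
    (hπ : IsBranchedCover π B) (hπ' : IsBranchedCover π' B') {n : ℕ} {c : Fin (n + 1) → ℂ}
    (hc : ∀ j, c j ≠ 0) (hmono : StrictMono fun j ↦ (c j).arg)
    (hlast : (c (Fin.last n)).arg = Real.pi) (hB : B ⊆ range c) (hB' : B' ⊆ range c⁻¹)
    (hconn : IsPreconnected (π ⁻¹' (range c)ᶜ)) :
    Nonempty (SheetDecomposition X n (π ⁻¹' {0}) (π' ⁻¹' {0}) (fun j ↦ π ⁻¹' {c j})) := by
  obtain ⟨D, q, hD⟩ := exists_isPlanarCut hc hmono hlast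
  have hc' : ∀ j, c⁻¹ j ≠ 0 := fun j ↦ inv_ne_zero (hc j)
  have hsB : slitRegion c ⊆ Bᶜ := (slitRegion_subset hc).trans (compl_subset_compl.2 hB)
  have hsB' : slitRegion c⁻¹ ⊆ B'ᶜ := (slitRegion_subset hc').trans (compl_subset_compl.2 hB')
  have h0B := hsB zero_mem_slitRegion
  have h0B' := hsB' zero_mem_slitRegion
  obtain ⟨r, hr⟩ : ∃ r : X → E, ∀ e, r (ι e) = e :=
    have : Nonempty E := ⟨(hπ.surjective 0).choose⟩
    ⟨Function.invFun ι, Function.leftInverse_invFun hι.isOpenEmbedding.injective⟩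
  obtain ⟨r', hr'⟩ : ∃ r : X → E', ∀ e, r (ι' e) = e :=
    have : Nonempty E' := ⟨(hπ'.surjective 0).choose⟩
    ⟨Function.invFun ι', Function.leftInverse_invFun hι.isOpenEmbedding'.injective⟩
  obtain ⟨ρ₀, hρ₀⟩ := hπ.exists_isSheetMap starConvex_slitRegion isOpen_slitRegion
    (sdiff_subset.trans hsB) zero_mem_slitRegion
  obtain ⟨ρ₀', hρ₀'⟩ := hπ'.exists_isSheetMap starConvex_slitRegion isOpen_slitRegion
    (sdiff_subset.trans hsB') zero_mem_slitRegion
  have hρ : ∀ j, ∃ ρ : E → π ⁻¹' {c j}, IsSheetMap π B (c j) (D j) ρ := fun j ↦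
    hπ.exists_isSheetMap ((hD.convex j).starConvex (hD.mem j)) (hD.isOpen j) (by
      rintro z ⟨hz, hzj⟩ hzB
      obtain ⟨i, rfl⟩ := hB hzB
      obtain rfl := hD.disj i j _ (hD.mem i) hz
      exact hzj rfl) (hD.mem j)
  choose ρ hρ using hρ
  have hsec : ∀ z, z ∈ sectorRegion c ↔ z ≠ 0 ∧ z ∈ slitRegion c ∧ z⁻¹ ∈ slitRegion c⁻¹ :=
    fun z ↦ mem_sectorRegion_iff' hc
  set Wo : Set X := ι '' (π ⁻¹' slitRegion c) with hWo
  set Wi : Set X := Set.image ι' (π' ⁻¹' slitRegion c⁻¹) with hWi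
  set W : Fin (n + 1) → Set X := fun j ↦ ι '' (π ⁻¹' D j) with hW
  have mem_Wo : ∀ e, ι e ∈ Wo ↔ π e ∈ slitRegion c := fun e ↦
    hι.isOpenEmbedding.injective.mem_set_image
  have mem_W : ∀ j e, ι e ∈ W j ↔ π e ∈ D j := fun j e ↦
    hι.isOpenEmbedding.injective.mem_set_image
  have mem_Wi : ∀ e, ι e ∈ Wi ↔ π e ≠ 0 ∧ (π e)⁻¹ ∈ slitRegion c⁻¹ := by
    intro e
    constructor
    · rintro ⟨e', he', h⟩
      obtain ⟨h1, h2⟩ := hι.eq_inv e e' h.symm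
      exact ⟨h1, h2 ▸ he'⟩
    · rintro ⟨h1, h2⟩
      obtain ⟨e', he'⟩ := hι.exists_right e h1
      exact ⟨e', by rw [mem_preimage, (hι.eq_inv e e' he').2]; exact h2, he'.symm⟩
  have lc_o : LocConstOn (ρ₀ ∘ r) Wo := hρ₀.locConst.image hι.isOpenEmbedding hr
  have lc_i : LocConstOn (ρ₀' ∘ r') Wi := hρ₀'.locConst.image hι.isOpenEmbedding' hr'
  have lc : ∀ j, LocConstOn (ρ j ∘ r) (W j) := fun j ↦ (hρ j).locConst.image hι.isOpenEmbedding hr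
  have hWoWi : Wo ∩ Wi = ι '' (π ⁻¹' sectorRegion c) := by
    ext x
    constructor
    · rintro ⟨⟨e, he, rfl⟩, hx⟩
      rw [mem_Wi] at hx
      exact ⟨e, (hsec _).2 ⟨hx.1, he, hx.2⟩, rfl⟩
    · rintro ⟨e, he, rfl⟩
      have := (hsec _).1 he
      exact ⟨(mem_Wo e).2 this.2.1, (mem_Wi e).2 ⟨this.1, this.2.2⟩⟩
  have hWWo : ∀ j, W j ∩ Wo = ι '' (π ⁻¹' (D j ∩ slitRegion c)) := fun j ↦ by
    rw [preimage_inter, image_inter hι.isOpenEmbedding.injective]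
  have lc_q : LocConstOn ((q ∘ π) ∘ r) (Wo ∩ Wi) := by
    rw [hWoWi]
    exact (hD.locConst.comp_right hπ.continuous).image hι.isOpenEmbedding hr
  have joined_oi : ∀ x ∈ Wo ∩ Wi, ∀ y ∈ Wo ∩ Wi, q (π (r x)) = q (π (r y)) →
      ρ₀ (r x) = ρ₀ (r y) → JoinedIn (Wo ∩ Wi) x y := by
    rw [hWoWi]
    rintro _ ⟨e, he, rfl⟩ _ ⟨a, ha, rfl⟩ h1 h2
    rw [hr, hr] at h1 h2
    have hs : sectorRegion c ⊆ slitRegion c := fun z hz ↦ ((hsec z).1 hz).2.1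
    exact (hρ₀.joinedIn hπ h0B (hs.trans hsB) hs (hD.joinedIn_sector _ _ he ha h1) h2).map
      hι.isOpenEmbedding.continuous
  have joined_o : ∀ j, ∀ x ∈ W j ∩ Wo, ∀ y ∈ W j ∩ Wo, ρ₀ (r x) = ρ₀ (r y) →
      JoinedIn (W j ∩ Wo) x y := by
    intro j
    rw [hWWo]
    rintro _ ⟨e, he, rfl⟩ _ ⟨a, ha, rfl⟩ h2
    rw [hr, hr] at h2
    exact (hρ₀.joinedIn hπ h0B (inter_subset_right.trans hsB) inter_subset_right
      (hD.joinedIn_slit j _ _ he ha) h2).map hι.isOpenEmbedding.continuous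
  have hWWi : ∀ j, W j ∩ Wi =
      Set.image ι' (π' ⁻¹' {y | y⁻¹ ∈ D j ∩ {z | z⁻¹ ∈ slitRegion c⁻¹}}) := by
    intro j
    ext x
    constructor
    · rintro ⟨⟨e, he, rfl⟩, ⟨e', he', h⟩⟩
      refine ⟨e', ?_, h⟩
      rw [mem_preimage, mem_ofPred_eq, (hι.eq_inv e e' h.symm).2, inv_inv]
      exact ⟨he, by rw [mem_ofPred_eq, ← (hι.eq_inv e e' h.symm).2]; exact he'⟩
    · rintro ⟨e', ⟨h1, h2⟩, rfl⟩
      have hne : π' e' ≠ 0 := fun h ↦ hD.zero_notMem j (by simpa [h] using h1)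
      obtain ⟨e, he⟩ := hι.exists_left e' hne
      refine ⟨⟨e, ?_, he⟩, e', by simpa using h2, rfl⟩
      rwa [(hι.eq_inv e e' he).2, inv_inv] at h1
  have joined_i : ∀ j, ∀ x ∈ W j ∩ Wi, ∀ y ∈ W j ∩ Wi, ρ₀' (r' x) = ρ₀' (r' y) →
      JoinedIn (W j ∩ Wi) x y := by
    intro j
    rw [hWWi]
    rintro _ ⟨e, he, rfl⟩ _ ⟨a, ha, rfl⟩ h2
    rw [hr', hr'] at h2
    have hs : {y : ℂ | y⁻¹ ∈ D j ∩ {z | z⁻¹ ∈ slitRegion c⁻¹}} ⊆ slitRegion c⁻¹ := fun y hy ↦ by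
      simpa using hy.2
    refine (hρ₀'.joinedIn hπ' h0B' (hs.trans hsB') hs ?_ h2).map
      hι.isOpenEmbedding'.continuous
    have := (hD.joinedIn_inv_slit j _ _ he ha).inv₀ (fun h ↦ hD.zero_notMem j h.1)
    rwa [inv_inv, inv_inv] at this
  -- representatives of the sheets in each sector
  choose z hz hqz using hD.exists_left
  choose z' hz' hqz' using hD.exists_right
  have hzs : ∀ j, z j ∈ slitRegion c := fun j ↦ ((hsec _).1 (hz j).2).2.1
  have hex : ∀ j s, ∃ e, π e = z j ∧ ρ₀ e = s := fun j s ↦ hρ₀.surjOn s _ (hzs j)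
  choose a ha haρ using hex
  have ha_eq : ∀ j e, π e = z j → a j (ρ₀ e) = e := fun j e he ↦
    hρ₀.injOn h0B _ _ (by rw [ha]; exact hzs j) (by rw [ha, he]) (haρ _ _)
  have haW : ∀ j s, ι (a j s) ∈ W j := fun j s ↦ (mem_W _ _).2 (by rw [ha]; exact (hz j).1)
  have haoi : ∀ j s, ι (a j s) ∈ Wo ∩ Wi := fun j s ↦ by
    rw [hWoWi]; exact ⟨_, by rw [mem_preimage, ha]; exact (hz j).2, rfl⟩
  have hbij : ∀ j, Function.Bijective fun s ↦ ρ₀' (r' (ι (a j s))) := by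
    intro j
    constructor
    · intro s t hst
      obtain ⟨e, he, h1⟩ := (haoi j s).2
      obtain ⟨f, hf, h2⟩ := (haoi j t).2
      simp only [← h1, ← h2, hr'] at hst
      have h3 : π' e = π' f := by
        rw [(hι.eq_inv _ _ h1.symm).2, (hι.eq_inv _ _ h2.symm).2, ha, ha]
      have h4 := hρ₀'.injOn h0B' e f he h3 hst
      rw [← haρ j s, ← haρ j t]
      congr 1
      exact hι.isOpenEmbedding.injective (by rw [← h1, ← h2, h4])
    · intro s'
      have h1 := (hsec _).1 (hz j).2
      obtain ⟨e', he', h2⟩ := hρ₀'.surjOn s' _ h1.2.2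
      obtain ⟨e, he⟩ := hι.exists_left e' (by rw [he']; exact inv_ne_zero h1.1)
      have h3 := (hι.eq_inv e e' he).2
      rw [he', inv_inj] at h3
      refine ⟨ρ₀ e, ?_⟩
      simp only [ha_eq j e h3.symm, he, hr', h2]
  let σ : ∀ j : Fin (n + 1), (π ⁻¹' {0}) ≃ (π' ⁻¹' {0}) := fun j ↦ Equiv.ofBijective _ (hbij j)
  have hσ : ∀ j s, σ j s = ρ₀' (r' (ι (a j s))) := fun j s ↦ rfl
  have hρi : ∀ x ∈ Wo, x ∈ Wi → ρ₀' (r' x) = σ (q (π (r x))) (ρ₀ (r x)) := by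
    intro x hx hx'
    refine (lc_i.joinedIn_eq ((joined_oi x ⟨hx, hx'⟩ _ (haoi (q (π (r x))) (ρ₀ (r x))) ?_ ?_).mono
      inter_subset_right)).symm
    · rw [hr, ha, hqz]
    · rw [hr, haρ]
  have hρo : ∀ j, ∀ x ∈ W j, x ∈ Wo → ρ j (r x) = ρ j (a j (ρ₀ (r x))) := by
    intro j x hx hx'
    have := (lc j).joinedIn_eq ((joined_o j x ⟨hx, hx'⟩ _ ⟨haW j (ρ₀ (r x)), (haoi _ _).1⟩ (by
      rw [hr, haρ])).mono inter_subset_left)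
    simpa [hr] using this.symm
  refine ⟨{
    Wo := Wo, Wi := Wi, W := W, ρo := ρ₀ ∘ r, ρi := ρ₀' ∘ r', ρ := fun j ↦ ρ j ∘ r,
    q := (q ∘ π) ∘ r, σ := σ, κ := fun j s ↦ ρ j (a j s)
    κ' := fun j s' ↦ ρ j (a j ((σ j).symm s'))
    isOpen_Wo := hι.isOpenEmbedding.isOpenMap _ (isOpen_slitRegion.preimage hπ.continuous)
    isOpen_Wi := hι.isOpenEmbedding'.isOpenMap _ (isOpen_slitRegion.preimage hπ'.continuous)
    isOpen_W := fun j ↦ hι.isOpenEmbedding.isOpenMap _ ((hD.isOpen j).preimage hπ.continuous)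
    cover := ?_
    disj := ?_
    lc_o := lc_o, lc_i := lc_i, lc := lc, lc_q := lc_q
    sc_o := ?_, sc_i := ?_, sc := ?_
    ρi_eq := hρi, ρ_eq_o := hρo, ρ_eq_i := ?_, joined_oi := joined_oi, joined_o := joined_o
    joined_i := joined_i, q_adj := ?_, exists_left := ?_, exists_right := ?_, κ_surj := ?_
    transitive := ?_ }⟩
  · have h : ∀ e, ι e ∈ Wo ∨ ∃ j, ι e ∈ W j := by
      intro e
      by_cases he : π e ∈ slitRegion c
      · exact .inl ((mem_Wo e).2 he)
      · obtain ⟨j, hj⟩ := hD.cover _ he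
        exact .inr ⟨j, (mem_W j e).2 hj⟩
    intro x
    rcases hι.cover x with ⟨e, rfl⟩ | ⟨e', rfl⟩
    · exact (h e).imp_right .inr
    · by_cases he : π' e' = 0
      · exact .inr (.inl ⟨e', by rw [mem_preimage, he]; exact zero_mem_slitRegion, rfl⟩)
      · obtain ⟨e, he⟩ := hι.exists_left e' he
        rw [← he]
        exact (h e).imp_right .inr
  · rintro i j _ ⟨e, he, rfl⟩ hj
    exact hD.disj i j _ he ((mem_W j e).1 hj)
  · intro s
    convert RelSimplyConnected.image_of_contractible (hρ₀.contractible s)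
      hι.isOpenEmbedding.isEmbedding
    ext x
    constructor
    · rintro ⟨⟨e, he, rfl⟩, hx⟩
      exact ⟨e, ⟨he, by simpa [hr] using hx⟩, rfl⟩
    · rintro ⟨e, ⟨he, hx⟩, rfl⟩
      exact ⟨⟨e, he, rfl⟩, by simpa [hr] using hx⟩
  · intro s
    convert RelSimplyConnected.image_of_contractible (hρ₀'.contractible s)
      hι.isOpenEmbedding'.isEmbedding
    ext x
    constructor
    · rintro ⟨⟨e, he, rfl⟩, hx⟩
      exact ⟨e, ⟨he, by simpa [hr'] using hx⟩, rfl⟩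
    · rintro ⟨e, ⟨he, hx⟩, rfl⟩
      exact ⟨⟨e, he, rfl⟩, by simpa [hr'] using hx⟩
  · intro j s
    convert RelSimplyConnected.image_of_contractible ((hρ j).contractible s)
      hι.isOpenEmbedding.isEmbedding
    ext x
    constructor
    · rintro ⟨⟨e, he, rfl⟩, hx⟩
      exact ⟨e, ⟨he, by simpa [hr] using hx⟩, rfl⟩
    · rintro ⟨e, ⟨he, hx⟩, rfl⟩
      exact ⟨⟨e, he, rfl⟩, by simpa [hr] using hx⟩
  · intro j x hx hx'
    have := (lc j).joinedIn_eq ((joined_i j x ⟨hx, hx'⟩ _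
      ⟨haW j ((σ j).symm (ρ₀' (r' x))), (haoi _ _).2⟩ (by
        rw [← hσ, Equiv.apply_symm_apply])).mono inter_subset_left)
    simpa [hr] using this.symm
  · rintro j _ ⟨e, he, rfl⟩ h1 h2
    simp only [Function.comp, hr]
    exact hD.adj j _ ⟨he, (hsec _).2 ⟨((mem_Wi e).1 h2).1, (mem_Wo e).1 h1, ((mem_Wi e).1 h2).2⟩⟩
  · intro j s
    exact ⟨_, haW j s, (haoi j s).1, (haoi j s).2, by simp [hr, ha, hqz], by simp [hr, haρ]⟩
  · intro j s
    have h1 := (hsec _).1 (hz' j).2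
    obtain ⟨e, he, hs⟩ := hρ₀.surjOn s _ h1.2.1
    exact ⟨ι e, (mem_W j e).2 (he ▸ (hz' j).1), (mem_Wo e).2 (he ▸ h1.2.1),
      (mem_Wi e).2 (he ▸ ⟨h1.1, h1.2.2⟩), by simp [hr, he, hqz'], by simp [hr, hs]⟩
  · intro j p
    obtain ⟨e, he, hp⟩ := (hρ j).surjOn p _ (hz j).1
    exact ⟨ρ₀ e, by simp only [ha_eq j e he, hp]⟩
  · intro A A' hAA'
    classical
    let m : E → Prop := fun e ↦
      if π e ∈ slitRegion c then ρ₀ e ∈ A else ρ₀' (r' (ι e)) ∈ A'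
    have hm1 : ∀ e, π e ∈ slitRegion c → m e = (ρ₀ e ∈ A) := fun e he ↦ if_pos he
    have hm2 : ∀ e, ι e ∈ Wi → m e = (ρ₀' (r' (ι e)) ∈ A') := by
      intro e he
      by_cases h : π e ∈ slitRegion c
      · rw [hm1 e h, hρi (ι e) ((mem_Wo e).2 h) he, ← hAA', hr]
      · exact if_neg h
    have hm : LocConstOn m (π ⁻¹' (range c)ᶜ) := by
      intro e he
      by_cases h : π e ∈ slitRegion c
      · filter_upwards [hρ₀.locConst e h, hπ.continuous.continuousAt.eventually
          (isOpen_slitRegion.mem_nhds h)] with x hx hx'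
        rw [hm1 x hx', hm1 e h, hx]
      · have h0 : π e ≠ 0 := fun h0 ↦ h (h0 ▸ zero_mem_slitRegion)
        have h1 := (mem_Wi e).2 ⟨h0, hD.cover_inv _ he h⟩
        have hWio : IsOpen Wi :=
          hι.isOpenEmbedding'.isOpenMap _ (isOpen_slitRegion.preimage hπ'.continuous)
        have hc := hι.isOpenEmbedding.continuous.continuousAt (x := e)
        filter_upwards [hc.eventually (lc_i _ h1), hc.eventually (hWio.mem_nhds h1)] with x hx hx'
        rw [hm2 x hx', hm2 e h1]
        exact congrArg (· ∈ A') hx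
    have key : ∀ s t : π ⁻¹' {0}, s ∈ A → t ∈ A := by
      intro s t hs
      have hmem : ∀ s : π ⁻¹' {0}, π s ∈ slitRegion c := fun s ↦ by
        rw [show π s = 0 from s.2]; exact zero_mem_slitRegion
      have := hm.eq_of_isPreconnected hconn continuousOn_id (fun _ h ↦ h)
        (slitRegion_subset hc (hmem s)) (slitRegion_subset hc (hmem t))
      simp only [id] at this
      rw [hm1 _ (hmem s), hm1 _ (hmem t), hρ₀.self_eq, hρ₀.self_eq] at this
      exact this ▸ hs
    rcases A.eq_empty_or_nonempty with h | ⟨s, hs⟩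
    · exact .inl h
    · exact .inr (eq_univ_of_forall fun t ↦ key s t hs)

end

namespace Polynomial

open Set Topology Filter

section

variable {f : ℂ[X][X]} {d : ℕ}

theorem evalEval_eq_sum (f : ℂ[X][X]) (z w : ℂ) :
    f.evalEval z w = ∑ k ∈ Finset.range (f.natDegree + 1), (f.coeff k).eval z * w ^ k := by
  rw [evalEval, eval_eq_sum_range (p := f), eval_finsetSum]
  simp

theorem contDiff_evalEval (f : ℂ[X][X]) :
    ContDiff ℂ 1 fun p : ℂ × ℂ ↦ f.evalEval p.1 p.2 := by
  simp only [Polynomial.evalEval_eq_sum]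
  refine ContDiff.sum fun k _ ↦ .mul ?_ (contDiff_snd.pow k)
  simp only [← Polynomial.coe_aeval_eq_eval]
  exact (Polynomial.contDiff_aeval _ _).comp contDiff_fst

theorem continuous_evalEval (f : ℂ[X][X]) :
    Continuous fun p : ℂ × ℂ ↦ f.evalEval p.1 p.2 :=
  f.contDiff_evalEval.continuous

theorem hasDerivAt_evalEval_right (f : ℂ[X][X]) (z w : ℂ) :
    HasDerivAt (fun w ↦ f.evalEval z w) (f.derivative.evalEval z w) w := by
  simp only [← map_evalRingHom_eval]
  rw [← derivative_map]
  exact Polynomial.hasDerivAt _ _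

/-- `w z` lists the roots of the fiber polynomial of `f` over `z`. -/
def IsRootVector (f : ℂ[X][X]) (d : ℕ) (w : ℂ → Fin d → ℂ) : Prop :=
  ∀ z, f.map (evalRingHom z) = ∏ i, (X - C (w z i))

theorem exists_isRootVector (hf : f.Monic) (hd : f.natDegree = d) : ∃ w, IsRootVector f d w := by
  have : ∀ z, ∃ w : Fin d → ℂ, f.map (evalRingHom z) = ∏ i, (X - C (w i)) := by
    intro z
    have hm := hf.map (evalRingHom z)
    have hs := IsAlgClosed.splits (f.map (evalRingHom z))
    have h1 := hs.natDegree_eq_card_roots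
    rw [hf.natDegree_map, hd] at h1
    obtain ⟨l, hl⟩ := Quot.exists_rep (f.map (evalRingHom z)).roots
    have hl' : l.length = d := by
      rw [h1, ← hl]; rfl
    subst hl'
    refine ⟨l.get, ?_⟩
    have h2 := hs.eq_prod_roots_of_monic hm
    rw [← hl] at h2
    refine h2.trans ?_
    rw [Fin.prod_univ_def, ← List.ofFn_eq_map]
    change (Multiset.map _ (l : Multiset ℂ)).prod = _
    rw [Multiset.map_coe, Multiset.prod_coe]
    conv_lhs => rw [← List.ofFn_get l, List.map_ofFn]
    rfl
  choose w hw using this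
  exact ⟨w, hw⟩

theorem IsRootVector.evalEval {w} (hw : IsRootVector f d w) (z t : ℂ) :
    f.evalEval z t = ∏ i, (t - w z i) := by
  rw [← map_evalRingHom_eval, hw z, eval_prod]
  simp

theorem IsRootVector.root_iff {w} (hw : IsRootVector f d w) {z t : ℂ} :
    f.evalEval z t = 0 ↔ ∃ i, w z i = t := by
  rw [hw.evalEval, Finset.prod_eq_zero_iff]
  simp [sub_eq_zero, eq_comm]

theorem exists_root_bound (hf : f.Monic) : ∃ M : ℂ → ℝ, Continuous M ∧
    ∀ z w, f.evalEval z w = 0 → ‖w‖ ≤ M z := by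
  refine ⟨fun z ↦ ∑ k ∈ Finset.range f.natDegree, ‖(f.coeff k).eval z‖ + 1, ?_, ?_⟩
  · exact (continuous_finsetSum _ fun k _ ↦ (Polynomial.continuous _).norm).add_const 1
  · intro z w h
    have hm := hf.map (evalRingHom z)
    have h1 := Polynomial.IsRoot.norm_lt_cauchyBound hm.ne_zero (a := w) (by
      rw [IsRoot, map_evalRingHom_eval, h])
    rw [cauchyBound, hm.leadingCoeff, nnnorm_one, div_one, hf.natDegree_map] at h1
    have h2 : (Finset.range f.natDegree).sup (fun k ↦ ‖(f.map (evalRingHom z)).coeff k‖₊) ≤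
        ∑ k ∈ Finset.range f.natDegree, ‖(f.map (evalRingHom z)).coeff k‖₊ :=
      Finset.sup_le fun k hk ↦ Finset.single_le_sum
        (f := fun k ↦ ‖(f.map (evalRingHom z)).coeff k‖₊)
        (fun _ _ ↦ zero_le) hk
    have h3 : ‖w‖₊ ≤ _ := h1.le.trans (add_le_add_left h2 1)
    have h4 := NNReal.coe_le_coe.2 h3
    push_cast [coeff_map] at h4
    exact h4

theorem IsRootVector.exists_tendsto {w} (hw : IsRootVector f d w) (hf : f.Monic) {b : ℂ}
    {α : Type*} {𝒰 : Ultrafilter α} {z : α → ℂ} (hz : Tendsto z 𝒰 (𝓝 b)) :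
    ∃ v : Fin d → ℂ, (∀ i, Tendsto (fun a ↦ w (z a) i) 𝒰 (𝓝 (v i))) ∧
      f.map (evalRingHom b) = ∏ i, (X - C (v i)) := by
  obtain ⟨M, hM, hwM⟩ := exists_root_bound hf
  have hb : ∀ᶠ a in 𝒰, w (z a) ∈ Metric.closedBall (0 : Fin d → ℂ) (max (M b + 1) 0) := by
    filter_upwards [hz.eventually (hM.continuousAt.eventually (gt_mem_nhds (lt_add_one (M b))))]
      with a ha
    rw [mem_closedBall_zero_iff, pi_norm_le_iff_of_nonneg (le_max_right _ _)]
    exact fun i ↦ ((hwM (z a) _ (hw.root_iff.2 ⟨i, rfl⟩)).trans ha.le).trans (le_max_left _ _)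
  obtain ⟨v, -, hv⟩ := (isCompact_closedBall (0 : Fin d → ℂ) (max (M b + 1) 0)).ultrafilter_le_nhds
    (𝒰.map fun a ↦ w (z a)) (le_principal_iff.2 hb)
  have hv' : ∀ i, Tendsto (fun a ↦ w (z a) i) 𝒰 (𝓝 (v i)) := tendsto_pi_nhds.1 hv
  refine ⟨v, hv', Polynomial.funext fun t ↦ ?_⟩
  rw [map_evalRingHom_eval, eval_prod]
  have h1 : Tendsto (fun a ↦ f.evalEval (z a) t) 𝒰 (𝓝 (f.evalEval b t)) :=
    ((f.continuous_evalEval.comp (by fun_prop : Continuous fun z : ℂ ↦ (z, t))).tendsto b).comp hz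
  have h2 : Tendsto (fun a ↦ ∏ i, (t - w (z a) i)) 𝒰 (𝓝 (∏ i, (t - v i))) :=
    tendsto_finsetProd _ fun i _ ↦ (hv' i).const_sub t
  simp only [hw.evalEval] at h1 ⊢
  simpa using tendsto_nhds_unique h1 h2

end

/-- The affine curve `f = 0`. -/
def affineCurve (f : ℂ[X][X]) : Set (ℂ × ℂ) := {p | f.evalEval p.1 p.2 = 0}

/-- The projection of the affine curve `f = 0` to the first coordinate. -/
def affineCurve.proj (f : ℂ[X][X]) (p : affineCurve f) : ℂ := p.1.1

section

variable {f : ℂ[X][X]} {d : ℕ}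

theorem affineCurve.continuous_proj : Continuous (affineCurve.proj f) :=
  continuous_fst.comp continuous_subtype_val

theorem affineCurve.isClosed : IsClosed (affineCurve f) :=
  isClosed_eq f.continuous_evalEval continuous_const

theorem affineCurve.isProperMap_proj (hf : f.Monic) : IsProperMap (affineCurve.proj f) := by
  rw [isProperMap_iff_ultrafilter]
  refine ⟨continuous_proj, fun 𝒰 b h𝒰 ↦ ?_⟩
  obtain ⟨w, hw⟩ := exists_isRootVector hf rfl
  obtain ⟨v, hv, hbv⟩ := hw.exists_tendsto hf h𝒰
  have h1 : ∀ᶠ p : affineCurve f in 𝒰, ∃ i, w p.1.1 i = p.1.2 :=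
    .of_forall fun p ↦ hw.root_iff.1 p.2
  rw [Ultrafilter.eventually_exists_iff] at h1
  obtain ⟨i, hi⟩ := h1
  have h2 : Tendsto (fun p : affineCurve f ↦ (p : ℂ × ℂ)) 𝒰 (𝓝 (b, v i)) :=
    Tendsto.prodMk_nhds h𝒰 ((hv i).congr' hi)
  have h3 : (b, v i) ∈ affineCurve f :=
    affineCurve.isClosed.mem_of_tendsto h2 (.of_forall fun p ↦ p.2)
  exact ⟨⟨(b, v i), h3⟩, rfl, tendsto_subtype_rng.2 h2⟩

theorem affineCurve.isOpenMap_proj (hf : f.Monic) : IsOpenMap (affineCurve.proj f) := by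
  rw [isOpenMap_iff_nhds_le]
  rintro ⟨⟨b, t⟩, hp⟩ U hU
  rw [mem_iff_ultrafilter]
  intro 𝒰 h𝒰
  obtain ⟨w, hw⟩ := exists_isRootVector hf rfl
  obtain ⟨v, hv, hbv⟩ := hw.exists_tendsto hf (z := id) (b := b) h𝒰
  obtain ⟨i, rfl⟩ : ∃ i, v i = t := by
    have h1 : f.evalEval b t = 0 := hp
    rw [← map_evalRingHom_eval, hbv, eval_prod, Finset.prod_eq_zero_iff] at h1
    simpa [sub_eq_zero, eq_comm] using h1
  have h2 : Tendsto (fun z ↦ (⟨(z, w z i), hw.root_iff.2 ⟨i, rfl⟩⟩ : affineCurve f)) 𝒰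
      (𝓝 ⟨(b, v i), hp⟩) :=
    tendsto_subtype_rng.2 (Tendsto.prodMk_nhds h𝒰 (hv i))
  exact mem_of_superset (h2 (mem_map.1 hU)) fun z hz ↦ hz

theorem affineCurve.finite_fiber (hf : f.Monic) (z : ℂ) : (affineCurve.proj f ⁻¹' {z}).Finite := by
  have h := (Polynomial.rootSet_finite (f.map (evalRingHom z)) ℂ)
  refine Set.Finite.of_finite_image (f := fun p ↦ p.1.2) (h.subset ?_) ?_
  · rintro _ ⟨p, rfl, rfl⟩
    rw [mem_rootSet]
    refine ⟨(hf.map _).ne_zero, ?_⟩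
    rw [coe_aeval_eq_eval, map_evalRingHom_eval]
    exact p.2
  · rintro p rfl q hq h
    exact Subtype.ext (Prod.ext (Eq.symm hq) h)

theorem affineCurve.surjective_proj (hf : f.Monic) (hd : f.natDegree ≠ 0) :
    Function.Surjective (affineCurve.proj f) := by
  intro z
  obtain ⟨w, hw⟩ := IsAlgClosed.exists_root (f.map (evalRingHom z)) (by
    rw [degree_eq_natDegree (hf.map _).ne_zero, hf.natDegree_map]
    exact_mod_cast hd)
  rw [IsRoot, map_evalRingHom_eval] at hw
  exact ⟨⟨(z, w), hw⟩, rfl⟩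

theorem affineCurve.eventually_injective {b t : ℂ} (h : f.derivative.evalEval b t ≠ 0) :
    ∀ᶠ x in 𝓝 ((b, t), (b, t)), f.evalEval x.1.1 x.1.2 = 0 → f.evalEval x.2.1 x.2.2 = 0 →
      x.1.1 = x.2.1 → x.1 = x.2 := by
  have h1 := (f.contDiff_evalEval.contDiffAt (x := (b, t))).hasStrictFDerivAt one_ne_zero
  set L := fderiv ℂ (fun p : ℂ × ℂ ↦ f.evalEval p.1 p.2) (b, t)
  have hL : L (0, 1) = f.derivative.evalEval b t := by
    have h2 := h1.hasFDerivAt.comp_hasDerivAt t ((hasDerivAt_const t b).prodMk (hasDerivAt_id t))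
    exact h2.unique (f.hasDerivAt_evalEval_right b t)
  have h3 := h1.isLittleO.def (half_pos (norm_pos_iff.2 h))
  filter_upwards [h3] with x hx h4 h5 h6
  rw [h4, h5, sub_self, zero_sub, norm_neg] at hx
  have e : x.1 - x.2 = (x.1.2 - x.2.2) • ((0, 1) : ℂ × ℂ) := by
    ext <;> simp [h6]
  rw [e, map_smul, hL, norm_smul, norm_smul] at hx
  have : ‖((0, 1) : ℂ × ℂ)‖ = 1 := by simp
  rw [this] at hx
  have h7 : ‖x.1.2 - x.2.2‖ = 0 := by
    have := norm_pos_iff.2 h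
    nlinarith [norm_nonneg (x.1.2 - x.2.2)]
  exact Prod.ext h6 (sub_eq_zero.1 (norm_eq_zero.1 h7))

theorem affineCurve.isLocalHomeomorphOn_proj (hf : f.Monic) :
    IsLocalHomeomorphOn (affineCurve.proj f) {p | f.derivative.evalEval p.1.1 p.1.2 ≠ 0} := by
  rw [isLocalHomeomorphOn_iff_isOpenEmbedding_restrict]
  intro p hp
  have h1 := eventually_injective hp
  rw [nhds_prod_eq, eventually_prod_self_iff'] at h1
  obtain ⟨V, hV, hV'⟩ := h1
  obtain ⟨U, hUV, hUo, hpU⟩ :=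
    mem_nhds_iff.1 (continuous_subtype_val.continuousAt.preimage_mem_nhds hV)
  refine ⟨U, hUo.mem_nhds hpU, .of_continuous_injective_isOpenMap
    (continuous_proj.comp continuous_subtype_val) ?_
    ((isOpenMap_proj hf).comp hUo.isOpenMap_subtype_val)⟩
  intro x y hxy
  exact Subtype.ext (Subtype.ext (hV' _ (hUV x.2) _ (hUV y.2) x.1.2 y.1.2 hxy))

theorem affineCurve.isBranchedCover (hf : f.Monic) (hd : f.natDegree ≠ 0) :
    IsBranchedCover (affineCurve.proj f) {z | ¬ (f.map (evalRingHom z)).Separable} where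
  continuous := continuous_proj
  isClosedMap := (isProperMap_proj hf).isClosedMap
  isOpenMap := isOpenMap_proj hf
  surjective := surjective_proj hf hd
  finite_fiber := finite_fiber hf
  isCoveringMapOn := (isProperMap_proj hf).isClosedMap.isCoveringMapOn_of_isLocalHomeomorphOn
    (fun x _ ↦ finite_fiber hf x) ((isLocalHomeomorphOn_proj hf).mono fun p hp h ↦ by
      rw [mem_preimage, mem_compl_iff, mem_ofPred_eq, not_not] at hp
      have h1 : (f.map (evalRingHom p.1.1)).eval p.1.2 = 0 := by
        rw [map_evalRingHom_eval]; exact p.2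
      refine hp.eval₂_derivative_ne_zero (RingHom.id ℂ) (x := p.1.2) h1 ?_
      rw [derivative_map]
      exact (map_evalRingHom_eval _ _ _).trans h)

end

section

variable {f : ℂ[X][X]} {d : ℕ}

/-- The affine curve `f = 0` has no singular points. -/
def IsSmoothCurve (f : ℂ[X][X]) : Prop :=
  ∀ z w, f.evalEval z w = 0 → f.derivative.evalEval z w = 0 →
    (derivative (f.eval (C w))).eval z ≠ 0

theorem exists_eq_map_C_add (f : ℂ[X][X]) (b : ℂ) :
    ∃ G : ℂ[X][X], f = (f.map (evalRingHom b)).map C + C (X - C b) * G := by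
  have : C (X - C b) ∣ f - (f.map (evalRingHom b)).map C := by
    rw [C_dvd_iff_dvd_coeff]
    intro i
    simp only [coeff_sub, coeff_map, coe_evalRingHom]
    exact X_sub_C_dvd_sub_C_eval
  obtain ⟨G, hG⟩ := this
  exact ⟨G, by rw [← hG]; ring⟩

theorem exists_tendsto_norm_derivative {b v : ℂ} (hf : f.Monic) (hsm : IsSmoothCurve f)
    (hv : f.evalEval b v = 0) {l : Filter ℂ} (hl : l ≤ 𝓝[≠] b) {s : ℂ → ℂ}
    (hs : ∀ z, f.evalEval z (s z) = 0) (hsv : Tendsto s l (𝓝 v)) :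
    ∃ L > 0, Tendsto (fun z ↦ ‖f.derivative.evalEval z (s z)‖ /
      ‖z - b‖ ^ (1 - ((f.map (evalRingHom b)).rootMultiplicity v : ℝ)⁻¹)) l (𝓝 L) := by
  obtain ⟨G, hG⟩ := exists_eq_map_C_add f b
  set P := f.map (evalRingHom b) with hP
  have hP0 : P ≠ 0 := (hf.map _).ne_zero
  set e := P.rootMultiplicity v with he
  set h := P /ₘ (X - C v) ^ e with hh
  have hPh : (X - C v) ^ e * h = P := pow_mul_divByMonic_rootMultiplicity_eq P v
  have hhv : h.eval v ≠ 0 := eval_divByMonic_pow_rootMultiplicity_ne_zero v hP0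
  have he0 : 0 < e := by
    rw [he, rootMultiplicity_pos hP0, IsRoot, map_evalRingHom_eval, hv]
  have hzb : Tendsto (fun z ↦ z) l (𝓝 b) := hl.trans nhdsWithin_le_nhds
  have hne : ∀ᶠ z in l, z ≠ b := hl self_mem_nhdsWithin
  have hpair : Tendsto (fun z ↦ (z, s z)) l (𝓝 (b, v)) := hzb.prodMk_nhds hsv
  have hcont (q : ℂ[X][X]) : Tendsto (fun z ↦ q.evalEval z (s z)) l (𝓝 (q.evalEval b v)) :=
    (q.continuous_evalEval.tendsto (b, v)).comp hpair
  have hcont' (q : ℂ[X]) : Tendsto (fun z ↦ q.eval (s z)) l (𝓝 (q.eval v)) :=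
    (q.continuous.tendsto v).comp hsv
  have hev (z w : ℂ) : f.evalEval z w = (w - v) ^ e * h.eval w + (z - b) * G.evalEval z w := by
    conv_lhs => rw [hG, ← hPh]
    simp only [evalEval_add, evalEval_mul, evalEval_map_C, evalEval_C, eval_sub, eval_X, eval_C,
      eval_mul, eval_pow]
  by_cases h1 : f.derivative.evalEval b v = 0
  · have hder : f.derivative =
        ((X - C v) ^ e * h).derivative.map C + C (X - C b) * G.derivative := by
      rw [hPh, ← derivative_map]
      conv_lhs => rw [hG]
      simp
    have hGv : G.evalEval b v ≠ 0 := by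
      have h2 := hsm b v hv h1
      have h3 : f.eval (C v) = C (P.eval v) + (X - C b) * G.eval (C v) := by
        conv_lhs => rw [hG]
        simp
      rw [h3] at h2
      simpa [evalEval] using h2
    have hu (z : ℂ) : (s z - v) ^ e * h.eval (s z) = - ((z - b) * G.evalEval z (s z)) := by
      have := hev z (s z)
      rw [hs] at this
      linear_combination -this
    have hdz (z : ℂ) (hz : G.evalEval z (s z) ≠ 0) : f.derivative.evalEval z (s z) =
        (s z - v) ^ (e - 1) * (e * h.eval (s z) + (s z - v) * h.derivative.eval (s z) -
          (s z - v) * h.eval (s z) / G.evalEval z (s z) * G.derivative.evalEval z (s z)) := by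
      rw [hder]
      simp only [evalEval_add, evalEval_mul, evalEval_map_C, evalEval_C, eval_sub, eval_X, eval_C,
        derivative_mul, derivative_X_sub_C_pow, eval_add, eval_mul, eval_pow]
      obtain ⟨m, hm⟩ := Nat.exists_eq_succ_of_ne_zero he0.ne'
      have h4 := hu z
      rw [hm] at h4 ⊢
      simp only [Nat.succ_eq_add_one, Nat.add_sub_cancel, pow_succ] at h4 ⊢
      field_simp
      linear_combination (G.derivative.evalEval z (s z)) * h4
    have hlim : Tendsto (fun z ↦ ‖G.evalEval z (s z)‖ / ‖h.eval (s z)‖) l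
        (𝓝 (‖G.evalEval b v‖ / ‖h.eval v‖)) :=
      (hcont G).norm.div (hcont' h).norm (norm_ne_zero_iff.2 hhv)
    have hpos : 0 < ‖G.evalEval b v‖ / ‖h.eval v‖ :=
      div_pos (norm_pos_iff.2 hGv) (norm_pos_iff.2 hhv)
    have hlim2 := (hlim.rpow_const (p := 1 - (e : ℝ)⁻¹) (.inl hpos.ne')).mul
      ((((hcont' h).const_mul (e : ℂ)).add (((hsv.sub_const v).mul (hcont' h.derivative)))).sub
        ((((hsv.sub_const v).mul (hcont' h)).div (hcont G) hGv).mul (hcont G.derivative))).norm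
    refine ⟨_, ?_, hlim2.congr' ?_⟩
    · refine mul_pos (Real.rpow_pos_of_pos hpos _) ?_
      simp [hhv, he0]
    · filter_upwards [hne, (hcont G).eventually_ne hGv, (hcont' h).eventually_ne hhv]
        with z hz hGz hhz
      rw [hdz z hGz, norm_mul, mul_div_right_comm]
      congr 1
      have hz' : 0 < ‖z - b‖ := norm_pos_iff.2 (sub_ne_zero.2 hz)
      have h5 : ‖G.evalEval z (s z)‖ / ‖h.eval (s z)‖ = ‖s z - v‖ ^ e / ‖z - b‖ := by
        rw [div_eq_div_iff (norm_ne_zero_iff.2 hhz) hz'.ne', ← norm_pow, ← norm_mul, ← norm_mul,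
          hu, norm_neg, mul_comm]
      rw [h5, Real.div_rpow (by positivity) hz'.le]
      congr 1
      rw [← Real.rpow_natCast, ← Real.rpow_mul (norm_nonneg _), norm_pow, ← Real.rpow_natCast]
      congr 1
      have : (e : ℝ) ≠ 0 := by exact_mod_cast he0.ne'
      rw [Nat.cast_sub he0]
      field_simp
      simp
  · have he1 : e = 1 := by
      refine le_antisymm ?_ he0
      by_contra! hlt
      apply h1
      have h2 := (one_lt_rootMultiplicity_iff_isRoot hP0).1 hlt
      have h3 := h2.2
      rwa [IsRoot, hP, derivative_map, map_evalRingHom_eval] at h3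
    refine ⟨_, norm_pos_iff.2 h1, ?_⟩
    rw [he1]
    simpa using (hcont f.derivative).norm

theorem exists_discriminant (hf : f.Monic) : ∃ R : ℂ[X],
    ∀ w, IsRootVector f d w → ∀ z, R.eval z = ∏ i, f.derivative.evalEval z (w z i) := by
  refine ⟨f.resultant f.derivative f.natDegree f.derivative.natDegree, fun w hw z ↦ ?_⟩
  rw [← coe_evalRingHom, ← resultant_map_map]
  have hm := hf.map (evalRingHom z)
  have := resultant_eq_prod_eval (f.map (evalRingHom z)) (f.derivative.map (evalRingHom z))
    f.derivative.natDegree natDegree_map_le (IsAlgClosed.splits _)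
  rw [hf.natDegree_map] at this
  rw [this, hm.leadingCoeff, one_pow, one_mul, hw z]
  have hr : (∏ i, (X - C (w z i))).roots = Finset.univ.val.map (w z) := by
    rw [← roots_multiset_prod_X_sub_C (Finset.univ.val.map (w z)), Multiset.map_map]
    rfl
  rw [hr, Multiset.map_map]
  simp only [Function.comp_apply, map_evalRingHom_eval]
  rfl

theorem ultrafilter_exponent_unique {b : ℂ} {l : Filter ℂ} [l.NeBot] (hl : l ≤ 𝓝[≠] b)
    {u : ℂ → ℝ} {p q L L' : ℝ} (hL : 0 < L) (hL' : 0 < L')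
    (h : Tendsto (fun z ↦ u z / ‖z - b‖ ^ p) l (𝓝 L))
    (h' : Tendsto (fun z ↦ u z / ‖z - b‖ ^ q) l (𝓝 L')) : p = q := by
  wlog hpq : p < q generalizing p q L L'
  · rcases (not_lt.1 hpq).eq_or_lt with h1 | h1
    · exact h1.symm
    · exact (this hL' hL h' h h1).symm
  have hne : ∀ᶠ z in l, z ≠ b := hl self_mem_nhdsWithin
  have h0 : Tendsto (fun z ↦ ‖z - b‖) l (𝓝 0) := by
    have : Tendsto (fun z : ℂ ↦ ‖z - b‖) (𝓝 b) (𝓝 ‖b - b‖) :=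
      (by fun_prop : Continuous fun z : ℂ ↦ ‖z - b‖).tendsto b
    rw [sub_self, norm_zero] at this
    exact this.mono_left (hl.trans nhdsWithin_le_nhds)
  have h1 : Tendsto (fun z ↦ ‖z - b‖ ^ (q - p)) l (𝓝 0) := by
    have := h0.rpow_const (p := q - p) (.inr (sub_pos.2 hpq).le)
    rwa [Real.zero_rpow (sub_pos.2 hpq).ne'] at this
  have h2 := h'.mul h1
  rw [mul_zero] at h2
  refine absurd (tendsto_nhds_unique (h2.congr' ?_) h) hL.ne
  filter_upwards [hne] with z hz
  have hz' : 0 < ‖z - b‖ := norm_pos_iff.2 (sub_ne_zero.2 hz)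
  rw [Real.rpow_sub hz']
  have := (Real.rpow_pos_of_pos hz' q).ne'
  field_simp

theorem rootMultiplicity_discriminant (hf : f.Monic)
    (hsm : IsSmoothCurve f) {R : ℂ[X]} {w} (hw : IsRootVector f d w)
    (hR : ∀ z, R.eval z = ∏ i, f.derivative.evalEval z (w z i)) (b : ℂ) :
    R ≠ 0 ∧ R.rootMultiplicity b + Nat.card (affineCurve.proj f ⁻¹' {b}) = d := by
  classical
  let 𝒰 : Ultrafilter ℂ := .of (𝓝[≠] b)
  have hl : (𝒰 : Filter ℂ) ≤ 𝓝[≠] b := Ultrafilter.of_le _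
  obtain ⟨v, hv, hbv⟩ := hw.exists_tendsto hf (𝒰 := 𝒰) (z := id) (b := b)
    (hl.trans nhdsWithin_le_nhds)
  have hroot (t : ℂ) : f.evalEval b t = 0 ↔ ∃ i, v i = t := by
    rw [← map_evalRingHom_eval, hbv, eval_prod, Finset.prod_eq_zero_iff]
    simp [sub_eq_zero, eq_comm]
  have hbr : (f.map (evalRingHom b)).roots = Finset.univ.val.map v := by
    rw [← roots_multiset_prod_X_sub_C (Finset.univ.val.map v), Multiset.map_map, hbv]
    rfl
  have hmult (i : Fin d) : (f.map (evalRingHom b)).rootMultiplicity (v i) =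
      Finset.card {j | v j = v i} := by
    rw [← count_roots, hbr, Multiset.count_map]
    simp only [eq_comm (a := v i)]
    rfl
  choose L hL hLt using fun i ↦ exists_tendsto_norm_derivative hf hsm ((hroot (v i)).2 ⟨i, rfl⟩) hl
    (s := fun z ↦ w z i) (fun z ↦ hw.root_iff.2 ⟨i, rfl⟩) (hv i)
  have hne : ∀ᶠ z in 𝒰, z ≠ b := hl self_mem_nhdsWithin
  have hprod : Tendsto (fun z ↦ ‖R.eval z‖ /
      ‖z - b‖ ^ (∑ i, (1 - ((f.map (evalRingHom b)).rootMultiplicity (v i) : ℝ)⁻¹))) 𝒰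
      (𝓝 (∏ i, L i)) := by
    refine (tendsto_finsetProd Finset.univ fun i _ ↦ hLt i).congr' ?_
    filter_upwards [hne] with z hz
    have hz' : 0 < ‖z - b‖ := norm_pos_iff.2 (sub_ne_zero.2 hz)
    rw [Finset.prod_div_distrib, hR, norm_prod, Real.rpow_sum_of_pos hz']
  have hLpos : 0 < ∏ i, L i := Finset.prod_pos fun i _ ↦ hL i
  have hR0 : R ≠ 0 := by
    rintro rfl
    simp only [eval_zero, norm_zero, zero_div] at hprod
    exact hLpos.ne (tendsto_nhds_unique tendsto_const_nhds hprod)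
  refine ⟨hR0, ?_⟩
  have hU := eval_divByMonic_pow_rootMultiplicity_ne_zero b hR0
  have hRU := pow_mul_divByMonic_rootMultiplicity_eq R b
  set N := R.rootMultiplicity b
  set U := R /ₘ (X - C b) ^ N
  have hlimU : Tendsto (fun z ↦ ‖R.eval z‖ / ‖z - b‖ ^ (N : ℝ)) 𝒰 (𝓝 ‖U.eval b‖) := by
    refine (((U.continuous.tendsto b).mono_left (hl.trans nhdsWithin_le_nhds)).norm).congr' ?_
    filter_upwards [hne] with z hz
    have hz' : 0 < ‖z - b‖ := norm_pos_iff.2 (sub_ne_zero.2 hz)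
    conv_rhs => rw [← hRU]
    rw [eval_mul, norm_mul, eval_pow, norm_pow, Real.rpow_natCast]
    simp only [eval_sub, eval_X, eval_C]
    field_simp
  have key := ultrafilter_exponent_unique hl (norm_pos_iff.2 hU) hLpos hlimU hprod
  have hcard : Nat.card (affineCurve.proj f ⁻¹' {b}) = (Finset.univ.image v).card := by
    rw [← Fintype.card_coe, ← Nat.card_eq_fintype_card]
    have hmem (p : affineCurve.proj f ⁻¹' {b}) : p.1.1.2 ∈ Finset.univ.image v := by
      obtain ⟨⟨⟨z, t⟩, hp⟩, rfl⟩ := p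
      obtain ⟨i, hi⟩ := (hroot t).1 hp
      exact Finset.mem_image.2 ⟨i, Finset.mem_univ _, hi⟩
    refine Nat.card_eq_of_bijective (fun p ↦ ⟨p.1.1.2, hmem p⟩) ⟨?_, ?_⟩
    · rintro ⟨⟨⟨z, t⟩, hp⟩, hz⟩ ⟨⟨⟨z', t'⟩, hp'⟩, hz'⟩ h
      have h1 : z = b := hz
      have h2 : z' = b := hz'
      have h3 : t = t' := congrArg Subtype.val h
      subst h1 h2 h3
      rfl
    · rintro ⟨t, ht⟩
      obtain ⟨i, -, hi⟩ := Finset.mem_image.1 ht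
      exact ⟨⟨⟨(b, t), (hroot t).2 ⟨i, hi⟩⟩, rfl⟩, rfl⟩
  rw [hcard]
  have hsum : ∑ i, (((f.map (evalRingHom b)).rootMultiplicity (v i) : ℝ)⁻¹) =
      (Finset.univ.image v).card := by
    simp only [hmult]
    rw [Finset.sum_comp (fun t ↦ ((Finset.card {j | v j = t} : ℕ) : ℝ)⁻¹) v]
    rw [Finset.card_eq_sum_ones, Nat.cast_sum]
    refine Finset.sum_congr rfl fun t ht ↦ ?_
    obtain ⟨i, -, rfl⟩ := Finset.mem_image.1 ht
    have : (Finset.card {j | v j = v i} : ℝ) ≠ 0 := by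
      exact_mod_cast (Finset.card_pos.2 ⟨i, by simp⟩).ne'
    rw [nsmul_eq_mul, mul_inv_cancel₀ this, Nat.cast_one]
  rw [Finset.sum_sub_distrib, hsum] at key
  simp only [Finset.sum_const, Finset.card_univ, Fintype.card_fin, nsmul_eq_mul, mul_one] at key
  have : ((N + (Finset.univ.image v).card : ℕ) : ℝ) = d := by push_cast; linarith
  exact_mod_cast this

end

section

variable {f f' : ℂ[X][X]} {d : ℕ}

theorem Separable.evalEval_derivative_ne_zero {z t : ℂ}
    (h : (f.map (evalRingHom z)).Separable) (ht : f.evalEval z t = 0) :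
    f.derivative.evalEval z t ≠ 0 := by
  have h1 : (f.map (evalRingHom z)).eval t = 0 := by
    rw [map_evalRingHom_eval]; exact ht
  have h2 := h.eval₂_derivative_ne_zero (RingHom.id ℂ) (x := t) h1
  rw [derivative_map] at h2
  rwa [← map_evalRingHom_eval]

/-- `f` and `f'` define the same curve in the charts `(z, w)` and `(z⁻¹, z⁻¹ w)` of the projective
plane. -/
def IsReciprocal (d : ℕ) (f f' : ℂ[X][X]) : Prop :=
  ∀ z w, z ≠ 0 → f.evalEval z w = z ^ d * f'.evalEval z⁻¹ (z⁻¹ * w)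

theorem IsReciprocal.derivative (h : IsReciprocal d f f') {z : ℂ} (w : ℂ) (hz : z ≠ 0) :
    f.derivative.evalEval z w = z ^ d * (f'.derivative.evalEval z⁻¹ (z⁻¹ * w) * z⁻¹) := by
  refine (f.hasDerivAt_evalEval_right z w).unique ?_
  simp only [h z _ hz]
  refine HasDerivAt.const_mul _ ?_
  refine (f'.hasDerivAt_evalEval_right z⁻¹ (z⁻¹ * w)).comp w ?_
  simpa using (hasDerivAt_id w).const_mul z⁻¹

theorem IsReciprocal.isRootVector (h : IsReciprocal d f f')
    {w w'} (hw : IsRootVector f d w) (hw' : IsRootVector f' d w') :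
    IsRootVector f d fun z i ↦ if z = 0 then w 0 i else z * w' z⁻¹ i := by
  intro z
  by_cases hz : z = 0
  · simp only [hz, if_true]
    exact hw 0
  simp only [hz, if_false]
  refine Polynomial.funext fun t ↦ ?_
  rw [map_evalRingHom_eval, h z t hz, hw'.evalEval, eval_prod]
  simp only [eval_sub, eval_X, eval_C]
  have hzd : z ^ d = ∏ _i : Fin d, z := by simp
  rw [hzd, ← Finset.prod_mul_distrib]
  refine Finset.prod_congr rfl fun i _ ↦ ?_
  field_simp

theorem natDegree_of_reciprocal {R R' : ℂ[X]} {n : ℕ} (hR' : R'.eval 0 ≠ 0)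
    (h : ∀ z, z ≠ 0 → R.eval z = z ^ n * R'.eval z⁻¹) : R.natDegree = n := by
  have h1 : R * X ^ R'.natDegree = X ^ n * R'.reverse := by
    refine eq_of_infinite_eval_eq _ _ (Set.Infinite.mono (s := {0}ᶜ) (fun z hz ↦ ?_)
      (Set.finite_singleton _).infinite_compl)
    have hz : z ≠ 0 := hz
    let _ : Invertible z⁻¹ := invertibleOfNonzero (inv_ne_zero hz)
    have h2 := eval₂_reverse_mul_pow (RingHom.id ℂ) z⁻¹ R'
    rw [invOf_eq_inv, inv_inv] at h2
    simp only [eval₂_id] at h2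
    rw [mem_ofPred_eq, eval_mul, eval_mul, eval_pow, eval_pow, eval_X, h z hz, ← h2, inv_pow]
    field_simp
  have hR0 : R'.coeff 0 ≠ 0 := by rwa [coeff_zero_eq_eval_zero]
  have hR'0 : R' ≠ 0 := by rintro rfl; simp at hR0
  have hRne : R ≠ 0 := by
    rintro rfl
    rw [zero_mul, eq_comm, mul_eq_zero, reverse_eq_zero] at h1
    exact h1.elim (pow_ne_zero _ X_ne_zero) hR'0
  have h2 := congrArg natDegree h1
  rw [natDegree_mul hRne (pow_ne_zero _ X_ne_zero),
    natDegree_mul (pow_ne_zero _ X_ne_zero) (by rwa [Ne, reverse_eq_zero]), natDegree_X_pow,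
    natDegree_X_pow, reverse_natDegree, natTrailingDegree_eq_zero.2 (.inr hR0)] at h2
  omega

theorem sum_card_fiber (hf : f.Monic) (hd : f.natDegree = d) (hsm : IsSmoothCurve f)
    (hf' : f'.Monic) (hd' : f'.natDegree = d) (h : IsReciprocal d f f') (hd0 : d ≠ 0)
    (hsep : (f'.map (evalRingHom 0)).Separable) {N : ℕ} {c : Fin N → ℂ}
    (hc : Function.Injective c) (hB : {z | ¬ (f.map (evalRingHom z)).Separable} ⊆ range c) :
    ∑ j, Nat.card (affineCurve.proj f ⁻¹' {c j}) + d * (d - 1) = N * d := by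
  classical
  obtain ⟨R, hR⟩ := exists_discriminant hf
  obtain ⟨R', hR'⟩ := exists_discriminant hf'
  obtain ⟨w, hw⟩ := exists_isRootVector hf hd
  obtain ⟨w', hw'⟩ := exists_isRootVector hf' hd'
  have hR'0 : R'.eval 0 ≠ 0 := by
    rw [hR' w' hw', Finset.prod_ne_zero_iff]
    exact fun i _ ↦ hsep.evalEval_derivative_ne_zero (hw'.root_iff.2 ⟨i, rfl⟩)
  have hdeg : R.natDegree = d * (d - 1) := by
    refine natDegree_of_reciprocal hR'0 fun z hz ↦ ?_
    rw [hR _ (h.isRootVector hw hw'), hR' w' hw']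
    simp only [hz, if_false, h.derivative _ hz, inv_mul_cancel_left₀ hz]
    rw [Finset.prod_mul_distrib, Finset.prod_mul_distrib, Finset.prod_const, Finset.prod_const,
      Finset.card_univ, Fintype.card_fin, mul_comm d (d - 1), pow_mul]
    have hzd : z ^ d = z ^ (d - 1) * z := by
      rw [← pow_succ, Nat.sub_add_cancel (Nat.one_le_iff_ne_zero.2 hd0)]
    rw [hzd, mul_pow, inv_pow]
    field_simp
  have key := rootMultiplicity_discriminant hf hsm hw (hR w hw)
  have hroots : R.roots.toFinset ⊆ Finset.univ.image c := by
    intro b hb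
    rw [Multiset.mem_toFinset, mem_roots', IsRoot, hR w hw, Finset.prod_eq_zero_iff] at hb
    obtain ⟨i, -, hi⟩ := hb.2
    obtain ⟨j, rfl⟩ := hB fun hs : (f.map (evalRingHom b)).Separable ↦
      hs.evalEval_derivative_ne_zero (hw.root_iff.2 ⟨i, rfl⟩) hi
    exact Finset.mem_image_of_mem _ (Finset.mem_univ _)
  have hsum : ∑ j, R.rootMultiplicity (c j) = d * (d - 1) := by
    rw [← hdeg, (IsAlgClosed.splits R).natDegree_eq_card_roots,
      ← Multiset.sum_count_eq_card (s := Finset.univ.image c)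
        (fun a ha ↦ hroots (Multiset.mem_toFinset.2 ha)),
      Finset.sum_image fun i _ j _ hij ↦ hc hij]
    simp only [count_roots]
  rw [← hsum, ← Finset.sum_add_distrib]
  simp only [add_comm (Nat.card _), (key _).2]
  simp

end

section

theorem _root_.Set.Finite.eventually_notMem_nhdsNE {J : Set ℂ} (hJ : J.Finite) (b : ℂ) :
    ∀ᶠ z in 𝓝[≠] b, z ∉ J := by
  have h1 : (J \ {b})ᶜ ∈ 𝓝 b := (hJ.sdiff).isClosed.isOpen_compl.mem_nhds (by simp)
  filter_upwards [mem_nhdsWithin_of_mem_nhds h1, self_mem_nhdsWithin] with z h2 h3 h4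
  exact h2 ⟨h4, h3⟩

/-- Riemann's removable singularity theorem for a finite set of singularities. -/
theorem exists_differentiable_eqOn {J : Set ℂ} (hJ : J.Finite) {φ : ℂ → ℂ}
    (hφ : ∀ z ∉ J, DifferentiableAt ℂ φ z) {M : ℂ → ℝ} (hM : Continuous M)
    (hφM : ∀ z, ‖φ z‖ ≤ M z) : ∃ ψ : ℂ → ℂ, Differentiable ℂ ψ ∧ ∀ z ∉ J, ψ z = φ z := by
  classical
  set ψ : ℂ → ℂ := fun z ↦ if z ∈ J then limUnder (𝓝[≠] z) φ else φ z with hψ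
  have hψφ (z) (hz : z ∉ J) : ψ z = φ z := if_neg hz
  have hdiff (z) (hz : z ∉ J) : DifferentiableAt ℂ ψ z := by
    refine (hφ z hz).congr_of_eventuallyEq ?_
    filter_upwards [hJ.isClosed.isOpen_compl.mem_nhds hz] with y hy
    exact hψφ y hy
  refine ⟨ψ, fun b ↦ ?_, hψφ⟩
  by_cases hb : b ∈ J
  · refine (Complex.analyticAt_of_differentiable_on_punctured_nhds_of_continuousAt
      ((hJ.eventually_notMem_nhdsNE b).mono hdiff) ?_).differentiableAt
    rw [continuousAt_iff_punctured_nhds]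
    have h1 := Complex.tendsto_limUnder_of_differentiable_on_punctured_nhds_of_bounded_under
      (f := φ) (c := b) ((hJ.eventually_notMem_nhdsNE b).mono hφ) (by
        refine isBoundedUnder_of_eventually_le (a := M b + 1 + ‖φ b‖) ?_
        filter_upwards [mem_nhdsWithin_of_mem_nhds
          (hM.continuousAt.eventually (gt_mem_nhds (lt_add_one (M b))))] with z hz
        have := hφM z
        exact (norm_sub_le _ _).trans (by linarith))
    have h2 : ψ b = limUnder (𝓝[≠] b) φ := if_pos hb
    rw [h2]
    refine h1.congr' ?_
    filter_upwards [hJ.eventually_notMem_nhdsNE b] with z hz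
    exact (hψφ z hz).symm
  · exact hdiff b hb

variable {f : ℂ[X][X]} {d : ℕ}

theorem exists_differentiableAt_section {b t : ℂ} (ht : f.evalEval b t = 0)
    (hder : f.derivative.evalEval b t ≠ 0) :
    ∃ s : ℂ → ℂ, DifferentiableAt ℂ s b ∧ s b = t ∧ ∀ᶠ z in 𝓝 b, f.evalEval z (s z) = 0 := by
  have h1 := (f.contDiff_evalEval.contDiffAt (x := (b, t))).hasStrictFDerivAt one_ne_zero
  have hL : fderiv ℂ (fun p : ℂ × ℂ ↦ f.evalEval p.1 p.2) (b, t) (0, 1) =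
      f.derivative.evalEval b t := by
    have h2 := h1.hasFDerivAt.comp_hasDerivAt t ((hasDerivAt_const t b).prodMk (hasDerivAt_id t))
    exact h2.unique (f.hasDerivAt_evalEval_right b t)
  have hinv : (fderiv ℂ (fun p : ℂ × ℂ ↦ f.evalEval p.1 p.2) (b, t) ∘L
      .inr ℂ ℂ ℂ).IsInvertible := by
    refine ⟨ContinuousLinearEquiv.unitsEquivAut ℂ (Units.mk0 _ hder), ?_⟩
    ext
    simp [← hL]
  refine ⟨h1.implicitFunctionOfProdDomain hinv,
    (h1.hasStrictFDerivAt_implicitFunctionOfProdDomain hinv).hasFDerivAt.differentiableAt, ?_, ?_⟩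
  · exact (h1.eventually_apply_eq_iff_implicitFunctionOfProdDomain hinv).self_of_nhds.mp rfl
  · filter_upwards [h1.eventually_apply_implicitFunctionOfProdDomain hinv] with z hz
    exact hz.trans ht

/-- Near a point over which `f` is separable, the roots of `f` depend differentiably on the base
point, and a locally constant function on the curve is constant along them. -/
theorem IsRootVector.exists_sections {w} (hw : IsRootVector f d w) {b : ℂ}
    (hb : (f.map (evalRingHom b)).Separable) {J : Set ℂ} (hbJ : Jᶜ ∈ 𝓝 b)
    {ρ : affineCurve f → Bool} (hρ : ContinuousOn ρ (affineCurve.proj f ⁻¹' Jᶜ)) :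
    ∃ s : Fin d → ℂ → ℂ, (∀ i, DifferentiableAt ℂ (s i) b) ∧ (∀ i, s i b = w b i) ∧
      ∀ᶠ z in 𝓝 b, ∃ σ : Equiv.Perm (Fin d), ∀ i, w z (σ i) = s i z ∧
        ρ ⟨(z, w z (σ i)), hw.root_iff.2 ⟨_, rfl⟩⟩ = ρ ⟨(b, w b i), hw.root_iff.2 ⟨_, rfl⟩⟩ := by
  have hroot (z) (i) : f.evalEval z (w z i) = 0 := hw.root_iff.2 ⟨_, rfl⟩
  choose s hs hsb hsev using fun i ↦ exists_differentiableAt_section (hroot b i)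
    (hb.evalEval_derivative_ne_zero (hroot b i))
  have hinj : Function.Injective (w b) := by
    have h1 := hb
    rw [hw b, separable_prod_X_sub_C_iff] at h1
    exact h1
  refine ⟨s, hs, hsb, ?_⟩
  have h1 : ∀ᶠ z in 𝓝 b, ∀ i j, i ≠ j → s i z ≠ s j z := by
    rw [eventually_all]; intro i
    rw [eventually_all]; intro j
    by_cases hij : i = j
    · simp [hij]
    · filter_upwards [((hs i).continuousAt.sub (hs j).continuousAt).eventually_ne
        (y := 0) (by
          change s i b - s j b ≠ 0
          rw [hsb, hsb]
          exact sub_ne_zero.2 (hinj.ne hij))] with z hz _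
      exact sub_ne_zero.1 hz
  have hmem (z) (i) : (z, w z i) ∈ affineCurve f := hroot z i
  have h2 : ∀ᶠ z in 𝓝 b, ∀ i, ∀ h : (z, s i z) ∈ affineCurve f,
      ρ ⟨(z, s i z), h⟩ = ρ ⟨(b, w b i), hmem b i⟩ := by
    rw [eventually_all]; intro i
    have hbi : b ∈ Jᶜ := mem_of_mem_nhds hbJ
    have h3 : ContinuousAt ρ ⟨(b, w b i), hmem b i⟩ :=
      hρ.continuousAt (affineCurve.continuous_proj.continuousAt.preimage_mem_nhds hbJ)
    have h4 : ∀ᶠ p in 𝓝 (⟨(b, w b i), hmem b i⟩ : affineCurve f),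
        ρ p = ρ ⟨(b, w b i), hmem b i⟩ := h3.eventually (isOpen_discrete {_} |>.mem_nhds rfl)
    rw [nhds_subtype_eq_comap, eventually_comap] at h4
    have h5 : Tendsto (fun z ↦ (z, s i z)) (𝓝 b) (𝓝 (b, w b i)) := by
      rw [← hsb i]
      exact tendsto_id.prodMk_nhds (hs i).continuousAt
    filter_upwards [h5.eventually h4] with z hz h
    exact hz ⟨(z, s i z), h⟩ rfl
  filter_upwards [h1, h2, eventually_all.2 hsev] with z hz1 hz2 hz3
  choose τ hτ using fun i ↦ hw.root_iff.1 (hz3 i)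
  have hτi : Function.Injective τ := by
    intro i j hij
    by_contra hne
    exact hz1 i j hne (by rw [← hτ, ← hτ, hij])
  refine ⟨Equiv.ofBijective τ (Finite.injective_iff_bijective.1 hτi), fun i ↦ ⟨hτ i, ?_⟩⟩
  rw [← hz2 i (hz3 i)]
  congr 3
  exact hτ i

end

section

variable {f f' : ℂ[X][X]} {d : ℕ}

theorem IsRootVector.mem_affineCurve {w} (hw : IsRootVector f d w) (z : ℂ) (i : Fin d) :
    (z, w z i) ∈ affineCurve f := hw.root_iff.2 ⟨i, rfl⟩

/-- A labelling of the curve, read off at the points listed by a root vector. -/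
def IsRootVector.label {w} (hw : IsRootVector f d w) (ρ : affineCurve f → Bool) (z : ℂ)
    (i : Fin d) : Bool :=
  ρ ⟨(z, w z i), hw.mem_affineCurve z i⟩

/-- The product of `x - w i` over the indices `i` with label `β`. -/
def partialProd (β : Bool) (x : ℂ) (w : Fin d → ℂ) (r : Fin d → Bool) : ℂ :=
  ∏ i, if r i = β then x - w i else 1

/-- The resultant of the two monic polynomials whose roots are the `w i` with label `true`,
respectively `false`. -/
def labelResultant (w : Fin d → ℂ) (r : Fin d → Bool) : ℂ :=
  ∏ i, ∏ j, if r i = true ∧ r j = false then w i - w j else 1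

theorem partialProd_comp_perm (β : Bool) (x : ℂ) (σ : Equiv.Perm (Fin d)) (w : Fin d → ℂ)
    (r : Fin d → Bool) : partialProd β x (w ∘ σ) (r ∘ σ) = partialProd β x w r :=
  Equiv.prod_comp σ fun i ↦ if r i = β then x - w i else 1

theorem labelResultant_comp_perm (σ : Equiv.Perm (Fin d)) (w : Fin d → ℂ) (r : Fin d → Bool) :
    labelResultant (w ∘ σ) (r ∘ σ) = labelResultant w r := by
  unfold labelResultant
  exact (Finset.prod_congr rfl fun i _ ↦ Equiv.prod_comp σ fun j ↦
    if r (σ i) = true ∧ r j = false then w (σ i) - w j else 1).trans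
    (Equiv.prod_comp σ fun i ↦ ∏ j, if r i = true ∧ r j = false then w i - w j else 1)

theorem differentiable_partialProd (β : Bool) (x : ℂ) (r : Fin d → Bool) :
    Differentiable ℂ fun w ↦ partialProd β x w r := by
  unfold partialProd
  refine (contDiff_prod (n := 1) fun i _ ↦ ?_).differentiable one_ne_zero
  split_ifs <;> fun_prop

theorem differentiable_labelResultant (r : Fin d → Bool) :
    Differentiable ℂ fun w ↦ labelResultant w r := by
  unfold labelResultant
  refine (contDiff_prod (n := 1) fun i _ ↦ contDiff_prod fun j _ ↦ ?_).differentiable one_ne_zero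
  split_ifs <;> fun_prop

theorem norm_partialProd_le (β : Bool) (x : ℂ) {w : Fin d → ℂ} (r : Fin d → Bool) {M : ℝ}
    (hM : ∀ i, ‖w i‖ ≤ M) : ‖partialProd β x w r‖ ≤ (1 + ‖x‖ + |M|) ^ d := by
  unfold partialProd
  rw [norm_prod]
  refine (Finset.prod_le_prod (fun _ _ ↦ norm_nonneg _) fun i _ ↦ ?_).trans_eq
    (by simp : ∏ _i : Fin d, (1 + ‖x‖ + |M|) = (1 + ‖x‖ + |M|) ^ d)
  split_ifs
  · exact (norm_sub_le _ _).trans (by linarith [hM i, le_abs_self M])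
  · rw [norm_one]
    linarith [norm_nonneg x, abs_nonneg M]

theorem norm_labelResultant_le {w : Fin d → ℂ} (r : Fin d → Bool) {M : ℝ}
    (hM : ∀ i, ‖w i‖ ≤ M) : ‖labelResultant w r‖ ≤ ((1 + 2 * |M|) ^ d) ^ d := by
  unfold labelResultant
  rw [norm_prod]
  refine (Finset.prod_le_prod (fun _ _ ↦ norm_nonneg _) fun i _ ↦ ?_).trans_eq
    (by simp : ∏ _i : Fin d, ((1 + 2 * |M|) ^ d) = ((1 + 2 * |M|) ^ d) ^ d)
  rw [norm_prod]
  refine (Finset.prod_le_prod (fun _ _ ↦ norm_nonneg _) fun j _ ↦ ?_).trans_eq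
    (by simp : ∏ _j : Fin d, (1 + 2 * |M|) = (1 + 2 * |M|) ^ d)
  split_ifs
  · exact (norm_sub_le _ _).trans (by linarith [hM i, hM j, le_abs_self M])
  · rw [norm_one]
    linarith [abs_nonneg M]

theorem partialProd_mul_partialProd (x : ℂ) (w : Fin d → ℂ) (r : Fin d → Bool) :
    partialProd true x w r * partialProd false x w r = ∏ i, (x - w i) := by
  unfold partialProd
  rw [← Finset.prod_mul_distrib]
  refine Finset.prod_congr rfl fun i _ ↦ ?_
  cases r i <;> simp

theorem IsRootVector.differentiableAt_symmetric {w} (hw : IsRootVector f d w) {b : ℂ}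
    (hb : (f.map (evalRingHom b)).Separable) {J : Set ℂ} (hbJ : Jᶜ ∈ 𝓝 b)
    {ρ : affineCurve f → Bool} (hρ : ContinuousOn ρ (affineCurve.proj f ⁻¹' Jᶜ))
    {Ψ : (Fin d → ℂ) → (Fin d → Bool) → ℂ}
    (hsym : ∀ (σ : Equiv.Perm (Fin d)) w r, Ψ (w ∘ σ) (r ∘ σ) = Ψ w r)
    (hΨ : ∀ r, Differentiable ℂ fun w ↦ Ψ w r) :
    DifferentiableAt ℂ (fun z ↦ Ψ (w z) (hw.label ρ z)) b := by
  obtain ⟨s, hs, hsb, hev⟩ := hw.exists_sections hb hbJ hρ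
  have h1 : DifferentiableAt ℂ (fun z ↦ Ψ (fun i ↦ s i z) (hw.label ρ b)) b :=
    (hΨ _ _).comp b (differentiableAt_pi.2 hs)
  refine h1.congr_of_eventuallyEq ?_
  filter_upwards [hev] with z ⟨σ, hσ⟩
  rw [← hsym σ]
  congr 1
  · exact _root_.funext fun i ↦ (hσ i).1
  · exact _root_.funext fun i ↦ (hσ i).2

theorem IsRootVector.exists_label_eq {w} (hw : IsRootVector f d w) {J : Set ℂ} (hJ : J.Finite)
    (hB : {z | ¬ (f.map (evalRingHom z)).Separable} ⊆ J)
    {ρ : affineCurve f → Bool} (hρ : ContinuousOn ρ (affineCurve.proj f ⁻¹' Jᶜ))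
    {x : affineCurve f} (hx : affineCurve.proj f x ∉ J) {z : ℂ} (hz : z ∉ J) :
    ∃ i, hw.label ρ z i = ρ x := by
  classical
  have hJc : IsPreconnected Jᶜ :=
    (hJ.countable.isConnected_compl_of_one_lt_rank (by simp)).isPreconnected
  have h1 : ContinuousOn (fun z ↦ decide (∃ i, hw.label ρ z i = ρ x)) Jᶜ := by
    intro b hb
    refine ContinuousAt.continuousWithinAt ?_
    obtain ⟨s, hs, hsb, hev⟩ := hw.exists_sections (not_not.1 fun h ↦ hb (hB h))
      (hJ.isClosed.isOpen_compl.mem_nhds hb) hρ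
    refine continuousAt_const.congr (f := fun _ ↦ decide (∃ i, hw.label ρ b i = ρ x)) ?_
    filter_upwards [hev] with z ⟨σ, hσ⟩
    rw [decide_eq_decide]
    refine (exists_congr fun i ↦ ?_).trans
      (σ.exists_congr_right (q := fun i ↦ hw.label ρ z i = ρ x))
    rw [label, label, (hσ i).2]
  have h2 := hJc.constant h1 hx hz
  rw [decide_eq_decide] at h2
  refine h2.1 ?_
  obtain ⟨⟨z, t⟩, ht⟩ := x
  obtain ⟨i, hi⟩ := hw.root_iff.1 ht
  change w z i = t at hi
  subst hi
  exact ⟨i, rfl⟩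

end

section

variable {f f' : ℂ[X][X]} {d : ℕ}

theorem _root_.Ultrafilter.exists_eventually_eq {α β : Type*} [Finite β] (𝒰 : Ultrafilter α)
    (g : α → β) : ∃ r, ∀ᶠ a in 𝒰, g a = r := by
  exact Ultrafilter.eventually_exists_iff.1 (.of_forall fun a ↦ ⟨g a, rfl⟩)

theorem IsRootVector.exists_extension {w} (hw : IsRootVector f d w) (hf : f.Monic) {J : Set ℂ}
    (hJ : J.Finite) (hB : {z | ¬ (f.map (evalRingHom z)).Separable} ⊆ J)
    {ρ : affineCurve f → Bool} (hρ : ContinuousOn ρ (affineCurve.proj f ⁻¹' Jᶜ))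
    {Ψ : (Fin d → ℂ) → (Fin d → Bool) → ℂ}
    (hsym : ∀ (σ : Equiv.Perm (Fin d)) w r, Ψ (w ∘ σ) (r ∘ σ) = Ψ w r)
    (hΨ : ∀ r, Differentiable ℂ fun w ↦ Ψ w r) {N : ℝ → ℝ} (hN : Continuous N)
    (hΨN : ∀ w r M, (∀ i, ‖w i‖ ≤ M) → ‖Ψ w r‖ ≤ N M) :
    ∃ ψ : ℂ → ℂ, Differentiable ℂ ψ ∧ ∀ z ∉ J, ψ z = Ψ (w z) (hw.label ρ z) := by
  obtain ⟨M, hM, hfM⟩ := exists_root_bound hf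
  refine exists_differentiable_eqOn hJ (fun z hz ↦ ?_) (hN.comp hM) fun z ↦
    hΨN _ _ _ fun i ↦ hfM z _ (hw.root_iff.2 ⟨i, rfl⟩)
  exact hw.differentiableAt_symmetric (by_contra fun h ↦ hz (hB h))
    (hJ.isClosed.isOpen_compl.mem_nhds hz) hρ hsym hΨ

theorem IsRootVector.exists_limit {w} (hw : IsRootVector f d w) (hf : f.Monic) {J : Set ℂ}
    (hJ : J.Finite) (ρ : affineCurve f → Bool) (b : ℂ) :
    ∃ v r, f.map (evalRingHom b) = ∏ i, (X - C (v i)) ∧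
      ∀ (Ψ : (Fin d → ℂ) → (Fin d → Bool) → ℂ), (∀ r, Differentiable ℂ fun w ↦ Ψ w r) →
        ∀ ψ : ℂ → ℂ, Differentiable ℂ ψ → (∀ z ∉ J, ψ z = Ψ (w z) (hw.label ρ z)) →
          ψ b = Ψ v r := by
  let 𝒰 : Ultrafilter ℂ := .of (𝓝[≠] b)
  have h𝒰 : (𝒰 : Filter ℂ) ≤ 𝓝[≠] b := Ultrafilter.of_le _
  have hb : (𝒰 : Filter ℂ) ≤ 𝓝 b := h𝒰.trans nhdsWithin_le_nhds
  obtain ⟨v, hv, hfv⟩ := hw.exists_tendsto hf (𝒰 := 𝒰) (z := id) hb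
  obtain ⟨r, hr⟩ := 𝒰.exists_eventually_eq fun z ↦ hw.label ρ z
  refine ⟨v, r, hfv, fun Ψ hΨ ψ hψ heq ↦ ?_⟩
  refine tendsto_nhds_unique (f := ψ) (l := 𝒰) (hψ.continuous.continuousAt.mono_left hb) ?_
  have h1 : Tendsto (fun z ↦ Ψ (w z) r) 𝒰 (𝓝 (Ψ v r)) :=
    ((hΨ r).continuous.tendsto v).comp (tendsto_pi_nhds.2 hv)
  refine h1.congr' ?_
  filter_upwards [hr, h𝒰 (hJ.eventually_notMem_nhdsNE b)] with z h2 h3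
  rw [heq z h3, ← h2]

theorem labelResultant_eq_zero_iff {w : Fin d → ℂ} {r : Fin d → Bool} :
    labelResultant w r = 0 ↔ ∃ i j, r i = true ∧ r j = false ∧ w i = w j := by
  simp only [labelResultant, Finset.prod_eq_zero_iff, Finset.mem_univ, true_and]
  refine exists_congr fun i ↦ exists_congr fun j ↦ ?_
  split_ifs with h
  · simp [h, sub_eq_zero]
  · simp only [one_ne_zero, false_iff]
    tauto

theorem partialProd_eq_zero {β : Bool} {x : ℂ} {w : Fin d → ℂ} {r : Fin d → Bool} {i : Fin d}
    (hi : r i = β) (hx : w i = x) : partialProd β x w r = 0 :=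
  Finset.prod_eq_zero (Finset.mem_univ i) (by simp [hi, hx])

/-- Over a smooth curve, the resultant of two complementary families of branches never vanishes. -/
theorem IsRootVector.extension_labelResultant_ne_zero {w} (hw : IsRootVector f d w) (hf : f.Monic)
    (hsm : IsSmoothCurve f) {J : Set ℂ}
    (hJ : J.Finite) (hB : {z | ¬ (f.map (evalRingHom z)).Separable} ⊆ J)
    {ρ : affineCurve f → Bool} (hρ : ContinuousOn ρ (affineCurve.proj f ⁻¹' Jᶜ)) {P : ℂ → ℂ}
    (hP : Differentiable ℂ P) (hPJ : ∀ z ∉ J, P z = labelResultant (w z) (hw.label ρ z)) (b : ℂ) :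
    P b ≠ 0 := by
  intro h0
  obtain ⟨v, r, hfv, hlim⟩ := hw.exists_limit hf hJ ρ b
  have h1 := hlim labelResultant differentiable_labelResultant P hP hPJ
  obtain ⟨i, j, hi, hj, hij⟩ := labelResultant_eq_zero_iff.1 (h1.symm.trans h0)
  have hext (β : Bool) := hw.exists_extension hf hJ hB hρ
    (partialProd_comp_perm β (v i)) (differentiable_partialProd β (v i))
    (N := fun M ↦ (1 + ‖v i‖ + |M|) ^ d) (by fun_prop)
    (fun w r M hM ↦ norm_partialProd_le β (v i) r hM)
  choose ψ hψ hψJ using hext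
  have hψb (β : Bool) := hlim _ (differentiable_partialProd β (v i)) (ψ β) (hψ β) (hψJ β)
  have ht : ψ true b = 0 := (hψb true).trans (partialProd_eq_zero hi rfl)
  have hf0 : ψ false b = 0 := (hψb false).trans (partialProd_eq_zero hj hij.symm)
  have hdense : Dense Jᶜ := hJ.countable.dense_compl ℝ
  have heq : (fun z ↦ (f.eval (C (v i))).eval z) = fun z ↦ ψ true z * ψ false z := by
    refine Continuous.ext_on hdense (Polynomial.continuous _)
      ((hψ true).continuous.mul (hψ false).continuous) fun z hz ↦ ?_
    rw [hψJ true z hz, hψJ false z hz, partialProd_mul_partialProd, ← hw.evalEval]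
  have hder : (derivative (f.eval (C (v i)))).eval b = 0 := by
    refine ((f.eval (C (v i))).hasDerivAt b).unique ?_
    rw [heq]
    have := ((hψ true).differentiableAt (x := b)).hasDerivAt.mul
      ((hψ false).differentiableAt (x := b)).hasDerivAt
    rwa [ht, hf0, mul_zero, zero_mul, add_zero] at this
  have hne : i ≠ j := fun h ↦ by simp [h, hj] at hi
  have hdvd : (X - C (v i)) ^ 2 ∣ f.map (evalRingHom b) := by
    rw [hfv, ← Finset.mul_prod_erase _ _ (Finset.mem_univ i), sq]
    refine mul_dvd_mul_left _ ?_
    rw [hij]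
    exact Finset.dvd_prod_of_mem (fun i ↦ X - C (v i)) (by simp [hne.symm])
  obtain ⟨q, hq⟩ := hdvd
  refine hsm b (v i) ?_ ?_ hder
  · rw [← map_evalRingHom_eval, hq]
    simp
  · rw [← map_evalRingHom_eval, ← derivative_map, hq]
    simp [derivative_pow]

theorem labelResultant_mul (z : ℂ) (w : Fin d → ℂ) (r : Fin d → Bool) :
    labelResultant (fun i ↦ z * w i) r =
      z ^ (∑ i, ∑ j, if r i = true ∧ r j = false then 1 else 0) * labelResultant w r := by
  simp only [labelResultant, ← Finset.prod_pow_eq_pow_sum, ← Finset.prod_mul_distrib]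
  refine Finset.prod_congr rfl fun i _ ↦ Finset.prod_congr rfl fun j _ ↦ ?_
  split_ifs
  · ring
  · simp

/-- A smooth plane curve, unramified over infinity, stays connected after removing finitely many
fibers containing all ramified ones. -/
theorem isPreconnected_preimage (hf : f.Monic) (hd : f.natDegree = d) (hsm : IsSmoothCurve f)
    (hf' : f'.Monic) (hd' : f'.natDegree = d) (h : IsReciprocal d f f')
    (hsep : (f'.map (evalRingHom 0)).Separable) {J : Set ℂ} (hJ : J.Finite)
    (hB : {z | ¬ (f.map (evalRingHom z)).Separable} ⊆ J) :
    IsPreconnected (affineCurve.proj f ⁻¹' Jᶜ) := by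
  classical
  refine isPreconnected_of_forall_constant fun ρ hρ x hx y hy ↦ ?_
  by_contra hxy
  wlog hxt : ρ x = true generalizing x y
  · exact this y hy x hx (Ne.symm hxy) (by
      cases h1 : ρ x <;> cases h2 : ρ y <;> simp_all)
  have hyf : ρ y = false := by cases h2 : ρ y <;> simp_all
  obtain ⟨w₀, hw₀⟩ := exists_isRootVector hf hd
  obtain ⟨w', hw'⟩ := exists_isRootVector hf' hd'
  have hw := h.isRootVector hw₀ hw'
  obtain ⟨P, hP, hPJ⟩ := hw.exists_extension hf hJ hB hρ labelResultant_comp_perm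
    differentiable_labelResultant (N := fun M ↦ ((1 + 2 * |M|) ^ d) ^ d) (by fun_prop)
    (fun w r M hM ↦ norm_labelResultant_le r hM)
  have hP0 := hw.extension_labelResultant_ne_zero hf hsm hJ hB hρ hP hPJ
  have hlim : Tendsto (fun z ↦ (P z)⁻¹) (cocompact ℂ) (𝓝 0) := by
    refine tendsto_iff_ultrafilter _ _ _ |>.2 fun 𝒰 h𝒰 ↦ ?_
    have hcob : Tendsto id (𝒰 : Filter ℂ) (Bornology.cobounded ℂ) := by
      rwa [Metric.cobounded_eq_cocompact]
    have hinv : Tendsto (fun z : ℂ ↦ z⁻¹) 𝒰 (𝓝 0) := tendsto_inv₀_cobounded.comp hcob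
    obtain ⟨v, hv, hfv⟩ := hw'.exists_tendsto hf' (𝒰 := 𝒰) hinv
    obtain ⟨r, hr⟩ := 𝒰.exists_eventually_eq fun z ↦ hw.label ρ z
    have hne : ∀ᶠ z in (𝒰 : Filter ℂ), z ∉ J ∧ z ≠ 0 := by
      have := (hJ.insert 0).isCompact.compl_mem_cocompact
      filter_upwards [h𝒰 this] with z hz
      simp only [mem_compl_iff, mem_insert_iff, not_or] at hz
      exact ⟨hz.2, hz.1⟩
    obtain ⟨z₀, ⟨hz₀J, -⟩, hz₀r⟩ := (hne.and hr).exists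
    obtain ⟨i, hi⟩ := hw.exists_label_eq hJ hB hρ hx hz₀J
    obtain ⟨j, hj⟩ := hw.exists_label_eq hJ hB hρ hy hz₀J
    rw [hz₀r] at hi hj
    rw [hfv, separable_prod_X_sub_C_iff] at hsep
    have hv0 : labelResultant v r ≠ 0 := by
      rw [Ne, labelResultant_eq_zero_iff]
      rintro ⟨k, l, hk, hl, hkl⟩
      rw [hsep hkl, hl] at hk
      simp at hk
    set K := ∑ i, ∑ j, if r i = true ∧ r j = false then 1 else 0 with hK
    have hK0 : K ≠ 0 := by
      rw [hK, Ne, Finset.sum_eq_zero_iff]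
      intro h1
      have h2 := Finset.sum_eq_zero_iff.1 (h1 i (Finset.mem_univ _)) j (Finset.mem_univ _)
      simp [hi, hj, hxt, hyf] at h2
    have h1 : Tendsto (fun z ↦ (z⁻¹) ^ K * (labelResultant (w' z⁻¹) r)⁻¹) 𝒰 (𝓝 0) := by
      have h2 : Tendsto (fun z ↦ labelResultant (w' z⁻¹) r) 𝒰 (𝓝 (labelResultant v r)) :=
        ((differentiable_labelResultant r).continuous.tendsto v).comp (tendsto_pi_nhds.2 hv)
      simpa [hK0] using (hinv.pow K).mul (h2.inv₀ hv0)
    refine h1.congr' ?_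
    filter_upwards [hne, hr] with z ⟨hzJ, hz0⟩ hzr
    rw [hPJ z hzJ, hzr]
    simp only [hz0, if_false]
    rw [labelResultant_mul, mul_inv, inv_pow]
  have h3 := Differentiable.apply_eq_of_tendsto_cocompact (f := fun z ↦ (P z)⁻¹)
    (fun z ↦ (hP z).inv (hP0 z)) 0 hlim
  exact inv_ne_zero (hP0 0) h3

end

section

variable {f f' : ℂ[X][X]} {d : ℕ}

theorem exists_enumeration_by_arg {B : Set ℂ} (hB : B.Finite) (h0 : (0 : ℂ) ∉ B)
    (hinj : InjOn Complex.arg B) (hπ : ∀ z ∈ B, z.arg ≠ Real.pi) :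
    ∃ (n : ℕ) (c : Fin (n + 1) → ℂ), (∀ j, c j ≠ 0) ∧ (StrictMono fun j ↦ (c j).arg) ∧
      (c (Fin.last n)).arg = Real.pi ∧ B ⊆ range c := by
  classical
  set T : Finset ℝ := (insert (-1) hB.toFinset).image Complex.arg with hT
  have hπT : Real.pi ∈ T := by simp [hT]
  obtain ⟨n, hn⟩ : ∃ n, T.card = n + 1 := Nat.exists_eq_succ_of_ne_zero
    (Finset.card_ne_zero_of_mem hπT)
  have hmem (j) : ∃ z ∈ insert (-1) hB.toFinset, z.arg = T.orderEmbOfFin hn j :=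
    Finset.mem_image.1 (T.orderEmbOfFin_mem hn j)
  choose c hcB hc using hmem
  have hsurj {t} (ht : t ∈ T) : ∃ j, (c j).arg = t := by
    have : t ∈ range (T.orderEmbOfFin hn) := by rwa [Finset.range_orderEmbOfFin]
    obtain ⟨j, hj⟩ := this
    exact ⟨j, (hc j).trans hj⟩
  have hmono : StrictMono fun j ↦ (c j).arg := by
    simp only [hc]
    exact (T.orderEmbOfFin hn).strictMono
  refine ⟨n, c, fun j hj ↦ ?_, hmono, ?_, fun z hz ↦ ?_⟩
  · have := hcB j
    simp [hj, h0] at this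
  · obtain ⟨j, hj⟩ := hsurj hπT
    exact le_antisymm (Complex.arg_le_pi _) (hj ▸ hmono.monotone (Fin.le_last j))
  · obtain ⟨j, hj⟩ := hsurj (t := z.arg) (Finset.mem_image_of_mem _ (by simp [hz]))
    refine ⟨j, ?_⟩
    have h1 := hcB j
    simp only [Finset.mem_insert, Finite.mem_toFinset] at h1
    rcases h1 with h1 | h1
    · rw [h1, Complex.arg_neg_one] at hj
      exact absurd hj.symm (hπ z hz)
    · exact hinj h1 hz hj

theorem IsRootVector.separable_iff {w} (hw : IsRootVector f d w) {z : ℂ} :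
    (f.map (evalRingHom z)).Separable ↔ Function.Injective (w z) := by
  rw [hw z, separable_prod_X_sub_C_iff]

theorem IsRootVector.card_fiber {w} (hw : IsRootVector f d w) {z : ℂ}
    (hz : (f.map (evalRingHom z)).Separable) : Nat.card (affineCurve.proj f ⁻¹' {z}) = d := by
  rw [← Nat.card_fin d]
  refine (Nat.card_congr (Equiv.ofBijective
    (fun i ↦ ⟨⟨(z, w z i), hw.mem_affineCurve z i⟩, rfl⟩) ⟨fun i j hij ↦ ?_, ?_⟩)).symm
  · exact hw.separable_iff.1 hz (congrArg (fun p ↦ p.1.1.2) hij)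
  · rintro ⟨⟨⟨z', t⟩, ht⟩, rfl⟩
    obtain ⟨i, hi⟩ := hw.root_iff.1 ht
    exact ⟨i, by simp [affineCurve.proj, hi]⟩

theorem IsReciprocal.separable_iff (h : IsReciprocal d f f') (hf : f.Monic) (hd : f.natDegree = d)
    (hf' : f'.Monic) (hd' : f'.natDegree = d) {z : ℂ} (hz : z ≠ 0) :
    (f.map (evalRingHom z)).Separable ↔ (f'.map (evalRingHom z⁻¹)).Separable := by
  obtain ⟨w₀, hw₀⟩ := exists_isRootVector hf hd
  obtain ⟨w', hw'⟩ := exists_isRootVector hf' hd'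
  rw [(h.isRootVector hw₀ hw').separable_iff, hw'.separable_iff]
  simp only [hz, if_false]
  exact (mul_right_injective₀ hz).of_comp_iff _

theorem finite_not_separable (hf : f.Monic) (hd : f.natDegree = d) (hsm : IsSmoothCurve f) :
    {z | ¬ (f.map (evalRingHom z)).Separable}.Finite := by
  obtain ⟨w, hw⟩ := exists_isRootVector hf hd
  obtain ⟨R, hR⟩ := exists_discriminant hf
  have hR0 := (rootMultiplicity_discriminant hf hsm hw (hR w hw) 0).1
  refine R.rootSet_finite ℂ |>.subset fun z hz ↦ ?_
  rw [mem_rootSet]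
  refine ⟨hR0, by_contra fun h ↦ hz ?_⟩
  rw [coe_aeval_eq_eval, hR w hw, Finset.prod_eq_zero_iff] at h
  push Not at h
  rw [separable_def, isCoprime_iff_aeval_ne_zero_of_isAlgClosed ℂ ℂ]
  intro t
  rw [coe_aeval_eq_eval, derivative_map, map_evalRingHom_eval, map_evalRingHom_eval,
    or_iff_not_imp_left, not_not, hw.root_iff]
  rintro ⟨i, rfl⟩
  exact h i (Finset.mem_univ i)

theorem finrank_additiveCharacters_of_isGluedCover {k X : Type*} [Field k] [TopologicalSpace X]
    (hf : f.Monic) (hd : f.natDegree = d) (hsm : IsSmoothCurve f) (hf' : f'.Monic)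
    (hd' : f'.natDegree = d) (h : IsReciprocal d f f') (hd0 : d ≠ 0)
    (hsep : (f.map (evalRingHom 0)).Separable) (hsep' : (f'.map (evalRingHom 0)).Separable)
    (hinj : InjOn Complex.arg {z | ¬ (f.map (evalRingHom z)).Separable})
    (hπ : ∀ z, ¬ (f.map (evalRingHom z)).Separable → z.arg ≠ Real.pi)
    {ι : affineCurve f → X} {ι' : affineCurve f' → X}
    (hι : IsGluedCover ι ι' (affineCurve.proj f) (affineCurve.proj f')) (x : X) :
    Module.finrank k (additiveCharacters k (FundamentalGroup X x)) + 2 * d = d * (d - 1) + 2 := by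
  obtain ⟨w, hw⟩ := exists_isRootVector hf hd
  obtain ⟨n, c, hc, hmono, hlast, hB⟩ := exists_enumeration_by_arg
    (finite_not_separable hf hd hsm) (by simpa using hsep) hinj hπ
  have hB' : {z | ¬ (f'.map (evalRingHom z)).Separable} ⊆ range c⁻¹ := by
    intro y hy
    have hy0 : y ≠ 0 := by rintro rfl; exact hy hsep'
    obtain ⟨j, hj⟩ := hB (a := y⁻¹) (by
      rw [mem_ofPred_eq, h.separable_iff hf hd hf' hd' (inv_ne_zero hy0), inv_inv]
      exact hy)
    exact ⟨j, by simp [hj]⟩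
  have hcinj : Function.Injective c := fun i j hij ↦ hmono.injective (congrArg Complex.arg hij)
  obtain ⟨D⟩ := hι.exists_sheetDecomposition (affineCurve.isBranchedCover hf (hd ▸ hd0))
    (affineCurve.isBranchedCover hf' (hd' ▸ hd0)) hc hmono hlast hB hB'
    (isPreconnected_preimage hf hd hsm hf' hd' h hsep' (finite_range c) hB)
  have hsum := sum_card_fiber hf hd hsm hf' hd' h hd0 hsep' hcinj hB
  have hfin (z) := (affineCurve.finite_fiber hf z).fintype
  let _ := hfin 0
  let _ (j) := hfin (c j)
  let _ := (affineCurve.finite_fiber hf' 0).fintype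
  have : Nonempty (affineCurve.proj f ⁻¹' {0}) :=
    let ⟨e, he⟩ := affineCurve.surjective_proj hf (hd ▸ hd0) 0
    ⟨⟨e, he⟩⟩
  have hmain := D.finrank_additiveCharacters (k := k) (c := x)
  simp only [← Nat.card_eq_fintype_card, hw.card_fiber hsep] at hmain
  lia

end

theorem finrank_additiveCharacters_of_mulEquiv {k G : Type*} [Field k] [Group G] {m : ℕ}
    (e : Abelianization G ≃* Multiplicative (Fin m → ℤ)) :
    Module.finrank k (additiveCharacters k G) = m := by
  classical
  let Φ : (Fin m → k) →ₗ[k] additiveCharacters k G :=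
    { toFun a := ⟨fun g ↦ ∑ i, ((e (.of g)).toAdd i : k) * a i, fun g g' ↦ by
        simp [add_mul, Finset.sum_add_distrib]⟩
      map_add' a b := by
        ext g
        simp [mul_add, Finset.sum_add_distrib]
      map_smul' r a := by
        ext g
        simp [Finset.mul_sum, mul_left_comm] }
  have hg (i : Fin m) : ∃ g : G, (e (.of g)).toAdd = Pi.single i 1 := by
    obtain ⟨g, hg⟩ := QuotientGroup.mk_surjective (e.symm (.ofAdd (Pi.single i 1)))
    exact ⟨g, by
      rw [show Abelianization.of g = _ from hg]
      simp⟩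
  choose g hg using hg
  have hinj : Function.Injective Φ := fun a b hab ↦ by
    ext i
    have := congrFun (congrArg Subtype.val hab) (g i)
    simpa [Φ, hg, Pi.single_apply] using this
  have hsurj : Function.Surjective Φ := fun h ↦ by
    refine ⟨fun i ↦ h.1 (g i), ?_⟩
    let H : G →* Multiplicative k :=
      { toFun x := .ofAdd (h.1 x)
        map_one' := by
          have := h.2 1 1
          rw [mul_one, left_eq_add] at this
          rw [this, ofAdd_zero]
        map_mul' x y := by rw [h.2 x y, ofAdd_add] }
    let K : (Fin m → ℤ) →+ k :=
      AddMonoidHom.toMultiplicative.symm ((Abelianization.lift H).comp e.symm.toMonoidHom)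
    have hK (x) : h.1 x = K (e (.of x)).toAdd := by
      simp [K, H]
    ext x
    rw [hK]
    have : K = ∑ i, (AddMonoidHom.mulRight (h.1 (g i))).comp
        ((Int.castAddHom k).comp (Pi.evalAddMonoidHom (fun _ : Fin m ↦ ℤ) i)) := by
      refine AddMonoidHom.functions_ext' _ _ _ fun i ↦ AddMonoidHom.ext_int ?_
      simp [← hg, ← hK]
      simp [hg, Pi.single_apply]
    rw [this]
    simp [Φ]
  rw [← (LinearEquiv.ofBijective Φ ⟨hinj, hsurj⟩).finrank_eq, Module.finrank_fin_fun]

theorem exists_translate_arg_injOn {B : Set ℂ} (hB : B.Finite) :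
    ∃ p ∉ B, InjOn (fun z ↦ (z - p).arg) B ∧ ∀ z ∈ B, (z - p).arg ≠ Real.pi := by
  obtain ⟨h, hh⟩ := (hB.image Complex.im).infinite_compl.nonempty
  have him {z} (hz : z ∈ B) : z.im - h ≠ 0 := fun h0 ↦ hh ⟨z, hz, by linarith⟩
  obtain ⟨x, hx⟩ : (⋃ z ∈ B, ⋃ z' ∈ B, {x : ℝ | z ≠ z' ∧
      (z - (⟨x, h⟩ : ℂ)).arg = (z' - (⟨x, h⟩ : ℂ)).arg})ᶜ.Nonempty := by
    refine (hB.biUnion fun z hz ↦ hB.biUnion fun z' hz' ↦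
      Subsingleton.finite ?_).infinite_compl.nonempty
    have key {x : ℝ} (ha : (z - (⟨x, h⟩ : ℂ)).arg = (z' - (⟨x, h⟩ : ℂ)).arg) :
        (z.re - x) * (z'.im - h) = (z.im - h) * (z'.re - x) := by
      have h1 := Complex.norm_mul_cos_arg (z - (⟨x, h⟩ : ℂ))
      have h2 := Complex.norm_mul_sin_arg (z - (⟨x, h⟩ : ℂ))
      have h3 := Complex.norm_mul_cos_arg (z' - (⟨x, h⟩ : ℂ))
      have h4 := Complex.norm_mul_sin_arg (z' - (⟨x, h⟩ : ℂ))
      rw [ha] at h1 h2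
      simp only [Complex.sub_re, Complex.sub_im] at h1 h2 h3 h4
      rw [← h1, ← h2, ← h3, ← h4]
      ring
    rintro x ⟨hne, hx⟩ y ⟨-, hy⟩
    have hx' := key hx
    have hy' := key hy
    by_cases hii : z.im = z'.im
    · rw [hii, mul_comm] at hx'
      exact absurd (Complex.ext (by linarith [mul_left_cancel₀ (him hz') hx']) hii) hne
    · refine mul_right_cancel₀ (sub_ne_zero.2 hii) ?_
      linarith
  refine ⟨⟨x, h⟩, fun hp ↦ him hp (sub_self h), fun z hz z' hz' hzz ↦ ?_, fun z hz hp ↦ ?_⟩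
  · by_contra hne
    exact hx (mem_biUnion hz (mem_biUnion hz' ⟨hne, hzz⟩))
  · exact him hz (Complex.arg_eq_pi_iff.1 hp).2

section

variable {d : ℕ} {F : MvPolynomial (Fin 3) ℂ}

/-- The affine equation of the plane curve `F = 0` in the chart `(z, w) ↦ [z a + b + w c]`. -/
noncomputable def chartEquation (F : MvPolynomial (Fin 3) ℂ) (a b c : Fin 3 → ℂ) : ℂ[X][X] :=
  MvPolynomial.aeval (fun i ↦ C (C (a i) * X + C (b i)) + C (C (c i)) * X) F

theorem evalEval_chartEquation (F : MvPolynomial (Fin 3) ℂ) (a b c : Fin 3 → ℂ) (z w : ℂ) :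
    (chartEquation F a b c).evalEval z w = F.eval (z • a + b + w • c) := by
  induction F using MvPolynomial.induction_on with
  | C r => simp [chartEquation]
  | add p q hp hq => simp_all [chartEquation, evalEval_add]
  | mul_X p i hp =>
    simp only [chartEquation, map_mul, MvPolynomial.aeval_X, evalEval_mul] at hp ⊢
    rw [hp]
    simp only [evalEval_add, evalEval_mul, evalEval_C, evalEval_X, eval_add, eval_mul, eval_C,
      eval_X, MvPolynomial.eval_X, Pi.add_apply, Pi.smul_apply, smul_eq_mul]
    ring

theorem _root_.MvPolynomial.IsHomogeneous.sum_eq (hF : F.IsHomogeneous d) {m : Fin 3 →₀ ℕ}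
    (hm : m ∈ F.support) : ∑ i, m i = d := by
  rw [← hF (MvPolynomial.mem_support_iff.1 hm), ← Finsupp.degree_eq_sum,
    Finsupp.degree_eq_weight_one]
  rfl

theorem _root_.MvPolynomial.IsHomogeneous.eval_smul (hF : F.IsHomogeneous d) (r : ℂ)
    (v : Fin 3 → ℂ) : F.eval (r • v) = r ^ d * F.eval v := by
  rw [MvPolynomial.eval_eq', MvPolynomial.eval_eq', Finset.mul_sum]
  refine Finset.sum_congr rfl fun m hm ↦ ?_
  simp only [Pi.smul_apply, smul_eq_mul, mul_pow, Finset.prod_mul_distrib,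
    Finset.prod_pow_eq_pow_sum, hF.sum_eq hm]
  ring

theorem coeff_chartEquation (hF : F.IsHomogeneous d) (a b c : Fin 3 → ℂ) :
    (chartEquation F a b c).natDegree ≤ d ∧ (chartEquation F a b c).coeff d = C (F.eval c) := by
  set l : Fin 3 → ℂ[X][X] := fun i ↦ C (C (a i) * X + C (b i)) + C (C (c i)) * X with hl
  have hlin (i : Fin 3) (n : ℕ) :
      (l i ^ n).natDegree ≤ n ∧ (l i ^ n).coeff n = C (c i ^ n) := by
    have h1 : (l i).natDegree ≤ 1 := by
      exact (natDegree_add_le _ _).trans (max_le (by rw [natDegree_C]; exact zero_le_one)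
        ((natDegree_C_mul_le _ _).trans natDegree_X_le))
    refine ⟨by simpa using natDegree_pow_le_of_le n h1, ?_⟩
    have := coeff_pow_of_natDegree_le h1 (m := n)
    rw [mul_one] at this
    rw [this]
    simp [hl]
  have hmon (m : Fin 3 →₀ ℕ) : (∏ i, l i ^ m i).natDegree ≤ ∑ i, m i ∧
      (∏ i, l i ^ m i).coeff (∑ i, m i) = C (∏ i, c i ^ m i) := by
    simp only [Fin.prod_univ_three, Fin.sum_univ_three]
    have h01 := natDegree_mul_le_of_le (hlin 0 (m 0)).1 (hlin 1 (m 1)).1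
    refine ⟨natDegree_mul_le_of_le h01 (hlin 2 (m 2)).1, ?_⟩
    rw [coeff_mul_add_eq_of_natDegree_le h01 (hlin 2 (m 2)).1,
      coeff_mul_add_eq_of_natDegree_le (hlin 0 (m 0)).1 (hlin 1 (m 1)).1, (hlin 0 _).2,
      (hlin 1 _).2, (hlin 2 _).2, C_mul, C_mul]
  have hsum : chartEquation F a b c = ∑ m ∈ F.support, C (C (F.coeff m)) * ∏ i, l i ^ m i :=
    MvPolynomial.eval₂_eq' _ _ _
  rw [hsum, MvPolynomial.eval_eq']
  refine ⟨natDegree_sum_le_of_forall_le _ _ fun m hm ↦ ?_, ?_⟩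
  · exact (natDegree_C_mul_le _ _).trans ((hmon m).1.trans_eq (hF.sum_eq hm))
  · rw [finsetSum_coeff, map_sum]
    refine Finset.sum_congr rfl fun m hm ↦ ?_
    rw [coeff_C_mul, C_mul, ← (hmon m).2, hF.sum_eq hm]

theorem natDegree_chartEquation (hF : F.IsHomogeneous d) (a b : Fin 3 → ℂ) {c : Fin 3 → ℂ}
    (hc : F.eval c = 1) : (chartEquation F a b c).natDegree = d :=
  natDegree_eq_of_le_of_coeff_ne_zero (coeff_chartEquation hF a b c).1 (by
    simp [(coeff_chartEquation hF a b c).2, hc])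

theorem monic_chartEquation (hF : F.IsHomogeneous d) (a b : Fin 3 → ℂ) {c : Fin 3 → ℂ}
    (hc : F.eval c = 1) : (chartEquation F a b c).Monic := by
  rw [Monic, leadingCoeff, natDegree_chartEquation hF a b hc, (coeff_chartEquation hF a b c).2, hc,
    C_1]

theorem isReciprocal_chartEquation (hF : F.IsHomogeneous d) (a b c : Fin 3 → ℂ) :
    IsReciprocal d (chartEquation F a b c) (chartEquation F b a c) := by
  intro z w hz
  rw [evalEval_chartEquation, evalEval_chartEquation, ← hF.eval_smul, smul_add, smul_add,
    smul_smul, smul_smul, mul_inv_cancel₀ hz, one_smul, mul_inv_cancel_left₀ hz,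
    add_comm b]

theorem hasDerivAt_eval (F : MvPolynomial (Fin 3) ℂ) (u v : Fin 3 → ℂ) (t : ℂ) :
    HasDerivAt (fun s : ℂ ↦ F.eval (u + s • v))
      (∑ i, v i * (MvPolynomial.pderiv i F).eval (u + t • v)) t := by
  induction F using MvPolynomial.induction_on with
  | C r => simpa using hasDerivAt_const _ _
  | add p q hp hq =>
    simp only [map_add, mul_add, Finset.sum_add_distrib]
    exact hp.add hq
  | mul_X p i hp =>
    have h1 : HasDerivAt (fun s : ℂ ↦ u i + s * v i) (v i) t := by
      simpa using ((hasDerivAt_id t).mul_const (v i)).const_add (u i)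
    have h2 := hp.mul h1
    simp only [map_mul, MvPolynomial.eval_X]
    refine h2.congr_deriv ?_
    simp only [MvPolynomial.pderiv_mul, MvPolynomial.pderiv_X, map_add (MvPolynomial.eval _),
      map_mul, mul_add (v _), Finset.sum_add_distrib, MvPolynomial.eval_X]
    congr 1
    · rw [Finset.sum_mul]
      exact Finset.sum_congr rfl fun j _ ↦ mul_assoc _ _ _
    · rw [Finset.sum_eq_single i]
      · simp [mul_comm]
      · intro j _ hj
        simp [hj.symm]
      · simp

theorem isSmoothCurve_chartEquation (hF : F.IsHomogeneous d)
    (hsmooth : ∀ v : Fin 3 → ℂ, v ≠ 0 → F.eval v = 0 → ∃ i, (MvPolynomial.pderiv i F).eval v ≠ 0)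
    {a b c : Fin 3 → ℂ} (hdet : (Matrix.of ![a, b, c]).det ≠ 0) :
    IsSmoothCurve (chartEquation F a b c) := by
  intro z w h0 hw hz
  set v := z • a + b + w • c with hv
  set q : Fin 3 → ℂ := fun i ↦ (MvPolynomial.pderiv i F).eval v with hq
  rw [evalEval_chartEquation, ← hv] at h0
  have hc : ∑ i, c i * q i = 0 := by
    rw [← hw]
    refine (hasDerivAt_eval F (z • a + b) c w).unique ?_
    simpa only [evalEval_chartEquation] using
      (chartEquation F a b c).hasDerivAt_evalEval_right z w
  have ha : ∑ i, a i * q i = 0 := by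
    rw [← hz]
    have h1 := (((chartEquation F a b c).eval (C w))).hasDerivAt z
    have h2 := hasDerivAt_eval F (b + w • c) a z
    have h3 : ∀ s : ℂ, b + w • c + s • a = s • a + b + w • c := fun s ↦ by abel
    simp only [h3] at h2
    refine h2.unique ?_
    simpa only [← evalEval_chartEquation] using h1
  have hE : ∑ i, v i * q i = 0 := by
    have := congrArg (MvPolynomial.eval v) hF.sum_X_mul_pderiv
    simpa [h0, hq] using this
  have hb : ∑ i, b i * q i = 0 := by
    simp only [hv, Pi.add_apply, Pi.smul_apply, smul_eq_mul, add_mul, Finset.sum_add_distrib,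
      mul_assoc, ← Finset.mul_sum, ha, hc] at hE
    simpa using hE
  have hv0 : v ≠ 0 := by
    intro h
    have h1 : Matrix.vecMul ![z, 1, w] (Matrix.of ![a, b, c]) = 0 := by
      rw [← h, hv]
      ext i
      simp [Matrix.vecMul, dotProduct, Fin.sum_univ_three]
    have := congrFun (Matrix.eq_zero_of_vecMul_eq_zero hdet h1) 1
    simp at this
  have hq0 : q = 0 := by
    refine Matrix.eq_zero_of_mulVec_eq_zero hdet ?_
    ext i
    fin_cases i <;> simpa [Matrix.mulVec, dotProduct]
  obtain ⟨i, hi⟩ := hsmooth v hv0 h0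
  exact hi (congrFun hq0 i)

end

section

variable {d : ℕ} {F : MvPolynomial (Fin 3) ℂ}

theorem map_evalRingHom_congr {f g : ℂ[X][X]} {z z' : ℂ}
    (h : ∀ w, f.evalEval z w = g.evalEval z' w) :
    f.map (evalRingHom z) = g.map (evalRingHom z') :=
  Polynomial.funext fun w ↦ by rw [map_evalRingHom_eval, map_evalRingHom_eval, h]

theorem exists_det_ne_zero {c : Fin 3 → ℂ} (hc : c ≠ 0) :
    ∃ a b : Fin 3 → ℂ, (Matrix.of ![a, b, c]).det ≠ 0 := by
  obtain ⟨i, hi⟩ := Function.ne_iff.1 hc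
  refine ⟨Pi.single (i + 1) 1, Pi.single (i + 2) 1, ?_⟩
  fin_cases i <;> simpa [Matrix.det_fin_three, Pi.single_apply] using hi

/-- A smooth plane curve has an affine chart whose projection to the first coordinate is unramified
over `0` and `∞` and has branch values with pairwise distinct arguments, all different from `π`. -/
theorem exists_chart (hd : d ≠ 0) (hF : F.IsHomogeneous d) (hF0 : F ≠ 0)
    (hsmooth : ∀ v : Fin 3 → ℂ, v ≠ 0 → F.eval v = 0 →
      ∃ i, (MvPolynomial.pderiv i F).eval v ≠ 0) :
    ∃ a b c : Fin 3 → ℂ, (Matrix.of ![a, b, c]).det ≠ 0 ∧ F.eval c = 1 ∧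
      ((chartEquation F a b c).map (evalRingHom 0)).Separable ∧
      ((chartEquation F b a c).map (evalRingHom 0)).Separable ∧
      InjOn Complex.arg {z | ¬ ((chartEquation F a b c).map (evalRingHom z)).Separable} ∧
      ∀ z, ¬ ((chartEquation F a b c).map (evalRingHom z)).Separable → z.arg ≠ Real.pi := by
  obtain ⟨v, hv⟩ : ∃ v, F.eval v ≠ 0 := by
    by_contra! h
    exact hF0 (MvPolynomial.funext fun v ↦ by simpa using h v)
  obtain ⟨μ, hμ⟩ := IsAlgClosed.exists_pow_nat_eq (F.eval v)⁻¹ hd.bot_lt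
  set c := μ • v with hcv
  have hc : F.eval c = 1 := by rw [hcv, hF.eval_smul, hμ, inv_mul_cancel₀ hv]
  have hc0 : c ≠ 0 := by
    rintro h
    have := hF.eval_smul 0 c
    rw [zero_smul, zero_pow hd, zero_mul, ← h, hc] at this
    exact one_ne_zero this
  obtain ⟨a₀, b₀, hdet⟩ := exists_det_ne_zero hc0
  obtain ⟨s, hs⟩ := (finite_not_separable (monic_chartEquation hF a₀ b₀ hc)
    (natDegree_chartEquation hF a₀ b₀ hc)
    (isSmoothCurve_chartEquation hF hsmooth hdet)).infinite_compl.nonempty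
  rw [mem_compl_iff, mem_ofPred_eq, not_not] at hs
  have hdet' : (Matrix.of ![s • a₀ + b₀, a₀, c]).det ≠ 0 := by
    refine fun h ↦ hdet ?_
    simp [Matrix.det_fin_three] at h ⊢
    linear_combination -h
  set a := s • a₀ + b₀ with ha
  obtain ⟨p, hpB, hpinj, hpπ⟩ := exists_translate_arg_injOn
    (finite_not_separable (monic_chartEquation hF a a₀ hc)
    (natDegree_chartEquation hF a a₀ hc) (isSmoothCurve_chartEquation hF hsmooth hdet'))
  have hmap (z : ℂ) : (chartEquation F a (a₀ + p • a) c).map (evalRingHom z) =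
      (chartEquation F a a₀ c).map (evalRingHom (z + p)) :=
    map_evalRingHom_congr fun w ↦ by
      rw [evalEval_chartEquation, evalEval_chartEquation]
      congr 2
      module
  rw [mem_ofPred_eq, not_not] at hpB
  refine ⟨a, a₀ + p • a, c, fun h ↦ hdet' ?_, hc, ?_, ?_, fun z hz z' hz' h ↦ ?_, fun z hz h ↦ ?_⟩
  · simp [Matrix.det_fin_three] at h ⊢
    linear_combination h
  · rwa [hmap, zero_add]
  · convert hs using 1
    refine map_evalRingHom_congr fun w ↦ ?_
    rw [evalEval_chartEquation, evalEval_chartEquation, zero_smul, zero_add]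
  · rw [mem_ofPred_eq, hmap] at hz hz'
    exact add_right_cancel (hpinj hz hz' (by simpa using h))
  · rw [hmap] at hz
    exact hpπ _ hz (by simpa using h)

end

end Polynomial

section

open Set Topology Filter Polynomial

variable {d : ℕ} {F : MvPolynomial (Fin 3) ℂ} {a b c : Fin 3 → ℂ}

theorem vecMul_of_vec (t : Fin 3 → ℂ) :
    Matrix.vecMul t (Matrix.of ![a, b, c]) = t 0 • a + t 1 • b + t 2 • c := by
  ext i
  simp [Matrix.vecMul, dotProduct, Fin.sum_univ_three]

/-- The coordinates of a vector with respect to the basis `a, b, c`. -/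
noncomputable def basisCoord (a b c x : Fin 3 → ℂ) : Fin 3 → ℂ :=
  Matrix.vecMul x (Matrix.of ![a, b, c])⁻¹

theorem basisCoord_smul (r : ℂ) (x : Fin 3 → ℂ) :
    basisCoord a b c (r • x) = r • basisCoord a b c x :=
  Matrix.smul_vecMul _ _ _

theorem continuous_basisCoord : Continuous (basisCoord a b c) :=
  continuous_id.matrix_vecMul continuous_const

theorem basisCoord_sum (hdet : (Matrix.of ![a, b, c]).det ≠ 0) (t : Fin 3 → ℂ) :
    basisCoord a b c (t 0 • a + t 1 • b + t 2 • c) = t := by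
  rw [basisCoord, ← vecMul_of_vec, Matrix.vecMul_vecMul,
    Matrix.mul_nonsing_inv _ (isUnit_iff_ne_zero.2 hdet), Matrix.vecMul_one]

theorem sum_basisCoord (hdet : (Matrix.of ![a, b, c]).det ≠ 0) (x : Fin 3 → ℂ) :
    basisCoord a b c x 0 • a + basisCoord a b c x 1 • b + basisCoord a b c x 2 • c = x := by
  rw [basisCoord, ← vecMul_of_vec, Matrix.vecMul_vecMul,
    Matrix.nonsing_inv_mul _ (isUnit_iff_ne_zero.2 hdet), Matrix.vecMul_one]

theorem basisCoord_chart (hdet : (Matrix.of ![a, b, c]).det ≠ 0) (z w : ℂ) :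
    basisCoord a b c (z • a + b + w • c) = ![z, 1, w] := by
  simpa using basisCoord_sum hdet ![z, 1, w]

theorem chart_ne_zero (hdet : (Matrix.of ![a, b, c]).det ≠ 0) (z w : ℂ) :
    z • a + b + w • c ≠ 0 := by
  intro h
  have h1 := basisCoord_chart hdet z w
  rw [h, basisCoord, Matrix.zero_vecMul] at h1
  simpa using congrFun h1 1

/-- The affine chart `(z, w) ↦ [z a + b + w c]` of the projective plane. -/
noncomputable def chartMap (hdet : (Matrix.of ![a, b, c]).det ≠ 0) (e : ℂ × ℂ) :
    Projectivization ℂ (Fin 3 → ℂ) :=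
  .mk ℂ (e.1 • a + b + e.2 • c) (chart_ne_zero hdet _ _)

theorem mk_eq_chartMap_iff (hdet : (Matrix.of ![a, b, c]).det ≠ 0) {x : Fin 3 → ℂ} (hx : x ≠ 0)
    (e : ℂ × ℂ) : .mk ℂ x hx = chartMap hdet e ↔ basisCoord a b c x 1 ≠ 0 ∧
      (basisCoord a b c x 0 / basisCoord a b c x 1, basisCoord a b c x 2 / basisCoord a b c x 1) =
        e := by
  rw [chartMap, Projectivization.mk_eq_mk_iff']
  constructor
  · rintro ⟨r, rfl⟩
    have hr : r ≠ 0 := fun h ↦ hx (by rw [h, zero_smul])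
    rw [basisCoord_smul, basisCoord_chart hdet]
    simp [hr]
  · rintro ⟨h1, rfl⟩
    refine ⟨basisCoord a b c x 1, ?_⟩
    conv_rhs => rw [← sum_basisCoord hdet x]
    simp only [smul_add, smul_smul, mul_div_cancel₀ _ h1]

theorem isOpenEmbedding_chartMap (hdet : (Matrix.of ![a, b, c]).det ≠ 0) :
    IsOpenEmbedding (chartMap hdet) := by
  refine .of_continuous_injective_isOpenMap ?_ (fun e e' h ↦ ?_) fun W hW ↦ ?_
  · refine continuous_quot_mk.comp (Continuous.subtype_mk ?_ _)
    fun_prop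
  · have := ((mk_eq_chartMap_iff hdet (chart_ne_zero hdet e.1 e.2) e').1 h).2
    simpa [basisCoord_chart hdet] using this
  · refine isOpen_coinduced.2 ?_
    have hpre : {x : {v : Fin 3 → ℂ // v ≠ 0} | basisCoord a b c x 1 ≠ 0 ∧
        (basisCoord a b c x 0 / basisCoord a b c x 1,
          basisCoord a b c x 2 / basisCoord a b c x 1) ∈ W} =
        Quotient.mk (projectivizationSetoid ℂ (Fin 3 → ℂ)) ⁻¹' (chartMap hdet '' W) := by
      ext ⟨x, hx⟩
      have hmk : Quotient.mk (projectivizationSetoid ℂ (Fin 3 → ℂ)) ⟨x, hx⟩ =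
          Projectivization.mk ℂ x hx := rfl
      simp only [mem_preimage, hmk, mem_ofPred_eq]
      constructor
      · rintro ⟨h1, h2⟩
        exact ⟨_, h2, ((mk_eq_chartMap_iff hdet hx _).2 ⟨h1, rfl⟩).symm⟩
      · rintro ⟨e, he, h⟩
        obtain ⟨h1, rfl⟩ := (mk_eq_chartMap_iff hdet hx e).1 h.symm
        exact ⟨h1, he⟩
    refine hpre ▸ ?_
    have hcoord (i : Fin 3) : Continuous fun x : {v : Fin 3 → ℂ // v ≠ 0} ↦ basisCoord a b c x i :=
      (continuous_apply i).comp (continuous_basisCoord.comp continuous_subtype_val)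
    have hU : IsOpen {x : {v : Fin 3 → ℂ // v ≠ 0} | basisCoord a b c x 1 ≠ 0} :=
      isOpen_ne_fun (hcoord 1) continuous_const
    refine ContinuousOn.isOpen_inter_preimage (f := fun x : {v : Fin 3 → ℂ // v ≠ 0} ↦
      (basisCoord a b c x 0 / basisCoord a b c x 1, basisCoord a b c x 2 / basisCoord a b c x 1))
      ?_ hU hW
    exact ((hcoord 0).continuousOn.div (hcoord 1).continuousOn fun x hx ↦ hx).prodMk
      ((hcoord 2).continuousOn.div (hcoord 1).continuousOn fun x hx ↦ hx)

theorem eval_rep_mk_eq_zero_iff (hF : F.IsHomogeneous d) {x : Fin 3 → ℂ} (hx : x ≠ 0) :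
    MvPolynomial.eval (Projectivization.mk ℂ x hx).rep F = 0 ↔ MvPolynomial.eval x F = 0 := by
  obtain ⟨r, hr⟩ := Projectivization.exists_smul_eq_mk_rep ℂ x hx
  rw [← hr, Units.smul_def, hF.eval_smul]
  simp

variable (F) in
/-- The plane curve `F = 0`. -/
def planeCurve : Set (Projectivization ℂ (Fin 3 → ℂ)) :=
  {p | MvPolynomial.eval p.rep F = 0}

theorem chartMap_mem_planeCurve_iff (hF : F.IsHomogeneous d)
    (hdet : (Matrix.of ![a, b, c]).det ≠ 0) (e : ℂ × ℂ) :
    chartMap hdet e ∈ planeCurve F ↔ e ∈ affineCurve (chartEquation F a b c) := by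
  rw [planeCurve, mem_ofPred_eq, chartMap, eval_rep_mk_eq_zero_iff hF, ← evalEval_chartEquation]
  rfl

/-- The part of a plane curve inside an affine chart. -/
noncomputable def curveChart (hF : F.IsHomogeneous d) (hdet : (Matrix.of ![a, b, c]).det ≠ 0)
    (e : affineCurve (chartEquation F a b c)) : planeCurve F :=
  ⟨chartMap hdet e, (chartMap_mem_planeCurve_iff hF hdet e).2 e.2⟩

theorem isOpenEmbedding_curveChart (hF : F.IsHomogeneous d)
    (hdet : (Matrix.of ![a, b, c]).det ≠ 0) : IsOpenEmbedding (curveChart hF hdet) := by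
  have h1 : affineCurve (chartEquation F a b c) = chartMap hdet ⁻¹' planeCurve F :=
    Set.ext fun e ↦ (chartMap_mem_planeCurve_iff hF hdet e).symm
  have h2 := (isOpenEmbedding_chartMap hdet).restrictPreimage (planeCurve F)
  exact h2.comp (Homeomorph.setCongr h1).isOpenEmbedding

theorem mk_eq_curveChart_iff (hF : F.IsHomogeneous d) (hdet : (Matrix.of ![a, b, c]).det ≠ 0)
    {x : Fin 3 → ℂ} (hx : x ≠ 0) (hxF : Projectivization.mk ℂ x hx ∈ planeCurve F) :
    (⟨Projectivization.mk ℂ x hx, hxF⟩ : planeCurve F) ∈ range (curveChart hF hdet) ↔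
      basisCoord a b c x 1 ≠ 0 := by
  constructor
  · rintro ⟨e, he⟩
    exact ((mk_eq_chartMap_iff hdet hx e).1 (congrArg Subtype.val he).symm).1
  · intro h1
    have h2 := (mk_eq_chartMap_iff hdet hx _).2 ⟨h1, rfl⟩
    exact ⟨⟨_, (chartMap_mem_planeCurve_iff hF hdet _).1 (h2 ▸ hxF)⟩, Subtype.ext h2.symm⟩

theorem basisCoord_swap (hdet : (Matrix.of ![a, b, c]).det ≠ 0)
    (hdet' : (Matrix.of ![b, a, c]).det ≠ 0) (x : Fin 3 → ℂ) :
    basisCoord b a c x = ![basisCoord a b c x 1, basisCoord a b c x 0, basisCoord a b c x 2] := by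
  conv_lhs => rw [← sum_basisCoord hdet x, add_comm (_ • a)]
  exact basisCoord_sum hdet' ![_, _, _]

theorem isGluedCover_curveChart (hF : F.IsHomogeneous d) (hc : MvPolynomial.eval c F ≠ 0)
    (hdet : (Matrix.of ![a, b, c]).det ≠ 0) (hdet' : (Matrix.of ![b, a, c]).det ≠ 0) :
    IsGluedCover (curveChart hF hdet) (curveChart hF hdet')
      (affineCurve.proj (chartEquation F a b c)) (affineCurve.proj (chartEquation F b a c)) where
  isOpenEmbedding := isOpenEmbedding_curveChart hF hdet
  isOpenEmbedding' := isOpenEmbedding_curveChart hF hdet'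
  cover := by
    rintro ⟨p, hp⟩
    induction p using Projectivization.ind with
    | h x hx =>
      rw [mk_eq_curveChart_iff hF hdet hx hp, mk_eq_curveChart_iff hF hdet' hx hp,
        basisCoord_swap hdet hdet']
      by_contra! h
      have h1 := sum_basisCoord hdet x
      simp only [Matrix.cons_val_one, Matrix.cons_val_zero] at h
      rw [h.1, h.2, zero_smul, zero_smul, zero_add, zero_add] at h1
      have h2 := (eval_rep_mk_eq_zero_iff hF hx).1 hp
      rw [← h1, hF.eval_smul] at h2
      refine hx ?_
      rcases mul_eq_zero.1 h2 with h3 | h3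
      · rw [← h1, eq_zero_of_pow_eq_zero h3, zero_smul]
      · exact absurd h3 hc
  eq_inv e e' h := by
    have h1 := (mk_eq_chartMap_iff hdet' _ e'.1).1 (congrArg Subtype.val h)
    rw [basisCoord_swap hdet hdet', basisCoord_chart hdet] at h1
    exact ⟨h1.1, by simpa [affineCurve.proj] using (congrArg Prod.fst h1.2).symm⟩
  exists_right e he := by
    obtain ⟨e', he'⟩ := (mk_eq_curveChart_iff hF hdet' (chart_ne_zero hdet e.1.1 e.1.2)
      (curveChart hF hdet e).2).2 (by rwa [basisCoord_swap hdet hdet', basisCoord_chart hdet])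
    exact ⟨e', he'.symm⟩
  exists_left e he := by
    refine (mk_eq_curveChart_iff hF hdet (chart_ne_zero hdet' e.1.1 e.1.2)
      (curveChart hF hdet' e).2).2 ?_
    rwa [basisCoord_swap hdet' hdet, basisCoord_chart hdet']

end

/-- A non-singular plane curve of degree `d ≥ 1` in the complex
projective plane, i.e. the zero locus `C` of a nonzero homogeneous polynomial
`F` of degree `d` in three variables with no singular points, has genus
`g = (1/2)(d-1)(d-2)`.  The genus is its topological genus as a compact
Riemann surface; it is characterized by the first homology of `C`, namely the
abelianized fundamental group, being free abelian of rank `2g`. -/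
theorem genus_of_smooth_plane_curve (d g : ℕ) (hd : 1 ≤ d)
    (F : MvPolynomial (Fin 3) ℂ) (hF : F.IsHomogeneous d) (hF0 : F ≠ 0)
    (hsmooth : ∀ v : Fin 3 → ℂ, v ≠ 0 → eval v F = 0 →
      ∃ i : Fin 3, eval v (pderiv i F) ≠ 0)
    (C : Set (Projectivization ℂ (Fin 3 → ℂ)))
    (hC : C = {p : Projectivization ℂ (Fin 3 → ℂ) | eval p.rep F = 0})
    (c : C)
    (e : Abelianization (FundamentalGroup C c) ≃* Multiplicative (Fin (2 * g) → ℤ)) :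
    2 * g = (d - 1) * (d - 2) := by
  obtain ⟨a, b, v, hdet, hv, hsep, hsep', hinj, hπ⟩ :=
    Polynomial.exists_chart (Nat.one_le_iff_ne_zero.1 hd) hF hF0 hsmooth
  have hdet' : (Matrix.of ![b, a, v]).det ≠ 0 := fun h ↦ hdet <| by
    simp [Matrix.det_fin_three] at h ⊢
    linear_combination -h
  have hcover : C = planeCurve F := hC
  subst hcover
  have h1 := Polynomial.finrank_additiveCharacters_of_isGluedCover (k := ℚ)
    (Polynomial.monic_chartEquation hF a b hv) (Polynomial.natDegree_chartEquation hF a b hv)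
    (Polynomial.isSmoothCurve_chartEquation hF hsmooth hdet)
    (Polynomial.monic_chartEquation hF b a hv)
    (Polynomial.natDegree_chartEquation hF b a hv) (Polynomial.isReciprocal_chartEquation hF a b v)
    (Nat.one_le_iff_ne_zero.1 hd) hsep hsep' hinj hπ
    (isGluedCover_curveChart hF (by simp [hv]) hdet hdet') c
  rw [Polynomial.finrank_additiveCharacters_of_mulEquiv e] at h1
  obtain ⟨m, rfl⟩ := Nat.exists_eq_add_of_le' hd
  rcases m with - | m
  · lia
  · simp only [Nat.add_sub_cancel, show m + 1 + 1 - 2 = m by lia] at h1 ⊢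
    nlinarith
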